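/- Let n ≥ 3 and let Q be a real quadratic form on ℝⁿ. Assume Q is nondegenerate, indefinite, and not a real scalar multiple of a quadratic form with integer coefficients. Then the set Q(𝒫) is dense in ℝ, where 𝒫 = {(m₁,…,mₙ) ∈ ℤⁿ : gcd(m₁,…,mₙ) = 1} is the set of primitive integer vectors. -/

import Mathlib

namespace Opp
open Matrix Filter Topology

set_option linter.all false

abbrev M3 := Matrix (Fin 3) (Fin 3) ℝ
abbrev G := Matrix.SpecialLinearGroup (Fin 3) ℝ
abbrev Gam := Matrix.SpecialLinearGroup (Fin 3) ℤ

def io : Gam →* G := Matrix.SpecialLinearGroup.map (Int.castRingHom ℝ)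

def J : M3 := !![0,0,1;0,-1,0;1,0,0]
def E33 : M3 := !![0,0,0;0,0,0;0,0,1]
def act (F : M3) (g : G) : M3 := (g : M3)ᵀ * F * (g : M3)

noncomputable def v1 (t : ℝ) : G := ⟨!![1,t,t^2/2;0,1,t;0,0,1], by simp [Matrix.det_fin_three]⟩
def v2 (t : ℝ) : G := ⟨!![1,0,t;0,1,0;0,0,1], by simp [Matrix.det_fin_three]⟩
noncomputable def dg (a : ℝ) (ha : a ≠ 0) : G :=
  ⟨!![a,0,0;0,1,0;0,0,a⁻¹], by simp [Matrix.det_fin_three, ha]⟩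
def co (g : G) : G := (g⁻¹).transpose
def JG : G := ⟨J, by simp [J, Matrix.det_fin_three]⟩

lemma v1_coe (t : ℝ) : ((v1 t : G) : M3) = !![1,t,t^2/2;0,1,t;0,0,1] := rfl
lemma v2_coe (t : ℝ) : ((v2 t : G) : M3) = !![1,0,t;0,1,0;0,0,1] := rfl
lemma dg_coe (a : ℝ) (ha : a ≠ 0) : ((dg a ha : G) : M3) = !![a,0,0;0,1,0;0,0,a⁻¹] := rfl
lemma JG_coe : ((JG : G) : M3) = !![0,0,1;0,-1,0;1,0,0] := rfl

lemma Gext {g h : G} (e : (g : M3) = (h : M3)) : g = h := Subtype.ext e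

/-- real vector of an integer vector -/
def rv (m : Fin 3 → ℤ) : Fin 3 → ℝ := fun i => (m i : ℝ)

lemma act_mul (F : M3) (g h : G) : act F (g * h) = act (act F g) h := by
  simp [act, Matrix.mul_assoc]
lemma act_one (F : M3) : act F 1 = F := by simp [act]
lemma act_add (F F' : M3) (g : G) : act (F + F') g = act F g + act F' g := by
  simp [act, Matrix.mul_add, Matrix.add_mul]
lemma act_smul (c : ℝ) (F : M3) (g : G) : act (c • F) g = c • act F g := by
  simp [act]
lemma act_sub (F F' : M3) (g : G) : act (F - F') g = act F g - act F' g := by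
  simp [act, Matrix.mul_sub, Matrix.sub_mul]
lemma act_inj {F F' : M3} {g : G} (h : act F g = act F' g) : F = F' := by
  have := congrArg (fun K => act K g⁻¹) h
  simpa [← act_mul, act_one] using this
lemma act_symm {F : M3} (hF : Fᵀ = F) (g : G) : (act F g)ᵀ = act F g := by
  simp [act, hF, Matrix.mul_assoc]
lemma act_det (F : M3) (g : G) : (act F g).det = F.det := by
  simp [act]
lemma J_symm : Jᵀ = J := by
  ext i j; fin_cases i <;> fin_cases j <;> simp [J]
lemma J_det : J.det = 1 := by simp [J, Matrix.det_fin_three]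

lemma continuous_act : Continuous (fun p : M3 × G => act p.1 p.2) := by
  unfold act; fun_prop

lemma co_co (g : G) : co (co g) = g := by
  have h : ((co (co g) : G) : M3) = (g : M3) := by
    have h1 : ((co g : G) : M3) = ((g : M3).adjugate)ᵀ := rfl
    have h2 : ((co (co g) : G) : M3) = (((co g : G) : M3).adjugate)ᵀ := rfl
    rw [h2, h1, Matrix.adjugate_transpose, Matrix.transpose_transpose, Matrix.adjugate_adjugate]
    · simp
    · simp
  exact Subtype.ext h

lemma co_coe (g : G) : ((co g : G) : M3) = ((g⁻¹ : G) : M3)ᵀ := rfl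
lemma co_mul (g h : G) : co (g * h) = co g * co h := by
  apply Subtype.ext
  rw [Matrix.SpecialLinearGroup.coe_mul, co_coe, co_coe, co_coe, _root_.mul_inv_rev,
    Matrix.SpecialLinearGroup.coe_mul, Matrix.transpose_mul]

lemma continuous_co : Continuous co := by
  unfold co
  refine continuous_induced_rng.mpr ?_
  have : Continuous (fun g : G => ((g⁻¹ : G) : M3)ᵀ) := by fun_prop
  exact this

lemma cross_mul (g : G) (x y : Fin 3 → ℝ) :
    ((g : M3) *ᵥ x) ⨯₃ ((g : M3) *ᵥ y) = ((co g : G) : M3) *ᵥ (x ⨯₃ y) := by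
  ext i
  fin_cases i <;>
  simp [co, Matrix.SpecialLinearGroup.transpose, Matrix.adjugate_fin_three, cross_apply,
    Matrix.mulVec, dotProduct, Fin.sum_univ_three] <;> ring

lemma cross_mul' (g : G) (x y : Fin 3 → ℝ) :
    (((co g : G) : M3) *ᵥ x) ⨯₃ (((co g : G) : M3) *ᵥ y) = (g : M3) *ᵥ (x ⨯₃ y) := by
  rw [cross_mul, co_co]

lemma dot_co (g : G) (x y : Fin 3 → ℝ) :
    ((g : M3) *ᵥ x) ⬝ᵥ (((co g : G) : M3) *ᵥ y) = x ⬝ᵥ y := by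
  have h : ((co g : G) : M3) = ((g⁻¹ : G) : M3)ᵀ := rfl
  rw [h, Matrix.mulVec_transpose, dotProduct_comm, ← Matrix.dotProduct_mulVec, Matrix.mulVec_mulVec,
    ← Matrix.SpecialLinearGroup.coe_mul, inv_mul_cancel, Matrix.SpecialLinearGroup.coe_one,
    Matrix.one_mulVec, dotProduct_comm]

lemma v1_add (s t : ℝ) : v1 (s + t) = v1 s * v1 t := by
  apply Gext
  rw [Matrix.SpecialLinearGroup.coe_mul]
  simp only [v1_coe, Matrix.mul_fin_three]
  ext i j
  fin_cases i <;> fin_cases j <;> simp <;> ring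
lemma v1_zero : v1 0 = 1 := by
  ext i j
  fin_cases i <;> fin_cases j <;> simp [v1]
lemma v1_neg (t : ℝ) : v1 (-t) = (v1 t)⁻¹ := by
  rw [eq_inv_iff_mul_eq_one, ← v1_add, neg_add_cancel, v1_zero]
lemma v2_add (s t : ℝ) : v2 (s + t) = v2 s * v2 t := by
  apply Gext
  rw [Matrix.SpecialLinearGroup.coe_mul]
  simp only [v2_coe, Matrix.mul_fin_three]
  ext i j
  fin_cases i <;> fin_cases j <;> simp <;> ring
lemma v2_zero : v2 0 = 1 := by
  ext i j
  fin_cases i <;> fin_cases j <;> simp [v2]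
lemma v2_neg (t : ℝ) : v2 (-t) = (v2 t)⁻¹ := by
  rw [eq_inv_iff_mul_eq_one, ← v2_add, neg_add_cancel, v2_zero]
lemma v1_v2 (s t : ℝ) : v1 s * v2 t = v2 t * v1 s := by
  apply Gext
  rw [Matrix.SpecialLinearGroup.coe_mul, Matrix.SpecialLinearGroup.coe_mul]
  simp only [v1_coe, v2_coe, Matrix.mul_fin_three]
  ext i j
  fin_cases i <;> fin_cases j <;> simp <;> ring

lemma act_J_v1 (t : ℝ) : act J (v1 t) = J := by
  ext i j
  fin_cases i <;> fin_cases j <;>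
    simp [act, J, v1, Matrix.mul_apply, Fin.sum_univ_three] <;> ring
lemma act_J_dg (a : ℝ) (ha : a ≠ 0) : act J (dg a ha) = J := by
  ext i j
  fin_cases i <;> fin_cases j <;>
    simp [act, J, dg, Matrix.mul_apply, Fin.sum_univ_three, ha]
lemma act_J_JG : act J JG = J := by
  ext i j
  fin_cases i <;> fin_cases j <;>
    simp [act, J, JG, Matrix.mul_apply, Fin.sum_univ_three]
lemma act_J_v2 (s : ℝ) : act J (v2 s) = J + (2 * s) • E33 := by
  ext i j
  fin_cases i <;> fin_cases j <;>
    simp [act, J, v2, E33, Matrix.mul_apply, Fin.sum_univ_three] <;> ring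
lemma act_E_v2 (s : ℝ) : act E33 (v2 s) = E33 := by
  ext i j
  fin_cases i <;> fin_cases j <;>
    simp [act, v2, E33, Matrix.mul_apply, Fin.sum_univ_three]
lemma act_E_v1 (s : ℝ) : act E33 (v1 s) = E33 := by
  ext i j
  fin_cases i <;> fin_cases j <;>
    simp [act, v1, E33, Matrix.mul_apply, Fin.sum_univ_three]

lemma continuous_v1 : Continuous v1 := by
  refine continuous_induced_rng.mpr ?_
  show Continuous (fun t : ℝ => (!![1,t,t^2/2;0,1,t;0,0,1] : M3))
  refine continuous_matrix ?_
  intro i j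
  fin_cases i <;> fin_cases j <;> simp <;> fun_prop
lemma continuous_v2 : Continuous v2 := by
  refine continuous_induced_rng.mpr ?_
  show Continuous (fun t : ℝ => (!![1,0,t;0,1,0;0,0,1] : M3))
  refine continuous_matrix ?_
  intro i j
  fin_cases i <;> fin_cases j <;> simp <;> fun_prop

end Opp


namespace Opp
open Matrix Filter Topology
set_option linter.all false

def VQ (F : ℝ → Fin 3 → ℝ) : Prop :=
  ∃ A B C : Fin 3 → ℝ, ∀ t i, F t i = A i + t * B i + t^2 * C i

lemma VQ.continuous {F : ℝ → Fin 3 → ℝ} (h : VQ F) : Continuous F := by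
  obtain ⟨A, B, C, h⟩ := h
  refine continuous_pi fun i => ?_
  simp only [h]
  fun_prop

lemma lagr {a b x1 x2 x3 M A B C t : ℝ} (hab : a < b)
    (h1 : x1 ∈ Set.Icc a b) (h2 : x2 ∈ Set.Icc a b) (h3 : x3 ∈ Set.Icc a b)
    (h12 : (b - a) / 10 ≤ x2 - x1) (h23 : (b - a) / 10 ≤ x3 - x2) (hM : 0 ≤ M)
    (p1 : |A + x1 * B + x1^2 * C| ≤ M) (p2 : |A + x2 * B + x2^2 * C| ≤ M)
    (p3 : |A + x3 * B + x3^2 * C| ≤ M) (ht : t ∈ Set.Icc a b) :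
    |A + t * B + t^2 * C| ≤ 300 * M := by
  have hd : 0 < b - a := by linarith
  have e12 : 0 < x2 - x1 := by linarith
  have e23 : 0 < x3 - x2 := by linarith
  have e13 : 0 < x3 - x1 := by linarith
  have key : A + t * B + t^2 * C =
      (A + x1 * B + x1^2 * C) * (((t - x2) / (x2 - x1)) * ((t - x3) / (x3 - x1)))
      + (A + x2 * B + x2^2 * C) * (((t - x1) / (x2 - x1)) * ((x3 - t) / (x3 - x2)))
      + (A + x3 * B + x3^2 * C) * (((t - x1) / (x3 - x1)) * ((t - x2) / (x3 - x2))) := by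
    field_simp
    ring
  have fac : ∀ x y d : ℝ, x ∈ Set.Icc a b → y ∈ Set.Icc a b → (b - a) / 10 ≤ d →
      |(x - y) / d| ≤ 10 := by
    intro x y d hx hy hd'
    have : 0 < d := by linarith
    rw [abs_div, abs_of_pos this, div_le_iff₀ this, abs_le]
    constructor <;> linarith [hx.1, hx.2, hy.1, hy.2]
  have bd : ∀ P u v : ℝ, |P| ≤ M → |u| ≤ 10 → |v| ≤ 10 → |P * (u * v)| ≤ 100 * M := by
    intro P u v hP hu hv
    rw [abs_mul, abs_mul]
    have : |u| * |v| ≤ 10 * 10 := by gcongr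
    calc |P| * (|u| * |v|) ≤ M * (10 * 10) := by gcongr
      _ = 100 * M := by ring
  rw [key]
  have b1 := bd _ _ _ p1 (fac t x2 _ ht h2 h12) (fac t x3 (x3 - x1) ht h3 (by linarith))
  have b2 := bd _ _ _ p2 (fac t x1 _ ht h1 h12) (fac x3 t (x3 - x2) h3 ht h23)
  have b3 := bd _ _ _ p3 (fac t x1 (x3 - x1) ht h1 (by linarith)) (fac t x2 (x3 - x2) ht h2 h23)
  refine (abs_add_three _ _ _).trans ?_
  linarith

lemma VQ.lagr {F : ℝ → Fin 3 → ℝ} (h : VQ F) {a b x1 x2 x3 M t : ℝ} (hab : a < b)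
    (h1 : x1 ∈ Set.Icc a b) (h2 : x2 ∈ Set.Icc a b) (h3 : x3 ∈ Set.Icc a b)
    (h12 : (b - a) / 10 ≤ x2 - x1) (h23 : (b - a) / 10 ≤ x3 - x2) (hM : 0 ≤ M)
    (p1 : ‖F x1‖ ≤ M) (p2 : ‖F x2‖ ≤ M) (p3 : ‖F x3‖ ≤ M) (ht : t ∈ Set.Icc a b) :
    ‖F t‖ ≤ 300 * M := by
  obtain ⟨A, B, C, h⟩ := h
  rw [pi_norm_le_iff_of_nonneg (by positivity)] at *
  intro i
  have p1 := p1 i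
  have p2 := p2 i
  have p3 := p3 i
  rw [Real.norm_eq_abs, h] at *
  exact Opp.lagr hab h1 h2 h3 h12 h23 hM p1 p2 p3 ht

lemma VQ.fifth {F : ℝ → Fin 3 → ℝ} (h : VQ F) {a b η : ℝ} (hab : a < b) (hη : 0 < η)
    (hF : ∃ t ∈ Set.Icc a b, η ≤ ‖F t‖) :
    ∃ c, a ≤ c ∧ c + (b - a) / 5 ≤ b ∧ ∀ t ∈ Set.Icc c (c + (b-a)/5), η / 300 ≤ ‖F t‖ := by
  obtain ⟨A, B, C, h⟩ := h
  obtain ⟨t, ht, hn⟩ := hF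
  obtain ⟨i, hi⟩ : ∃ i, η ≤ |F t i| := by
    by_contra hcon
    push Not at hcon
    have : ‖F t‖ < η := by
      rw [pi_norm_lt_iff hη]
      intro i; exact hcon i
    linarith
  by_contra hcon
  push Not at hcon
  have red : ∀ c, a ≤ c → c + (b - a) / 5 ≤ b → ∃ s ∈ Set.Icc c (c + (b-a)/5), |F s i| < η / 300 := by
    intro c h1 h2
    obtain ⟨s, hs, hs'⟩ := hcon c h1 h2
    exact ⟨s, hs, lt_of_le_of_lt (norm_le_pi_norm (F s) i) hs'⟩
  obtain ⟨s1, m1, q1⟩ := red a le_rfl (by linarith)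
  obtain ⟨s2, m2, q2⟩ := red (a + 2 * ((b-a)/5)) (by linarith) (by linarith)
  obtain ⟨s3, m3, q3⟩ := red (a + 4 * ((b-a)/5)) (by linarith) (by linarith)
  set M := max (|F s1 i|) (max (|F s2 i|) (|F s3 i|)) with hM
  have hMl : M < η / 300 := by simp [hM, q1, q2, q3]
  have := Opp.lagr (A := A i) (B := B i) (C := C i) (M := M) (t := t) hab
    (x1 := s1) (x2 := s2) (x3 := s3)
    ⟨by linarith [m1.1], by linarith [m1.2]⟩ ⟨by linarith [m2.1], by linarith [m2.2]⟩
    ⟨by linarith [m3.1], by linarith [m3.2]⟩ (by linarith [m1.2, m2.1]) (by linarith [m2.2, m3.1])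
    (le_trans (abs_nonneg _) (le_max_left _ _)) (by rw [← h]; exact le_max_left _ _)
    (by rw [← h]; exact le_trans (le_max_left _ _) (le_max_right _ _))
    (by rw [← h]; exact le_trans (le_max_right _ _) (le_max_right _ _)) ht
  rw [← h] at this
  linarith

lemma half_lemma {ι : Type*} {F : ℝ → Fin 3 → ℝ} {g : ι → ℝ → Fin 3 → ℝ} (hF : VQ F)
    (hg : ∀ i, VQ (g i)) {a b η : ℝ} (hab : a < b) (hη : 0 < η) (hη1 : η ≤ 1)
    (hFp : ∃ t ∈ Set.Icc a b, η ≤ ‖F t‖) (hgp : ∀ i, ∃ t ∈ Set.Icc a b, η ≤ ‖g i t‖)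
    (comp : ∀ i j t, (∀ s, ‖g i s‖ = ‖g j s‖) ∨ ‖F t‖ ≤ 2 * (‖g i t‖ * ‖g j t‖)) :
    ∃ t ∈ Set.Icc a b, η / 300 ≤ ‖F t‖ ∧ ∀ i, η / 1000 ≤ ‖g i t‖ := by
  obtain ⟨c, hc1, hc2, hc⟩ := hF.fifth hab hη hFp
  have hd : 0 < b - a := by linarith
  by_contra hcon
  push Not at hcon
  have cov : ∀ t ∈ Set.Icc c (c + (b-a)/5), ∃ i, ‖g i t‖ < η / 1000 := fun t ht =>
    hcon t ⟨by linarith [ht.1], by linarith [ht.2]⟩ (hc t ht)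
  obtain ⟨i, hi⟩ := cov c ⟨le_rfl, by linarith⟩
  let U := {t : ℝ | ‖g i t‖ < η / 1000}
  let V := ⋃ j ∈ {j : ι | ¬ ∀ s, ‖g i s‖ = ‖g j s‖}, {t : ℝ | ‖g j t‖ < η / 1000}
  have opn : ∀ j, IsOpen {t : ℝ | ‖g j t‖ < η / 1000} := fun j =>
    isOpen_lt ((hg j).continuous.norm) continuous_const
  have hU : IsOpen U := opn i
  have hV : IsOpen V := isOpen_biUnion fun j _ => opn j
  have all : ∀ t ∈ Set.Icc c (c + (b-a)/5), ‖g i t‖ < η / 1000 := by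
    intro t ht
    by_contra hnt
    obtain ⟨j, hj⟩ := cov t ht
    have hj' : ¬ ∀ s, ‖g i s‖ = ‖g j s‖ := fun h => hnt (by rw [h]; exact hj)
    have pc : IsPreconnected (Set.Icc c (c + (b-a)/5)) := isPreconnected_Icc
    obtain ⟨s, hs, hsU, hsV⟩ := pc U V hU hV (by
      intro s hs
      obtain ⟨k, hk⟩ := cov s hs
      by_cases hik : ∀ s, ‖g i s‖ = ‖g k s‖
      · left; show ‖g i s‖ < _; rw [hik]; exact hk
      · right; exact Set.mem_biUnion (show k ∈ {j : ι | ¬ ∀ s, ‖g i s‖ = ‖g j s‖} from hik) hk)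
      ⟨c, ⟨le_rfl, by linarith⟩, hi⟩
      ⟨t, ht, Set.mem_biUnion (show j ∈ {j : ι | ¬ ∀ s, ‖g i s‖ = ‖g j s‖} from hj') hj⟩
    obtain ⟨k, hk, hks⟩ := Set.mem_iUnion₂.mp hsV
    have hks : ‖g k s‖ < η / 1000 := hks
    have hsU : ‖g i s‖ < η / 1000 := hsU
    rcases comp i k s with h | h
    · exact hk h
    · have h3 := hc s hs
      have : ‖g i s‖ * ‖g k s‖ ≤ (η / 1000) * (η/1000) := by gcongr
      nlinarith
  obtain ⟨t, ht, hgt⟩ := hgp i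
  have := (hg i).lagr (x1 := c) (x2 := c + (b-a)/10) (x3 := c + (b-a)/5) (M := η/1000) hab
    ⟨hc1, by linarith⟩ ⟨by linarith, by linarith⟩ ⟨by linarith, by linarith⟩ (by linarith)
    (by linarith) (by positivity) (all _ ⟨by linarith, by linarith⟩).le
    (all _ ⟨by linarith, by linarith⟩).le (all _ ⟨by linarith, by linarith⟩).le ht
  linarith

lemma good_interval {ι : Type*} {x : ι → ℝ → Fin 3 → ℝ} (hx : ∀ i, VQ (x i)) {α β η : ℝ}
    (hab : α < β) (hη : 0 < η) (hp : ∀ i, ∃ t ∈ Set.Icc α β, η ≤ ‖x i t‖)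
    (hi : ∃ i, ‖x i ((α+β)/2)‖ < η) :
    ∃ a b i, α ≤ a ∧ a < b ∧ b ≤ β ∧ (∀ t ∈ Set.Icc a b, ‖x i t‖ ≤ 300 * η) ∧
      ∀ j, ∃ t ∈ Set.Icc a b, η ≤ ‖x j t‖ := by
  let S := {l : ℝ | ∃ a b i, α ≤ a ∧ a ≤ b ∧ b ≤ β ∧ b - a = l ∧ ∀ t ∈ Set.Icc a b, ‖x i t‖ ≤ η}
  have bdd : BddAbove S := ⟨β - α, by
    rintro l ⟨a, b, i, h1, h2, h3, h4, -⟩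
    linarith⟩
  obtain ⟨l0, hl0, hl0S⟩ : ∃ l0 > 0, l0 ∈ S := by
    obtain ⟨i, hi⟩ := hi
    have ho : IsOpen {t : ℝ | ‖x i t‖ < η} := isOpen_lt ((hx i).continuous.norm) continuous_const
    obtain ⟨e, he, hb⟩ := Metric.isOpen_iff.mp ho _ hi
    set e' := min (e/2) ((β-α)/2) with he'
    have e1 : e' ≤ e/2 := min_le_left _ _
    have e2 : e' ≤ (β-α)/2 := min_le_right _ _
    have e0 : 0 < e' := lt_min (by linarith) (by linarith)
    refine ⟨e', e0, (α+β)/2, (α+β)/2 + e', i, by linarith, by linarith, by linarith, by ring, ?_⟩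
    intro t ht
    have : t ∈ Metric.ball ((α+β)/2) e := by
      rw [Metric.mem_ball, Real.dist_eq, abs_lt]
      constructor <;> linarith [ht.1, ht.2]
    exact (hb this).le
  have hL0 : 0 < sSup S := lt_of_lt_of_le hl0 (le_csSup bdd hl0S)
  obtain ⟨l, hlS, hl⟩ := exists_lt_of_lt_csSup ⟨l0, hl0S⟩ (half_lt_self hL0)
  have hnl : ∀ l' ∈ S, l' < 2 * l := fun l' h => lt_of_le_of_lt (le_csSup bdd h) (by linarith)
  obtain ⟨a, b, i, h1, h2, h3, h4, h5⟩ := hlS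
  have lpos : 0 < l := by linarith
  obtain ⟨a', b', c1, c2, c3, c4, c5, c6⟩ : ∃ a' b', α ≤ a' ∧ a' ≤ a ∧ b ≤ b' ∧ b' ≤ β ∧
      b' - a' ≤ 2 * l ∧ ∀ j, ∃ t ∈ Set.Icc a' b', η ≤ ‖x j t‖ := by
    by_cases hc : 2 * l ≤ β - α
    · refine ⟨max α (b - 2*l), max α (b - 2*l) + 2 * l, le_max_left _ _, max_le h1 (by linarith),
        by linarith [le_max_right α (b - 2*l)], ?_, by linarith, ?_⟩
      · have : max α (b - 2*l) ≤ β - 2 * l := max_le (by linarith) (by linarith)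
        linarith
      · intro j
        by_contra hcon
        push Not at hcon
        have hm : max α (b - 2*l) ≤ β - 2 * l := max_le (by linarith) (by linarith)
        have : 2 * l ∈ S := ⟨max α (b - 2*l), max α (b - 2*l) + 2 * l, j, le_max_left _ _,
          by linarith, by linarith, by ring, fun t ht => (hcon t ht).le⟩
        exact lt_irrefl _ (hnl _ this)
    · exact ⟨α, β, le_rfl, h1, h3, le_rfl, by linarith, hp⟩
  refine ⟨a', b', i, c1, by linarith, c4, ?_, c6⟩
  intro t ht
  exact (hx i).lagr (x1 := a) (x2 := (a+b)/2) (x3 := b) (by linarith)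
    ⟨c2, by linarith⟩ ⟨by linarith, by linarith⟩ ⟨by linarith, c3⟩ (by linarith) (by linarith)
    hη.le (h5 _ ⟨le_rfl, h2⟩) (h5 _ ⟨by linarith, by linarith⟩) (h5 _ ⟨h2, le_rfl⟩) ht

def Prim (m : Fin 3 → ℤ) : Prop := ∃ k : Fin 3 → ℤ, k ⬝ᵥ m = 1

lemma Prim.ne_zero {m : Fin 3 → ℤ} (h : Prim m) : m ≠ 0 := by
  rintro rfl
  obtain ⟨k, hk⟩ := h
  simp at hk

lemma exists_prim {m : Fin 3 → ℤ} (h : m ≠ 0) : ∃ (d : ℤ) (m0 : Fin 3 → ℤ),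
    d ≠ 0 ∧ Prim m0 ∧ m = d • m0 := by
  obtain ⟨i, hi⟩ := Function.ne_iff.mp h
  obtain ⟨m0, h1, h2⟩ := Finset.extract_gcd (s := (Finset.univ : Finset (Fin 3))) m ⟨i, by simp⟩
  refine ⟨Finset.univ.gcd m, m0, ?_, ?_, ?_⟩
  · intro h0
    rw [Finset.gcd_eq_zero_iff] at h0
    exact hi (h0 i (by simp))
  · obtain ⟨k, hk⟩ := Finset.gcd_eq_sum_mul (Finset.univ : Finset (Fin 3)) m0
    rw [h2] at hk
    exact ⟨k, by rw [dotProduct, hk]; exact Finset.sum_congr rfl fun i _ => by ring⟩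
  · ext j; simpa using h1 j (by simp)

lemma Prim.par {m m' : Fin 3 → ℤ} {k : Fin 3 → ℤ} (hk : k ⬝ᵥ m = 1) (h : m ⨯₃ m' = 0) :
    m' = (k ⬝ᵥ m') • m := by
  have h0 := congrFun h 0
  have h1 := congrFun h 1
  have h2 := congrFun h 2
  simp [cross_apply, dotProduct, Fin.sum_univ_three] at h0 h1 h2 hk ⊢
  ext i
  fin_cases i <;> simp <;> grind

lemma rv_smul (d : ℤ) (m : Fin 3 → ℤ) : rv (d • m) = (d : ℝ) • rv m := by
  ext i; simp [rv]
lemma rv_neg (m : Fin 3 → ℤ) : rv (-m) = - rv m := by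
  ext i; simp [rv]
lemma rv_cross (m m' : Fin 3 → ℤ) : rv (m ⨯₃ m') = rv m ⨯₃ rv m' := by
  ext i; fin_cases i <;> simp [rv, cross_apply]
lemma rv_dot (m m' : Fin 3 → ℤ) : ((m ⬝ᵥ m' : ℤ) : ℝ) = rv m ⬝ᵥ rv m' := by
  simp [rv, dotProduct, Fin.sum_univ_three]
lemma rv_inj {m m' : Fin 3 → ℤ} (h : rv m = rv m') : m = m' := by
  ext i; have := congrFun h i; simpa [rv] using this
lemma rv_ne {m : Fin 3 → ℤ} (h : m ≠ 0) : rv m ≠ 0 := by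
  intro h0; apply h; apply rv_inj; rw [h0]; ext i; simp [rv]

lemma norm_cross (x y : Fin 3 → ℝ) : ‖x ⨯₃ y‖ ≤ 2 * (‖x‖ * ‖y‖) := by
  rw [pi_norm_le_iff_of_nonneg (by positivity)]
  have b : ∀ i j, |x i * y j| ≤ ‖x‖ * ‖y‖ := fun i j => by
    rw [abs_mul]
    exact mul_le_mul (norm_le_pi_norm x i) (norm_le_pi_norm y j) (abs_nonneg _) (norm_nonneg _)
  have c : ∀ i j k l, |x i * y j - x k * y l| ≤ 2 * (‖x‖ * ‖y‖) := fun i j k l => by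
    refine (abs_sub _ _).trans ?_
    linarith [b i j, b k l]
  intro i
  rw [cross_apply]
  fin_cases i
  · exact c 1 2 2 1
  · exact c 2 0 0 2
  · exact c 0 1 1 0

lemma abs_dot_le (x y : Fin 3 → ℝ) : |x ⬝ᵥ y| ≤ 3 * (‖x‖ * ‖y‖) := by
  have b : ∀ i, |x i * y i| ≤ ‖x‖ * ‖y‖ := fun i => by
    rw [abs_mul]
    exact mul_le_mul (norm_le_pi_norm x i) (norm_le_pi_norm y i) (abs_nonneg _) (norm_nonneg _)
  rw [dotProduct, Fin.sum_univ_three]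
  refine (abs_add_three _ _ _).trans ?_
  linarith [b 0, b 1, b 2]

/-- two vectors orthogonal to a primitive vector have cross product proportional to it -/
lemma cross_perp {v w w' : Fin 3 → ℤ} (hv : Prim v) (h : w ⬝ᵥ v = 0) (h' : w' ⬝ᵥ v = 0) :
    ∃ k : ℤ, w ⨯₃ w' = k • v := by
  obtain ⟨k, hk⟩ := hv
  refine ⟨_, Prim.par hk ?_⟩
  simp [cross_apply, dotProduct, Fin.sum_univ_three] at h h' ⊢
  refine ⟨?_, ?_, ?_⟩
  · linear_combination w 0 * h' - w' 0 * h
  · linear_combination w 1 * h' - w' 1 * h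
  · linear_combination w 2 * h' - w' 2 * h

lemma prim_par_prim {m m' : Fin 3 → ℤ} (hm : Prim m) (hm' : Prim m') (h : m ⨯₃ m' = 0) :
    m' = m ∨ m' = - m := by
  obtain ⟨k, hk⟩ := hm
  obtain ⟨k', hk'⟩ := hm'
  have e := Prim.par hk h
  rw [e, dotProduct_smul, smul_eq_mul] at hk'
  rcases Int.isUnit_iff.mp (IsUnit.of_mul_eq_one _ hk') with h1 | h1
  · left; rw [e, h1, one_smul]
  · right; rw [e, h1, neg_one_smul]

noncomputable def fv (y : G) (m : Fin 3 → ℤ) (t : ℝ) : Fin 3 → ℝ := ((v1 t * y : G) : M3) *ᵥ rv m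
noncomputable def gv (y : G) (m : Fin 3 → ℤ) (t : ℝ) : Fin 3 → ℝ :=
  ((co (v1 t * y) : G) : M3) *ᵥ rv m

lemma v1_mulVec (t : ℝ) (x : Fin 3 → ℝ) : ((v1 t : G) : M3) *ᵥ x =
    ![x 0 + t * x 1 + t^2/2 * x 2, x 1 + t * x 2, x 2] := by
  ext i; fin_cases i <;> simp [v1_coe, Matrix.mulVec, dotProduct, Fin.sum_univ_three]

lemma co_v1_coe (t : ℝ) : ((co (v1 t) : G) : M3) = !![1,0,0;-t,1,0;t^2/2,-t,1] := by
  rw [co_coe, ← v1_neg, v1_coe]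
  ext i j; fin_cases i <;> fin_cases j <;> simp

lemma co_v1_mulVec (t : ℝ) (x : Fin 3 → ℝ) : ((co (v1 t) : G) : M3) *ᵥ x =
    ![x 0, x 1 - t * x 0, x 2 - t * x 1 + t^2/2 * x 0] := by
  ext i; fin_cases i <;> simp [co_v1_coe, Matrix.mulVec, dotProduct, Fin.sum_univ_three] <;> ring

lemma fv_eq (y : G) (m : Fin 3 → ℤ) (t : ℝ) :
    fv y m t = ((v1 t : G) : M3) *ᵥ ((y : M3) *ᵥ rv m) := by
  rw [fv, Matrix.SpecialLinearGroup.coe_mul, Matrix.mulVec_mulVec]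
lemma gv_eq (y : G) (m : Fin 3 → ℤ) (t : ℝ) :
    gv y m t = ((co (v1 t) : G) : M3) *ᵥ (((co y : G) : M3) *ᵥ rv m) := by
  rw [gv, co_mul, Matrix.SpecialLinearGroup.coe_mul, Matrix.mulVec_mulVec]

lemma fv_VQ (y : G) (m : Fin 3 → ℤ) : VQ (fv y m) := by
  set x := (y : M3) *ᵥ rv m with hx
  refine ⟨x, ![x 1, x 2, 0], ![x 2 / 2, 0, 0], fun t i => ?_⟩
  rw [fv_eq, v1_mulVec]
  fin_cases i <;> simp [← hx] <;> ring
lemma gv_VQ (y : G) (m : Fin 3 → ℤ) : VQ (gv y m) := by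
  set x := ((co y : G) : M3) *ᵥ rv m with hx
  refine ⟨x, ![0, - x 0, - x 1], ![0, 0, x 0 / 2], fun t i => ?_⟩
  rw [gv_eq, co_v1_mulVec]
  fin_cases i <;> simp [← hx] <;> ring

lemma fv_smul (y : G) (d : ℤ) (m : Fin 3 → ℤ) (t : ℝ) : fv y (d • m) t = (d : ℝ) • fv y m t := by
  rw [fv, rv_smul, Matrix.mulVec_smul, fv]
lemma gv_smul (y : G) (d : ℤ) (m : Fin 3 → ℤ) (t : ℝ) : gv y (d • m) t = (d : ℝ) • gv y m t := by
  rw [gv, rv_smul, Matrix.mulVec_smul, gv]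
lemma fv_cross (y : G) (m m' : Fin 3 → ℤ) (t : ℝ) :
    fv y m t ⨯₃ fv y m' t = gv y (m ⨯₃ m') t := by
  rw [fv, fv, cross_mul, gv, rv_cross]
lemma gv_cross (y : G) (m m' : Fin 3 → ℤ) (t : ℝ) :
    gv y m t ⨯₃ gv y m' t = fv y (m ⨯₃ m') t := by
  rw [gv, gv, cross_mul', fv, rv_cross]
lemma fv_dot_gv (y : G) (m m' : Fin 3 → ℤ) (t : ℝ) :
    fv y m t ⬝ᵥ gv y m' t = ((m ⬝ᵥ m' : ℤ) : ℝ) := by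
  rw [fv, gv, dot_co, rv_dot]

lemma norm_smul_ge {d : ℤ} (hd : d ≠ 0) (x : Fin 3 → ℝ) : ‖x‖ ≤ ‖(d : ℝ) • x‖ := by
  rw [norm_smul, Real.norm_eq_abs]
  have : (1 : ℝ) ≤ |(d : ℝ)| := by exact_mod_cast Int.one_le_abs hd
  nlinarith [norm_nonneg x]

/-- non-divergence -/
theorem nondiv {η : ℝ} (hη : 0 < η) (hη1 : η ≤ 1) (y : G) {α β : ℝ} (hab : α < β)
    (hf : ∀ m, m ≠ 0 → ∃ t ∈ Set.Icc α β, η ≤ ‖fv y m t‖)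
    (hg : ∀ m, m ≠ 0 → ∃ t ∈ Set.Icc α β, η ≤ ‖gv y m t‖) :
    ∃ t ∈ Set.Icc α β, ∀ m, m ≠ 0 → η / 1000000 ≤ ‖fv y m t‖ := by
  by_cases h0 : ∀ m, m ≠ 0 → η ≤ ‖fv y m ((α+β)/2)‖
  · exact ⟨(α+β)/2, ⟨by linarith, by linarith⟩, fun m hm => le_trans (by linarith) (h0 m hm)⟩
  push Not at h0
  obtain ⟨m1, hm1, hm1'⟩ := h0
  obtain ⟨d, m0, hd, hm0, rfl⟩ := exists_prim hm1
  rw [fv_smul] at hm1'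
  have hm1' := lt_of_le_of_lt (norm_smul_ge hd _) hm1'
  let x : {m // Prim m} ⊕ {m // Prim m} → ℝ → Fin 3 → ℝ :=
    Sum.elim (fun m => fv y m.1) (fun m => gv y m.1)
  obtain ⟨a, b, i, h1, h2, h3, h4, h5⟩ := good_interval (x := x)
    (by rintro (m | m); exacts [fv_VQ y _, gv_VQ y _]) hab hη
    (by rintro (m | m); exacts [hf _ m.2.ne_zero, hg _ m.2.ne_zero]) ⟨Sum.inl ⟨m0, hm0⟩, hm1'⟩
  have sub : ∀ t ∈ Set.Icc a b, t ∈ Set.Icc α β := fun t ht =>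
    ⟨by linarith [ht.1], by linarith [ht.2]⟩
  rcases i with ⟨v, hv⟩ | ⟨w, hw⟩
  · obtain ⟨t, ht, q1, q2⟩ := half_lemma (F := fv y v)
      (g := fun w : {w // Prim w ∧ w ⬝ᵥ v = 0} => gv y w.1) (fv_VQ y v) (fun w => gv_VQ y w)
      h2 hη hη1 (h5 (Sum.inl ⟨v, hv⟩)) (fun w => h5 (Sum.inr ⟨w.1, w.2.1⟩)) (by
        rintro ⟨w, hw, hwv⟩ ⟨w', hw', hwv'⟩ t
        by_cases hc : w ⨯₃ w' = 0
        · left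
          intro s
          rcases prim_par_prim hw hw' hc with h | h
          · simp only [h]
          · have := gv_smul y (-1) w s
            simp only [h]
            rw [neg_one_smul] at this
            rw [this]; simp
        · right
          obtain ⟨k, hk⟩ := cross_perp hv hwv hwv'
          have hk0 : k ≠ 0 := by rintro rfl; simp at hk; exact hc hk
          refine (norm_smul_ge hk0 _).trans ?_
          rw [← fv_smul, ← hk, ← gv_cross]
          exact norm_cross _ _)
    refine ⟨t, sub t ht, fun u hu => ?_⟩
    have q3 : ‖fv y v t‖ ≤ 300 * η := h4 t ht
    by_cases hc : v ⨯₃ u = 0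
    · obtain ⟨k, hk⟩ := hv
      have e := Prim.par hk hc
      have : k ⬝ᵥ u ≠ 0 := by intro h; rw [h, zero_smul] at e; exact hu e
      rw [e, fv_smul]
      refine le_trans ?_ (norm_smul_ge this _)
      linarith
    · obtain ⟨d, w, hd, hw, e⟩ := exists_prim hc
      have hwv : w ⬝ᵥ v = 0 := by
        have : (v ⨯₃ u) ⬝ᵥ v = 0 := by rw [dotProduct_comm]; exact dot_self_cross v u
        rw [e, smul_dotProduct, smul_eq_mul] at this
        exact (mul_eq_zero.mp this).resolve_left hd
      have q4 := q2 ⟨w, hw, hwv⟩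
      have q5 : ‖gv y w t‖ ≤ 2 * (‖fv y v t‖ * ‖fv y u t‖) := by
        refine (norm_smul_ge hd _).trans ?_
        rw [← gv_smul, ← e, ← fv_cross]
        exact norm_cross _ _
      have q6 : ‖fv y v t‖ * ‖fv y u t‖ ≤ (300 * η) * ‖fv y u t‖ := by gcongr
      have q7 : η / 1000 ≤ 2 * ((300 * η) * ‖fv y u t‖) := by
        have := q4.trans q5
        linarith
      have q8 : η * (1/1000) ≤ η * (600 * ‖fv y u t‖) := by linarith
      have q9 := le_of_mul_le_mul_left q8 hη
      linarith
  · obtain ⟨t, ht, q1, q2⟩ := half_lemma (F := gv y w)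
      (g := fun u : {u // Prim u ∧ u ⬝ᵥ w = 0} => fv y u.1) (gv_VQ y w) (fun u => fv_VQ y u)
      h2 hη hη1 (h5 (Sum.inr ⟨w, hw⟩)) (fun u => h5 (Sum.inl ⟨u.1, u.2.1⟩)) (by
        rintro ⟨u, hu, huw⟩ ⟨u', hu', huw'⟩ t
        by_cases hc : u ⨯₃ u' = 0
        · left
          intro s
          rcases prim_par_prim hu hu' hc with h | h
          · simp only [h]
          · have := fv_smul y (-1) u s
            simp only [h]
            rw [neg_one_smul] at this
            rw [this]; simp
        · right
          obtain ⟨k, hk⟩ := cross_perp hw huw huw'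
          have hk0 : k ≠ 0 := by rintro rfl; simp at hk; exact hc hk
          refine (norm_smul_ge hk0 _).trans ?_
          rw [← gv_smul, ← hk, ← fv_cross]
          exact norm_cross _ _)
    refine ⟨t, sub t ht, fun u hu => ?_⟩
    have q3 : ‖gv y w t‖ ≤ 300 * η := h4 t ht
    obtain ⟨d, u0, hd, hu0, rfl⟩ := exists_prim hu
    rw [fv_smul]
    refine le_trans ?_ (norm_smul_ge hd _)
    by_cases hc : u0 ⬝ᵥ w = 0
    · have := q2 ⟨u0, hu0, hc⟩
      refine le_trans ?_ this
      linarith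
    · have e := fv_dot_gv y u0 w t
      have e2 := abs_dot_le (fv y u0 t) (gv y w t)
      have e3 : (1:ℝ) ≤ |fv y u0 t ⬝ᵥ gv y w t| := by
        rw [e]; exact_mod_cast Int.one_le_abs hc
      have q6 : ‖fv y u0 t‖ * ‖gv y w t‖ ≤ ‖fv y u0 t‖ * (300 * η) := by gcongr
      have q7 : ‖fv y u0 t‖ * (300 * η) ≤ ‖fv y u0 t‖ * (300 * 1) := by gcongr
      linarith

end Opp


namespace Opp
open Matrix Filter Topology
set_option linter.all false

lemma gram_ineq {a b c p q r : ℝ} (ha : 0 < a) (hb : 0 < b) (hc : 0 < c) (pa : 2 * |p| ≤ a)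
    (pb : 2 * |p| ≤ b) (hac : a ≤ c) (hbc : b ≤ c)
    (h : ∀ m n : ℤ, 0 ≤ 2 * m * q + 2 * n * r + a * m^2 + 2 * p * m * n + b * n^2) :
    3 * (a * b * c) ≤ 8 * (a*b*c + 2*p*q*r - a*r^2 - b*q^2 - c*p^2) := by
  set D := a * b - p^2 with hD
  have hp2 : 4 * p^2 ≤ a * b := by
    have : (2 * |p|) * (2 * |p|) ≤ a * b := by gcongr
    have e : |p| * |p| = p^2 := by rw [← sq, sq_abs]
    linarith
  have hab : 0 < a * b := by positivity
  have hDpos : 0 < D := by linarith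
  set x := (b*q - p*r) / D with hx
  set y := (a*r - p*q) / D with hy
  have ex : x * D = b*q - p*r := by rw [hx]; field_simp
  have ey : y * D = a*r - p*q := by rw [hy]; field_simp
  set n := round y with hn
  set v := y - n with hv
  set m := round (x + p * v / a) with hm
  have hv2 : |v| ≤ 1/2 := abs_sub_round y
  have hu2 : |x + p * v / a - m| ≤ 1/2 := abs_sub_round _
  have hh := h (-m) (-n)
  push_cast at hh
  set u := x - m with hu
  set w := x + p * v / a - m with hw
  have hwu : a * w = a * u + p * v := by rw [hw, hu]; field_simp; ring
  have hN : a * (a * u^2 + 2 * p * u * v + b * v^2) = (a * w)^2 + D * v^2 := by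
    rw [hwu, hD]; ring
  have q4 : ∀ z : ℝ, |z| ≤ 1/2 → z^2 ≤ 1/4 := by
    intro z hz
    have := abs_le.mp hz
    nlinarith only [this.1, this.2]
  have hw' : w^2 ≤ 1/4 := q4 w hu2
  have hv' : v^2 ≤ 1/4 := q4 v hv2
  have hN2 : a * u^2 + 2 * p * u * v + b * v^2 ≤ c / 2 := by
    have h1 : a * (a * u^2 + 2 * p * u * v + b * v^2) ≤ a * (c/2) := by
      rw [hN]
      have : D * v^2 ≤ (a * b) * (1/4) := by
        have : D ≤ a * b := by rw [hD]; linarith [sq_nonneg p]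
        gcongr
      have h3 : (a * w)^2 ≤ a * a * (1/4) := by
        rw [mul_pow, sq a]; gcongr
      have h4 : a * a ≤ a * c := by gcongr
      have h5 : a * b ≤ a * c := by gcongr
      linarith
    exact le_of_mul_le_mul_left h1 ha
  -- identity
  have hq : q = a * x + p * y := by
    have : D * q = D * (a * x + p * y) := by
      rw [show D * (a * x + p * y) = a * (x * D) + p * (y * D) by ring, ex, ey, hD]; ring
    exact mul_left_cancel₀ hDpos.ne' this
  have hr : r = p * x + b * y := by
    have : D * r = D * (p * x + b * y) := by
      rw [show D * (p * x + b * y) = p * (x * D) + b * (y * D) by ring, ex, ey, hD]; ring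
    exact mul_left_cancel₀ hDpos.ne' this
  have hmm : (m : ℝ) = x - u := by rw [hu]; ring
  have hnn : (n : ℝ) = y - v := by rw [hv]; ring
  rw [hmm, hnn] at hh
  have hdet : a*b*c + 2*p*q*r - a*r^2 - b*q^2 - c*p^2
      = D * (c - (a * x^2 + 2 * p * x * y + b * y^2)) := by
    rw [hq, hr, hD]; ring
  have hN3 : a * x^2 + 2 * p * x * y + b * y^2 ≤ c / 2 := by
    refine le_trans ?_ hN2
    rw [hq, hr] at hh
    linarith
  rw [hdet]
  have hD2 : 3 * (a * b) ≤ 4 * D := by rw [hD]; linarith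
  have : D * (c / 2) ≤ D * (c - (a * x^2 + 2 * p * x * y + b * y^2)) := by
    apply mul_le_mul_of_nonneg_left _ hDpos.le
    linarith
  have : 3 * (a * b) * c ≤ 4 * D * c := by gcongr
  linarith

def Ssq (A : M3) : ℝ := ∑ i, ∑ j, A i j ^ 2

lemma entry_le_Ssq (A : M3) (i j : Fin 3) : A i j ^2 ≤ Ssq A := by
  unfold Ssq
  refine le_trans ?_ (Finset.single_le_sum (f := fun i => ∑ j, A i j ^2) (fun i _ => by positivity) (Finset.mem_univ i))
  exact Finset.single_le_sum (f := fun j => A i j ^2) (fun i _ => by positivity) (Finset.mem_univ j)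

lemma io_coe (γ : Gam) (i j : Fin 3) : ((io γ : G) : M3) i j = ((γ : Matrix (Fin 3) (Fin 3) ℤ) i j : ℝ) := by
  simp [io]

/-- entries bounded implies finitely many -/
lemma finite_bdd (B : ℝ) : {γ : Gam | ∀ i j, |((io γ : G) : M3) i j| ≤ B}.Finite := by
  have hfin : (Set.pi Set.univ (fun _ : Fin 3 => Set.pi Set.univ
      (fun _ : Fin 3 => Set.Icc (-⌈B⌉) ⌈B⌉))).Finite :=
    Set.Finite.pi fun _ => Set.Finite.pi fun _ => Set.finite_Icc _ _
  refine Set.Finite.of_finite_image (f := fun γ : Gam => (fun i j => (γ : Matrix (Fin 3) (Fin 3) ℤ) i j)) ?_ ?_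
  · refine hfin.subset ?_
    rintro _ ⟨γ, hγ, rfl⟩
    intro i _ j _
    have := hγ i j
    rw [io_coe, abs_le] at this
    have h2 := Int.le_ceil B
    constructor
    · have : (-(⌈B⌉:ℝ)) ≤ ((γ : Matrix (Fin 3) (Fin 3) ℤ) i j : ℝ) := by linarith
      exact_mod_cast this
    · have : ((γ : Matrix (Fin 3) (Fin 3) ℤ) i j : ℝ) ≤ (⌈B⌉:ℝ) := by linarith
      exact_mod_cast this
  · intro γ _ γ' _ h
    apply Subtype.ext
    ext i j
    exact congrFun (congrFun h i) j

lemma entry_mul_le {A B : M3} {a b : ℝ} (ha : 0 ≤ a) (hA : ∀ i j, |A i j| ≤ a) (hB : ∀ i j, |B i j| ≤ b) (i j : Fin 3) :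
    |(A * B) i j| ≤ 3 * (a * b) := by
  have t : ∀ k, |A i k * B k j| ≤ a * b := fun k => by
    rw [abs_mul]; exact mul_le_mul (hA i k) (hB k j) (abs_nonneg _) ha
  rw [Matrix.mul_apply, Fin.sum_univ_three]
  refine (abs_add_three _ _ _).trans ?_
  linarith [t 0, t 1, t 2]

lemma exists_entry_bd (A : M3) : ∃ B, 0 < B ∧ ∀ i j, |A i j| ≤ B := by
  refine ⟨1 + ∑ i, ∑ j, |A i j|, by positivity, fun i j => ?_⟩
  have h1 : ∑ j, |A i j| ≤ ∑ i, ∑ j, |A i j| :=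
    Finset.single_le_sum (f := fun i => ∑ j, |A i j|) (fun i _ => by positivity) (Finset.mem_univ i)
  have h2 : |A i j| ≤ ∑ j, |A i j| :=
    Finset.single_le_sum (f := fun j => |A i j|) (fun i _ => by positivity) (Finset.mem_univ j)
  linarith

lemma finite_bdd_mul (g : G) (B : ℝ) : {γ : Gam | ∀ i j, |((g * io γ : G) : M3) i j| ≤ B}.Finite := by
  obtain ⟨C, hC, hC'⟩ := exists_entry_bd ((g⁻¹ : G) : M3)
  refine (finite_bdd (3 * (C * B))).subset ?_
  intro γ hγ i j
  have : ((io γ : G) : M3) = ((g⁻¹ : G) : M3) * ((g * io γ : G) : M3) := by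
    rw [← Matrix.SpecialLinearGroup.coe_mul, inv_mul_cancel_left]
  rw [this]
  exact entry_mul_le hC.le hC' hγ i j

lemma exists_min (g : G) : ∃ γ : Gam, ∀ γ' : Gam, Ssq ((g * io γ : G) : M3) ≤ Ssq ((g * io γ' : G) : M3) := by
  set S := {γ : Gam | Ssq ((g * io γ : G) : M3) ≤ Ssq ((g * io 1 : G) : M3)}
  have hS : S.Finite := by
    refine (finite_bdd_mul g (1 + Ssq ((g * io 1 : G) : M3))).subset ?_
    intro γ hγ i j
    have h1 := (entry_le_Ssq ((g * io γ : G) : M3) i j).trans hγ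
    rw [abs_le]
    constructor <;> nlinarith
  obtain ⟨γ, hγ, hmin⟩ := Set.exists_min_image S (fun γ => Ssq ((g * io γ : G) : M3)) hS ⟨1, le_refl (Ssq ((g * io 1 : G) : M3))⟩
  refine ⟨γ, fun γ' => ?_⟩
  by_cases h : γ' ∈ S
  · exact hmin γ' h
  · have h : ¬ Ssq ((g * io γ' : G) : M3) ≤ Ssq ((g * io 1 : G) : M3) := h
    exact le_trans hγ (le_of_not_ge h)

def e1 (m n : ℤ) : Gam := ⟨!![1,0,0;m,1,0;n,0,1], by simp [Matrix.det_fin_three]⟩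
def e2 (m n : ℤ) : Gam := ⟨!![1,m,0;0,1,0;0,n,1], by simp [Matrix.det_fin_three]⟩
def e3 (m n : ℤ) : Gam := ⟨!![1,0,m;0,1,n;0,0,1], by simp [Matrix.det_fin_three]⟩

lemma io_e1 (m n : ℤ) : ((io (e1 m n) : G) : M3) = !![1,0,0;(m:ℝ),1,0;(n:ℝ),0,1] := by
  ext i j
  rw [io_coe]
  fin_cases i <;> fin_cases j <;> simp [e1]
lemma Ssq_e1 (A : M3) (m n : ℤ) : Ssq (A * ((io (e1 m n) : G) : M3)) = Ssq A +
    (2 * m * (∑ i, A i 0 * A i 1) + 2 * n * (∑ i, A i 0 * A i 2) + (∑ i, A i 1 ^2) * m^2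
      + 2 * (∑ i, A i 1 * A i 2) * m * n + (∑ i, A i 2 ^2) * n^2) := by
  rw [io_e1]; simp [Ssq, Matrix.mul_apply, Fin.sum_univ_three]; ring
lemma io_e2 (m n : ℤ) : ((io (e2 m n) : G) : M3) = !![1,(m:ℝ),0;0,1,0;0,(n:ℝ),1] := by
  ext i j
  rw [io_coe]
  fin_cases i <;> fin_cases j <;> simp [e2]
lemma Ssq_e2 (A : M3) (m n : ℤ) : Ssq (A * ((io (e2 m n) : G) : M3)) = Ssq A +
    (2 * m * (∑ i, A i 0 * A i 1) + 2 * n * (∑ i, A i 1 * A i 2) + (∑ i, A i 0 ^2) * m^2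
      + 2 * (∑ i, A i 0 * A i 2) * m * n + (∑ i, A i 2 ^2) * n^2) := by
  rw [io_e2]; simp [Ssq, Matrix.mul_apply, Fin.sum_univ_three]; ring
lemma io_e3 (m n : ℤ) : ((io (e3 m n) : G) : M3) = !![1,0,(m:ℝ);0,1,(n:ℝ);0,0,1] := by
  ext i j
  rw [io_coe]
  fin_cases i <;> fin_cases j <;> simp [e3]
lemma Ssq_e3 (A : M3) (m n : ℤ) : Ssq (A * ((io (e3 m n) : G) : M3)) = Ssq A +
    (2 * m * (∑ i, A i 0 * A i 2) + 2 * n * (∑ i, A i 1 * A i 2) + (∑ i, A i 0 ^2) * m^2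
      + 2 * (∑ i, A i 0 * A i 1) * m * n + (∑ i, A i 1 ^2) * n^2) := by
  rw [io_e3]; simp [Ssq, Matrix.mul_apply, Fin.sum_univ_three]; ring

lemma bound_of {δ a b c x : ℝ} (hδ : 0 < δ) (ha : δ^2 ≤ a) (hb : δ^2 ≤ b) (h : 3 * (a * b * c) ≤ 8)
    (hc : 0 < c) (hx : x^2 ≤ c) : |x| ≤ 2 / δ^2 := by
  have h1 : δ^2 * δ^2 * c ≤ a * b * c := by
    have : 0 < δ^2 := by positivity
    have : 0 < a := by linarith
    gcongr
  rw [le_div_iff₀ (by positivity)]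
  refine abs_le_of_sq_le_sq' ?_ (by norm_num) |>.2
  rw [mul_pow, sq_abs]
  nlinarith [sq_nonneg δ, mul_nonneg (sq_nonneg δ) (sq_nonneg δ)]

theorem mahler {δ : ℝ} (hδ : 0 < δ) (g : G) (h : ∀ m, m ≠ 0 → δ ≤ ‖(g : M3) *ᵥ rv m‖) :
    ∃ γ : Gam, ∀ i j, |((g * io γ : G) : M3) i j| ≤ 2 / δ^2 := by
  obtain ⟨γ, hγ⟩ := exists_min g
  refine ⟨γ, ?_⟩
  set A := ((g * io γ : G) : M3) with hA
  have hdet : A.det = 1 := (g * io γ).2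
  have hmin : ∀ γ' : Gam, Ssq A ≤ Ssq (A * ((io γ' : G) : M3)) := by
    intro γ'
    have := hγ (γ * γ')
    rwa [map_mul, ← mul_assoc, Matrix.SpecialLinearGroup.coe_mul] at this
  have hcol : ∀ j, δ^2 ≤ ∑ i, A i j ^2 := by
    intro j
    have hne : (fun i => (γ : Matrix (Fin 3) (Fin 3) ℤ) i j) ≠ 0 := by
      intro h0
      have : (γ : Matrix (Fin 3) (Fin 3) ℤ).det = 0 :=
        Matrix.det_eq_zero_of_column_eq_zero j (fun i => congrFun h0 i)
      rw [γ.2] at this; norm_num at this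
    have h1 := h _ hne
    have h2 : (g : M3) *ᵥ rv (fun i => (γ : Matrix (Fin 3) (Fin 3) ℤ) i j) = fun i => A i j := by
      ext i
      rw [hA, Matrix.SpecialLinearGroup.coe_mul, Matrix.mul_apply]
      simp [Matrix.mulVec, dotProduct, rv, io_coe]
    rw [h2] at h1
    obtain ⟨i, hi⟩ : ∃ i, δ ≤ |A i j| := by
      by_contra hcon
      push Not at hcon
      have : ‖fun i => A i j‖ < δ := by
        rw [pi_norm_lt_iff hδ]; exact hcon
      linarith
    calc δ^2 ≤ |A i j|^2 := by gcongr
      _ = A i j ^2 := sq_abs _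
      _ ≤ _ := Finset.single_le_sum (f := fun i => A i j ^2) (fun i _ => by positivity) (Finset.mem_univ i)
  have hent : ∀ i j, A i j ^2 ≤ ∑ i, A i j ^2 := fun i j =>
    Finset.single_le_sum (f := fun i => A i j ^2) (fun i _ => by positivity) (Finset.mem_univ i)
  have m1 : ∀ m n : ℤ, _ := fun m n => (hmin (e1 m n)).trans_eq (Ssq_e1 A m n)
  have m2 : ∀ m n : ℤ, _ := fun m n => (hmin (e2 m n)).trans_eq (Ssq_e2 A m n)
  have m3 : ∀ m n : ℤ, _ := fun m n => (hmin (e3 m n)).trans_eq (Ssq_e3 A m n)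
  simp only [le_add_iff_nonneg_right] at m1 m2 m3
  have gram : (∑ i, A i 0 ^2) * (∑ i, A i 1 ^2) * (∑ i, A i 2 ^2)
      + 2 * (∑ i, A i 0 * A i 1) * (∑ i, A i 0 * A i 2) * (∑ i, A i 1 * A i 2)
      - (∑ i, A i 0 ^2) * (∑ i, A i 1 * A i 2)^2 - (∑ i, A i 1 ^2) * (∑ i, A i 0 * A i 2)^2
      - (∑ i, A i 2 ^2) * (∑ i, A i 0 * A i 1)^2 = 1 := by
    have : A.det ^2 = 1 := by rw [hdet]; norm_num
    rw [← this, Matrix.det_fin_three]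
    simp only [Fin.sum_univ_three]
    ring
  have c0 := hcol 0
  have c1 := hcol 1
  have c2 := hcol 2
  have n0 := fun i => hent i 0
  have n1 := fun i => hent i 1
  have n2 := fun i => hent i 2
  have hδ2 : 0 < δ^2 := by positivity
  generalize (∑ i, A i 0 ^2) = a at *
  generalize (∑ i, A i 1 ^2) = b at *
  generalize (∑ i, A i 2 ^2) = c at *
  generalize (∑ i, A i 0 * A i 1) = p at *
  generalize (∑ i, A i 0 * A i 2) = q at *
  generalize (∑ i, A i 1 * A i 2) = r at *
  have ha : 0 < a := by linarith
  have hb : 0 < b := by linarith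
  have hc : 0 < c := by linarith
  have ineqs : (2 * |p| ≤ a ∧ 2 * |p| ≤ b) ∧ (2 * |q| ≤ a ∧ 2 * |q| ≤ c) ∧ (2 * |r| ≤ b ∧ 2 * |r| ≤ c) := by
    have x1 := m1 1 0
    have x2 := m1 (-1) 0
    have x3 := m1 0 1
    have x4 := m1 0 (-1)
    have y1 := m2 1 0
    have y2 := m2 (-1) 0
    have y3 := m2 0 1
    have y4 := m2 0 (-1)
    have z1 := m3 1 0
    have z2 := m3 (-1) 0
    have z3 := m3 0 1
    have z4 := m3 0 (-1)
    norm_num at x1 x2 x3 x4 y1 y2 y3 y4 z1 z2 z3 z4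
    refine ⟨⟨?_, ?_⟩, ⟨?_, ?_⟩, ⟨?_, ?_⟩⟩ <;>
    · rw [← abs_two, ← abs_mul, abs_le]; constructor <;> linarith
  obtain ⟨⟨i1, i2⟩, ⟨i3, i4⟩, ⟨i5, i6⟩⟩ := ineqs
  have key : 3 * (a * b * c) ≤ 8 := by
    rcases le_total a c with h1 | h1 <;> rcases le_total b c with h2 | h2 <;> rcases le_total a b with h3 | h3
    · have := gram_ineq ha hb hc i1 i2 h1 h2 m3; linarith
    · have := gram_ineq ha hb hc i1 i2 h1 h2 m3; linarith
    · have := gram_ineq ha hc hb i3 i4 h3 h2 m2; linarith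
    · have := gram_ineq ha hc hb i3 i4 (by linarith) h2 m2; linarith
    · have := gram_ineq hb hc ha i5 i6 (by linarith) h1 m1; linarith
    · have := gram_ineq hb hc ha i5 i6 (by linarith) h1 m1; linarith
    · have := gram_ineq ha hc hb i3 i4 (by linarith) h2 m2; linarith
    · have := gram_ineq hb hc ha i5 i6 (by linarith) h1 m1; linarith
  intro i j
  fin_cases j
  · exact bound_of hδ c1 c2 (by linarith) ha (n0 i)
  · exact bound_of hδ c0 c2 (by linarith) hb (n1 i)
  · exact bound_of hδ c0 c1 (by linarith) hc (n2 i)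

end Opp


namespace Opp
open Matrix Filter Topology
set_option linter.all false

def Bd (R : ℝ) : Set G := {g | ∀ i j, |(g : M3) i j| ≤ R}
def BM (R : ℝ) : Set G := {g | ∃ γ : Gam, g * io γ ∈ Bd R}
noncomputable def RR (η : ℝ) : ℝ := 2 / (η / 1000000)^2

lemma nondiv_bm {η : ℝ} (hη : 0 < η) (hη1 : η ≤ 1) (y : G) {α β : ℝ} (hab : α < β)
    (hf : ∀ m, m ≠ 0 → ∃ t ∈ Set.Icc α β, η ≤ ‖fv y m t‖)
    (hg : ∀ m, m ≠ 0 → ∃ t ∈ Set.Icc α β, η ≤ ‖gv y m t‖) :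
    ∃ t ∈ Set.Icc α β, v1 t * y ∈ BM (RR η) := by
  obtain ⟨t, ht, h⟩ := nondiv hη hη1 y hab hf hg
  exact ⟨t, ht, mahler (by positivity) _ h⟩

lemma norm_mulVec_le {A : M3} {B : ℝ} (hA : ∀ i j, |A i j| ≤ B) (x : Fin 3 → ℝ) :
    ‖A *ᵥ x‖ ≤ 3 * (B * ‖x‖) := by
  have hB : 0 ≤ B := (abs_nonneg _).trans (hA 0 0)
  rw [pi_norm_le_iff_of_nonneg (by positivity)]
  intro i
  have t : ∀ k, |A i k * x k| ≤ B * ‖x‖ := fun k => by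
    rw [abs_mul]; exact mul_le_mul (hA i k) (norm_le_pi_norm x k) (abs_nonneg _) hB
  rw [Matrix.mulVec, dotProduct, Fin.sum_univ_three, Real.norm_eq_abs]
  refine (abs_add_three _ _ _).trans ?_
  linarith [t 0, t 1, t 2]

lemma norm_rv_le (g : G) : ∃ C, 0 < C ∧ ∀ x : Fin 3 → ℝ, ‖x‖ ≤ C * ‖(g : M3) *ᵥ x‖ := by
  obtain ⟨B, hB, h⟩ := exists_entry_bd ((g⁻¹ : G) : M3)
  refine ⟨3 * B, by positivity, fun x => ?_⟩
  have e : x = ((g⁻¹ : G) : M3) *ᵥ ((g : M3) *ᵥ x) := by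
    rw [Matrix.mulVec_mulVec, ← Matrix.SpecialLinearGroup.coe_mul, inv_mul_cancel,
      Matrix.SpecialLinearGroup.coe_one, Matrix.one_mulVec]
  have := norm_mulVec_le h ((g : M3) *ᵥ x)
  rw [← e] at this
  linarith

lemma one_le_norm_rv {m : Fin 3 → ℤ} (h : m ≠ 0) : 1 ≤ ‖rv m‖ := by
  obtain ⟨i, hi⟩ := Function.ne_iff.mp h
  refine le_trans ?_ (norm_le_pi_norm (rv m) i)
  rw [rv, Real.norm_eq_abs]
  exact_mod_cast Int.one_le_abs hi

lemma finite_short (g : G) (C : ℝ) : {m : Fin 3 → ℤ | ‖(g : M3) *ᵥ rv m‖ ≤ C}.Finite := by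
  obtain ⟨D, hD, h⟩ := norm_rv_le g
  have hfin : (Set.pi Set.univ (fun _ : Fin 3 => Set.Icc (-⌈D * C⌉) ⌈D * C⌉)).Finite :=
    Set.Finite.pi fun _ => Set.finite_Icc _ _
  refine hfin.subset ?_
  intro m hm i _
  have hm : ‖(g : M3) *ᵥ rv m‖ ≤ C := hm
  have h1 : ‖rv m i‖ ≤ D * C := (norm_le_pi_norm _ i).trans ((h _).trans (by gcongr))
  rw [rv, Real.norm_eq_abs, abs_le] at h1
  have h2 := Int.le_ceil (D * C)
  constructor
  · have : (-(⌈D * C⌉:ℝ)) ≤ (m i : ℝ) := by linarith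
    exact_mod_cast this
  · have : (m i : ℝ) ≤ (⌈D * C⌉:ℝ) := by linarith
    exact_mod_cast this

lemma lin_grow (b c η T0 : ℝ) (hc : c ≠ 0) : ∃ t ≥ T0, η ≤ |b + t * c| := by
  have hc' : 0 < |c| := abs_pos.mpr hc
  refine ⟨max T0 ((|η| + |b|) / |c|), le_max_left _ _, ?_⟩
  set t := max T0 ((|η| + |b|) / |c|)
  have h1 : (|η| + |b|) / |c| ≤ t := le_max_right _ _
  have h0 : 0 ≤ t := le_trans (by positivity) h1
  rw [div_le_iff₀ hc'] at h1
  have h2 : |t * c| ≤ |b + t * c| + |b| := by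
    have := abs_sub (b + t * c) b
    rwa [add_sub_cancel_left] at this
  rw [abs_mul, abs_of_nonneg h0] at h2
  linarith [le_abs_self η]

/-- condition on invariant vectors -/
def InvOK (η : ℝ) (y : G) : Prop :=
  (∀ m : Fin 3 → ℤ, m ≠ 0 → ((y : M3) *ᵥ rv m) 1 = 0 → ((y : M3) *ᵥ rv m) 2 = 0 → η ≤ ‖(y : M3) *ᵥ rv m‖) ∧
  (∀ m : Fin 3 → ℤ, m ≠ 0 → (((co y : G) : M3) *ᵥ rv m) 0 = 0 → (((co y : G) : M3) *ᵥ rv m) 1 = 0 →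
    η ≤ ‖((co y : G) : M3) *ᵥ rv m‖)

lemma unif_time {F : (Fin 3 → ℤ) → ℝ → Fin 3 → ℝ} {η T0 : ℝ}
    (hfin : {m | ‖F m T0‖ ≤ η}.Finite) (h : ∀ m, m ≠ 0 → ∃ t ≥ T0, η ≤ ‖F m t‖) :
    ∃ β > T0, ∀ β' ≥ β, ∀ m, m ≠ 0 → ∃ t ∈ Set.Icc T0 β', η ≤ ‖F m t‖ := by
  have : ∀ m, ∃ t ≥ T0, m ≠ 0 → η ≤ ‖F m t‖ := by
    intro m
    by_cases hm : m = 0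
    · exact ⟨T0, le_refl _, fun h => absurd hm h⟩
    · obtain ⟨t, ht, h'⟩ := h m hm
      exact ⟨t, ht, fun _ => h'⟩
  choose τ hτ hτ' using this
  obtain ⟨β, hβ⟩ := (hfin.image τ).bddAbove
  refine ⟨max β T0 + 1, by linarith [le_max_right β T0], ?_⟩
  intro β' hβ' m hm
  by_cases hs : ‖F m T0‖ ≤ η
  · refine ⟨τ m, ⟨hτ m, ?_⟩, hτ' m hm⟩
    have : τ m ≤ β := hβ ⟨m, hs, rfl⟩
    linarith [le_max_left β T0]
  · exact ⟨T0, ⟨le_refl _, by linarith [le_max_right β T0]⟩, (not_le.mp hs).le⟩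

lemma comp_le {x : Fin 3 → ℝ} (i : Fin 3) {η : ℝ} (h : η ≤ |x i|) : η ≤ ‖x‖ :=
  h.trans (norm_le_pi_norm x i)

lemma N2 {η : ℝ} (hη : 0 < η) (hη1 : η ≤ 1) {y : G} (hy : InvOK η y) (T0 : ℝ) :
    (∃ t ≥ T0, v1 t * y ∈ BM (RR η)) ∧ (∃ t ≥ T0, v1 (-t) * y ∈ BM (RR η)) := by
  have grow : ∀ e : ℝ, e = 1 ∨ e = -1 → (∀ m, m ≠ 0 → ∃ t ≥ T0, η ≤ ‖fv y m (e * t)‖) ∧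
      (∀ m, m ≠ 0 → ∃ t ≥ T0, η ≤ ‖gv y m (e * t)‖) := by
    intro e he
    have he0 : e ≠ 0 := by rcases he with h | h <;> rw [h] <;> norm_num
    constructor
    · intro m hm
      have h1 := hy.1 m hm
      simp only [fv_eq, v1_mulVec]
      set x := (y : M3) *ᵥ rv m
      by_cases hx2 : x 2 = 0
      · by_cases hx1 : x 1 = 0
        · refine ⟨T0, le_refl _, (h1 hx1 hx2).trans (le_of_eq ?_)⟩
          congr 1; ext i; fin_cases i <;> simp [hx1, hx2]
        · obtain ⟨t, ht, h⟩ := lin_grow (x 0) (e * x 1) η T0 (mul_ne_zero he0 hx1)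
          refine ⟨t, ht, comp_le 0 (h.trans (le_of_eq ?_))⟩
          simp [hx2]; ring_nf
      · obtain ⟨t, ht, h⟩ := lin_grow (x 1) (e * x 2) η T0 (mul_ne_zero he0 hx2)
        refine ⟨t, ht, comp_le 1 (h.trans (le_of_eq ?_))⟩
        simp; ring_nf
    · intro m hm
      have h1 := hy.2 m hm
      simp only [gv_eq, co_v1_mulVec]
      set x := ((co y : G) : M3) *ᵥ rv m
      by_cases hx2 : x 0 = 0
      · by_cases hx1 : x 1 = 0
        · refine ⟨T0, le_refl _, (h1 hx2 hx1).trans (le_of_eq ?_)⟩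
          congr 1; ext i; fin_cases i <;> simp [hx1, hx2]
        · obtain ⟨t, ht, h⟩ := lin_grow (x 2) (-e * x 1) η T0 (mul_ne_zero (neg_ne_zero.mpr he0) hx1)
          refine ⟨t, ht, comp_le 2 (h.trans (le_of_eq ?_))⟩
          simp [hx2]; ring_nf
      · obtain ⟨t, ht, h⟩ := lin_grow (x 1) (-e * x 0) η T0 (mul_ne_zero (neg_ne_zero.mpr he0) hx2)
        refine ⟨t, ht, comp_le 1 (h.trans (le_of_eq ?_))⟩
        simp; ring_nf
  have all : ∀ e : ℝ, e = 1 ∨ e = -1 → ∃ β > T0, (∀ m, m ≠ 0 → ∃ t ∈ Set.Icc T0 β, η ≤ ‖fv y m (e * t)‖) ∧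
      (∀ m, m ≠ 0 → ∃ t ∈ Set.Icc T0 β, η ≤ ‖gv y m (e * t)‖) := by
    intro e he
    obtain ⟨g1, g2⟩ := grow e he
    obtain ⟨b1, hb1, h1⟩ := unif_time (F := fun m t => fv y m (e * t)) (finite_short (v1 (e * T0) * y) η) g1
    obtain ⟨b2, hb2, h2⟩ := unif_time (F := fun m t => gv y m (e * t)) (finite_short (co (v1 (e * T0) * y)) η) g2
    exact ⟨max b1 b2, lt_of_lt_of_le hb1 (le_max_left _ _), h1 _ (le_max_left _ _), h2 _ (le_max_right _ _)⟩
  constructor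
  · obtain ⟨β, hβ, h1, h2⟩ := all 1 (Or.inl rfl)
    simp only [one_mul] at h1 h2
    obtain ⟨t, ht, h⟩ := nondiv_bm hη hη1 y hβ h1 h2
    exact ⟨t, ht.1, h⟩
  · obtain ⟨β, hβ, h1, h2⟩ := all (-1) (Or.inr rfl)
    obtain ⟨t, ht, h⟩ := nondiv_bm (α := -β) (β := -T0) hη hη1 y (by linarith)
      (fun m hm => by
        obtain ⟨t, ht, h⟩ := h1 m hm
        exact ⟨-t, ⟨by linarith [ht.2], by linarith [ht.1]⟩, by simpa using h⟩)
      (fun m hm => by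
        obtain ⟨t, ht, h⟩ := h2 m hm
        exact ⟨-t, ⟨by linarith [ht.2], by linarith [ht.1]⟩, by simpa using h⟩)
    exact ⟨-t, by linarith [ht.2], by simpa using h⟩

lemma InvOK_single (y : G) : ∃ η, 0 < η ∧ η ≤ 1 ∧ InvOK η y := by
  obtain ⟨C, hC, h⟩ := norm_rv_le y
  obtain ⟨D, hD, h'⟩ := norm_rv_le (co y)
  refine ⟨min 1 (min (1/C) (1/D)), by positivity, min_le_left _ _, ?_, ?_⟩
  · intro m hm _ _
    have h1 := (one_le_norm_rv hm).trans (h _)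
    refine (min_le_right _ _).trans ((min_le_left _ _).trans ?_)
    rw [div_le_iff₀ hC]; linarith
  · intro m hm _ _
    have h1 := (one_le_norm_rv hm).trans (h' _)
    refine (min_le_right _ _).trans ((min_le_right _ _).trans ?_)
    rw [div_le_iff₀ hD]; linarith

lemma dg_v1 (a : ℝ) (ha : a ≠ 0) (t : ℝ) : dg a ha * v1 t = v1 (a * t) * dg a ha := by
  apply Gext
  rw [Matrix.SpecialLinearGroup.coe_mul, Matrix.SpecialLinearGroup.coe_mul, v1_coe, v1_coe, dg_coe]
  simp only [Matrix.mul_fin_three]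
  ext i j
  fin_cases i <;> fin_cases j <;> simp <;> field_simp

lemma dg_v2 (a : ℝ) (ha : a ≠ 0) (t : ℝ) : dg a ha * v2 t = v2 (a^2 * t) * dg a ha := by
  apply Gext
  rw [Matrix.SpecialLinearGroup.coe_mul, Matrix.SpecialLinearGroup.coe_mul, v2_coe, v2_coe, dg_coe]
  simp only [Matrix.mul_fin_three]
  ext i j
  fin_cases i <;> fin_cases j <;> simp <;> field_simp

lemma dg_inv (a : ℝ) (ha : a ≠ 0) : (dg a ha)⁻¹ = dg a⁻¹ (inv_ne_zero ha) := by
  rw [inv_eq_iff_mul_eq_one]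
  apply Gext
  rw [Matrix.SpecialLinearGroup.coe_mul, dg_coe, dg_coe]
  simp only [Matrix.mul_fin_three]
  ext i j
  fin_cases i <;> fin_cases j <;> simp [ha]

lemma co_dg (a : ℝ) (ha : a ≠ 0) : co (dg a ha) = dg a⁻¹ (inv_ne_zero ha) := by
  apply Gext
  rw [co_coe, dg_inv, dg_coe]
  ext i j
  fin_cases i <;> fin_cases j <;> simp

lemma quad_coef {α β : ℝ} (hab : α < β) : ∃ C > 0, ∀ A B D M : ℝ,
    (∀ t ∈ Set.Icc α β, |A + t * B + t^2 * D| ≤ M) → |A| ≤ C * M ∧ |B| ≤ C * M ∧ |D| ≤ C * M := by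
  set h := (β - α)/2 with hh
  set μ := (α + β)/2 with hμ
  have hpos : 0 < h := by rw [hh]; linarith
  refine ⟨(2 / h^2) + (1 / h + 2 * |μ| * (2 / h^2)) + (1 + |μ| * (1 / h + 2 * |μ| * (2 / h^2)) + μ^2 * (2 / h^2)), by positivity, ?_⟩
  intro A B D M H
  have p0 := H μ ⟨by linarith, by linarith⟩
  have p1 := H (μ + h) ⟨by linarith, by linarith⟩
  have p2 := H (μ - h) ⟨by linarith, by linarith⟩
  have hM : 0 ≤ M := (abs_nonneg _).trans p0
  have hD : |D| ≤ (2 / h^2) * M := by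
    rw [div_mul_eq_mul_div, le_div_iff₀ (by positivity), ← abs_of_pos (show 0 < h^2 by positivity), ← abs_mul]
    rw [abs_le] at *
    constructor <;> linarith
  have hB' : |B + 2 * μ * D| ≤ (1 / h) * M := by
    rw [div_mul_eq_mul_div, le_div_iff₀ hpos]
    rw [show |B + 2 * μ * D| * h = |(B + 2 * μ * D) * h| by rw [abs_mul, abs_of_pos hpos]]
    rw [abs_le] at *
    constructor <;> linarith
  have hB : |B| ≤ (1 / h + 2 * |μ| * (2 / h^2)) * M := by
    have e : B = (B + 2 * μ * D) - 2 * μ * D := by ring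
    have : |B| ≤ |B + 2 * μ * D| + |2 * μ * D| := by
      conv_lhs => rw [e]
      exact abs_sub _ _
    have e2 : |2 * μ * D| ≤ 2 * |μ| * (2 / h^2 * M) := by
      rw [abs_mul, abs_mul, abs_two]; gcongr
    linarith
  have hA : |A| ≤ (1 + |μ| * (1 / h + 2 * |μ| * (2 / h^2)) + μ^2 * (2 / h^2)) * M := by
    have e : A = (A + μ * B + μ^2 * D) + (- (μ * B)) + (- (μ^2 * D)) := by ring
    have : |A| ≤ |A + μ * B + μ^2 * D| + |μ * B| + |μ^2 * D| := by
      conv_lhs => rw [e]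
      refine (abs_add_three _ _ _).trans ?_
      rw [abs_neg, abs_neg]
    have e1 : |μ * B| ≤ |μ| * ((1 / h + 2 * |μ| * (2 / h^2)) * M) := by rw [abs_mul]; gcongr
    have e2 : |μ^2 * D| ≤ μ^2 * (2 / h^2 * M) := by
      rw [abs_mul, abs_of_nonneg (sq_nonneg μ)]; gcongr
    linarith
  have z1 : 0 ≤ (2 / h^2) * M := by positivity
  have z2 : 0 ≤ (1 / h + 2 * |μ| * (2 / h^2)) * M := by positivity
  have z3 : 0 ≤ (1 + |μ| * (1 / h + 2 * |μ| * (2 / h^2)) + μ^2 * (2 / h^2)) * M := by positivity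
  refine ⟨?_, ?_, ?_⟩ <;> linarith

lemma U2 (y : G) {α β : ℝ} (hab : α < β) : ∃ a0 > 0, ∀ a, ∀ ha : a ≠ 0, a0 ≤ a →
    ∃ t ∈ Set.Icc α β, dg a ha * v1 t * y ∈ BM (RR 1) := by
  obtain ⟨K, hK, hKc⟩ := quad_coef hab
  obtain ⟨C, hC, h⟩ := norm_rv_le y
  obtain ⟨D, hD, h'⟩ := norm_rv_le (co y)
  set c := min (1/C) (1/D) with hc
  have c0 : 0 < c := by positivity
  have low1 : ∀ m : Fin 3 → ℤ, m ≠ 0 → c ≤ ‖(y : M3) *ᵥ rv m‖ := by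
    intro m hm
    have h1 := (one_le_norm_rv hm).trans (h _)
    refine (min_le_left _ _).trans ?_
    rw [div_le_iff₀ hC]; linarith
  have low2 : ∀ m : Fin 3 → ℤ, m ≠ 0 → c ≤ ‖((co y : G) : M3) *ᵥ rv m‖ := by
    intro m hm
    have h1 := (one_le_norm_rv hm).trans (h' _)
    refine (min_le_right _ _).trans ?_
    rw [div_le_iff₀ hD]; linarith
  -- sup bound
  have sup : ∀ A B E : ℝ, (c ≤ |A| ∨ c ≤ |B| ∨ c ≤ |E|) →
      ∃ t ∈ Set.Icc α β, c / (4 * K) ≤ |A + t * B + t^2 * (E/2)| := by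
    intro A B E hABE
    by_contra hcon
    push Not at hcon
    obtain ⟨k1, k2, k3⟩ := hKc A B (E/2) (c / (4*K)) (fun t ht => (hcon t ht).le)
    have e : K * (c / (4*K)) = c / 4 := by field_simp
    rw [e] at k1 k2 k3
    rw [abs_div, abs_two] at k3
    rcases hABE with h | h | h <;> linarith
  have exco : ∀ x : Fin 3 → ℝ, c ≤ ‖x‖ → (c ≤ |x 0| ∨ c ≤ |x 1| ∨ c ≤ |x 2|) := by
    intro x hx
    by_contra hcon
    push Not at hcon
    have : ‖x‖ < c := by
      rw [pi_norm_lt_iff c0]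
      intro i
      fin_cases i
      exacts [hcon.1, hcon.2.1, hcon.2.2]
    linarith
  refine ⟨4 * K / c, by positivity, fun a ha haa => ?_⟩
  have a0 : 0 < a := lt_of_lt_of_le (by positivity) haa
  have hac : 1 ≤ a * (c / (4 * K)) := by
    rw [div_le_iff₀ c0] at haa
    rw [mul_div_assoc', le_div_iff₀ (by positivity)]; linarith
  obtain ⟨s, hs, hh⟩ := nondiv_bm one_pos le_rfl (dg a ha * y) (α := a * α) (β := a * β)
    (by gcongr) (by
      intro m hm
      obtain ⟨t, ht, hb⟩ := sup _ _ _ (exco _ (low1 m hm))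
      refine ⟨a * t, ⟨by nlinarith [ht.1], by nlinarith [ht.2]⟩, ?_⟩
      rw [fv, ← mul_assoc, ← dg_v1, Matrix.SpecialLinearGroup.coe_mul, Matrix.SpecialLinearGroup.coe_mul,
        ← Matrix.mulVec_mulVec, ← Matrix.mulVec_mulVec, v1_mulVec]
      set x := (y : M3) *ᵥ rv m
      refine comp_le 0 ?_
      have : ((dg a ha : G) : M3) *ᵥ ![x 0 + t * x 1 + t ^ 2 / 2 * x 2, x 1 + t * x 2, x 2] =
        ![a * (x 0 + t * x 1 + t ^ 2 / 2 * x 2), x 1 + t * x 2, a⁻¹ * x 2] := by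
        ext i; fin_cases i <;> simp [dg_coe, Matrix.mulVec, dotProduct, Fin.sum_univ_three]
      rw [this]
      simp only [Matrix.cons_val_zero]
      rw [abs_mul, abs_of_pos a0]
      refine hac.trans ?_
      gcongr
      refine hb.trans (le_of_eq ?_)
      ring_nf) (by
      intro m hm
      obtain ⟨t, ht, hb⟩ := sup ((((co y : G) : M3) *ᵥ rv m) 2) (-(((co y : G) : M3) *ᵥ rv m) 1) ((((co y : G) : M3) *ᵥ rv m) 0) (by
        rw [abs_neg]
        rcases exco _ (low2 m hm) with h | h | h
        exacts [Or.inr (Or.inr h), Or.inr (Or.inl h), Or.inl h])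
      refine ⟨a * t, ⟨by nlinarith [ht.1], by nlinarith [ht.2]⟩, ?_⟩
      rw [gv, ← mul_assoc, ← dg_v1, co_mul, co_mul, Matrix.SpecialLinearGroup.coe_mul, Matrix.SpecialLinearGroup.coe_mul,
        ← Matrix.mulVec_mulVec, ← Matrix.mulVec_mulVec, co_v1_mulVec, co_dg]
      set x := ((co y : G) : M3) *ᵥ rv m
      refine comp_le 2 ?_
      have : ((dg a⁻¹ (inv_ne_zero ha) : G) : M3) *ᵥ ![x 0, x 1 - t * x 0, x 2 - t * x 1 + t ^ 2 / 2 * x 0] =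
        ![a⁻¹ * x 0, x 1 - t * x 0, a * (x 2 - t * x 1 + t ^ 2 / 2 * x 0)] := by
        ext i; fin_cases i <;> simp [dg_coe, Matrix.mulVec, dotProduct, Fin.sum_univ_three]
      rw [this]
      simp only [Matrix.cons_val]
      rw [abs_mul, abs_of_pos a0]
      refine hac.trans ?_
      gcongr
      refine hb.trans (le_of_eq ?_)
      ring_nf)
  refine ⟨s / a, ⟨by rw [le_div_iff₀ a0]; linarith [hs.1], by rw [div_le_iff₀ a0]; linarith [hs.2]⟩, ?_⟩
  rw [dg_v1, mul_div_cancel₀ _ ha, mul_assoc]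
  exact hh

end Opp


namespace Opp
open Matrix Filter Topology
set_option linter.all false

instance instFCM : FirstCountableTopology M3 :=
  inferInstanceAs (FirstCountableTopology (Fin 3 → Fin 3 → ℝ))
instance instFCG : FirstCountableTopology G :=
  (Matrix.SpecialLinearGroup.isClosedEmbedding_val (n := Fin 3) (R := ℝ)).isEmbedding.isInducing.firstCountableTopology

lemma continuous_coe : Continuous (fun g : G => (g : M3)) := continuous_subtype_val
lemma continuous_entry (i j : Fin 3) : Continuous (fun g : G => (g : M3) i j) :=
  (continuous_coe).matrix_elem i j

lemma isCompact_Bd (R : ℝ) : IsCompact (Bd R) := by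
  have h : IsCompact {A : M3 | ∀ i j, |A i j| ≤ R} := by
    have h1 : IsCompact (Set.pi Set.univ (fun _ : Fin 3 => Set.pi Set.univ (fun _ : Fin 3 => Set.Icc (-R) R))) :=
      isCompact_univ_pi fun _ => isCompact_univ_pi fun _ => isCompact_Icc
    have h2 : (Set.pi Set.univ (fun _ : Fin 3 => Set.pi Set.univ (fun _ : Fin 3 => Set.Icc (-R) R)))
        = {A : Fin 3 → Fin 3 → ℝ | ∀ i j, |A i j| ≤ R} := by
      ext A
      simp only [Set.mem_setOf_eq, Set.mem_pi, Set.mem_univ, true_imp_iff, Set.mem_Icc, abs_le]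
    rw [h2] at h1
    exact h1
  exact (Matrix.SpecialLinearGroup.isClosedEmbedding_val).isCompact_preimage h

lemma isClosed_Bd (R : ℝ) : IsClosed (Bd R) := (isCompact_Bd R).isClosed

lemma Bd_mono {R R' : ℝ} (h : R ≤ R') : Bd R ⊆ Bd R' := fun g hg i j => (hg i j).trans h

/-- left-`L`, right-`Γ` invariance -/
def Inv (L : Set G) (E : Set G) : Prop :=
  (∀ y ∈ E, ∀ h ∈ L, h * y ∈ E) ∧ (∀ y ∈ E, ∀ γ : Gam, y * io γ ∈ E)

def IsMin (L : Set G) (Y : Set G) : Prop :=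
  IsClosed Y ∧ Y.Nonempty ∧ Inv L Y ∧ ∀ Z ⊆ Y, IsClosed Z → Z.Nonempty → Inv L Z → Z = Y

lemma Inv.meet {L E : Set G} (h : Inv L E) {R : ℝ} {y : G} (hy : y ∈ E) (hR : y ∈ BM R) :
    (E ∩ Bd R).Nonempty := by
  obtain ⟨γ, hγ⟩ := hR
  exact ⟨_, h.2 y hy γ, hγ⟩

lemma exists_min_set {L E : Set G} {R : ℝ} (hE : IsClosed E) (hne : E.Nonempty) (hinv : Inv L E)
    (hK : ∀ Z ⊆ E, IsClosed Z → Z.Nonempty → Inv L Z → (Z ∩ Bd R).Nonempty) :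
    ∃ Y ⊆ E, IsMin L Y := by
  let S : Set (Set G) := {Z | Z ⊆ E ∧ IsClosed Z ∧ Z.Nonempty ∧ Inv L Z}
  obtain ⟨Y, hYE, hY⟩ := zorn_superset_nonempty S (by
    intro c hc hchain hcne
    refine ⟨⋂₀ c, ⟨?_, ?_, ?_, ?_⟩, fun s hs => Set.sInter_subset_of_mem hs⟩
    · obtain ⟨Z, hZ⟩ := hcne
      exact (Set.sInter_subset_of_mem hZ).trans (hc hZ).1
    · exact isClosed_sInter fun Z hZ => (hc hZ).2.1
    · have hne2 : (⋂₀ ((fun Z => Z ∩ Bd R) '' c)).Nonempty := by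
        have : Nonempty ((fun Z => Z ∩ Bd R) '' c) := (hcne.image _).to_subtype
        apply IsCompact.nonempty_sInter_of_directed_nonempty_isCompact_isClosed
        · rintro _ ⟨Z, hZ, rfl⟩ _ ⟨Z', hZ', rfl⟩
          rcases hchain.total hZ hZ' with h | h
          · exact ⟨Z ∩ Bd R, ⟨Z, hZ, rfl⟩, subset_rfl, Set.inter_subset_inter_left _ h⟩
          · exact ⟨Z' ∩ Bd R, ⟨Z', hZ', rfl⟩, Set.inter_subset_inter_left _ h, subset_rfl⟩
        · rintro _ ⟨Z, hZ, rfl⟩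
          obtain ⟨h1, h2, h3, h4⟩ := hc hZ
          exact hK Z h1 h2 h3 h4
        · rintro _ ⟨Z, hZ, rfl⟩
          exact (isCompact_Bd R).inter_left (hc hZ).2.1
        · rintro _ ⟨Z, hZ, rfl⟩
          exact (hc hZ).2.1.inter (isClosed_Bd R)
      obtain ⟨x, hx⟩ := hne2
      exact ⟨x, fun Z hZ => (hx _ ⟨Z, hZ, rfl⟩).1⟩
    · refine ⟨fun y hy h hh Z hZ => (hc hZ).2.2.2.1 y (hy Z hZ) h hh,
        fun y hy γ Z hZ => (hc hZ).2.2.2.2 y (hy Z hZ) γ⟩) E ⟨subset_rfl, hE, hne, hinv⟩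
  have hYS : Y ∈ S := hY.prop
  refine ⟨Y, hYE, hYS.2.1, hYS.2.2.1, hYS.2.2.2, ?_⟩
  intro Z hZ h1 h2 h3
  exact Set.Subset.antisymm hZ (hY.le_of_le ⟨hZ.trans hYE, h1, h2, h3⟩ hZ)

/-- In a minimal set, every orbit is dense. -/
lemma IsMin.dense {L Y : Set G} (hY : IsMin L Y) (hL1 : (1 : G) ∈ L)
    (hLm : ∀ a ∈ L, ∀ b ∈ L, a * b ∈ L) {y : G} (hy : y ∈ Y) :
    Y = closure {x | ∃ h ∈ L, ∃ γ : Gam, x = h * y * io γ} := by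
  symm
  set O := {x | ∃ h ∈ L, ∃ γ : Gam, x = h * y * io γ}
  apply hY.2.2.2
  · apply closure_minimal _ hY.1
    rintro _ ⟨h, hh, γ, rfl⟩
    exact hY.2.2.1.2 _ (hY.2.2.1.1 y hy h hh) γ
  · exact isClosed_closure
  · exact ⟨y, subset_closure ⟨1, hL1, 1, by simp⟩⟩
  · constructor
    · intro x hx h hh
      refine map_mem_closure (continuous_const_mul h) hx ?_
      rintro _ ⟨h', hh', γ, rfl⟩
      exact ⟨h * h', hLm h hh h' hh', γ, by simp only [mul_assoc]⟩
    · intro x hx γ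
      refine map_mem_closure (f := fun x => x * io γ) (by fun_prop) hx ?_
      rintro _ ⟨h', hh', γ', rfl⟩
      exact ⟨h', hh', γ' * γ, by simp only [mul_assoc, map_mul]⟩

def V1 : Set G := Set.range v1
def HH : Set G := {h | act J h = J}

lemma V1_one : (1 : G) ∈ V1 := ⟨0, v1_zero⟩
lemma V1_mul : ∀ a ∈ V1, ∀ b ∈ V1, a * b ∈ V1 := by
  rintro _ ⟨s, rfl⟩ _ ⟨t, rfl⟩
  exact ⟨s + t, v1_add s t⟩
lemma HH_one : (1 : G) ∈ HH := act_one J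
lemma HH_mul : ∀ a ∈ HH, ∀ b ∈ HH, a * b ∈ HH := by
  intro a ha b hb
  show act J (a * b) = J
  rw [act_mul, ha, hb]
lemma v1_mem (t : ℝ) : v1 t ∈ V1 := ⟨t, rfl⟩
lemma v1_mem_HH (t : ℝ) : v1 t ∈ HH := act_J_v1 t
lemma dg_mem_HH (a : ℝ) (ha : a ≠ 0) : dg a ha ∈ HH := act_J_dg a ha

lemma HH_min {E : Set G} (hE : IsClosed E) (hne : E.Nonempty) (hinv : Inv HH E) :
    ∃ Y ⊆ E, IsMin HH Y := by
  refine exists_min_set (R := RR 1) hE hne hinv ?_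
  intro Z _ _ ⟨z, hz⟩ hZ
  obtain ⟨a0, ha0, h⟩ := U2 z (zero_lt_one)
  obtain ⟨t, _, h⟩ := h a0 ha0.ne' le_rfl
  refine hZ.meet (y := dg a0 ha0.ne' * v1 t * z) ?_ h
  rw [mul_assoc]
  exact hZ.1 _ (hZ.1 _ hz _ (v1_mem_HH t)) _ (dg_mem_HH _ _)

lemma Prim.mul {m : Fin 3 → ℤ} (h : Prim m) (γ : Gam) : Prim ((γ : Matrix (Fin 3) (Fin 3) ℤ) *ᵥ m) := by
  obtain ⟨k, hk⟩ := h
  refine ⟨k ᵥ* ((γ⁻¹ : Gam) : Matrix (Fin 3) (Fin 3) ℤ), ?_⟩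
  rw [← Matrix.dotProduct_mulVec, Matrix.mulVec_mulVec, ← Matrix.SpecialLinearGroup.coe_mul,
    inv_mul_cancel, Matrix.SpecialLinearGroup.coe_one, Matrix.one_mulVec, hk]

lemma rv_mulVec (γ : Gam) (m : Fin 3 → ℤ) :
    ((io γ : G) : M3) *ᵥ rv m = rv ((γ : Matrix (Fin 3) (Fin 3) ℤ) *ᵥ m) := by
  ext i
  simp [Matrix.mulVec, dotProduct, rv, io_coe]

lemma isClosed_rv_image (S : Set (Fin 3 → ℤ)) : IsClosed (rv '' S) := by
  have h : IsClosedEmbedding rv := IsClosedEmbedding.piMap fun _ => Int.isClosedEmbedding_coe_real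
  exact h.isClosedMap S (isClosed_discrete S)

lemma inv_mulVec (g : G) (x y : Fin 3 → ℝ) : (g : M3) *ᵥ x = y ↔ x = ((g⁻¹ : G) : M3) *ᵥ y := by
  constructor
  · rintro rfl
    rw [Matrix.mulVec_mulVec, ← Matrix.SpecialLinearGroup.coe_mul, inv_mul_cancel,
      Matrix.SpecialLinearGroup.coe_one, Matrix.one_mulVec]
  · rintro rfl
    rw [Matrix.mulVec_mulVec, ← Matrix.SpecialLinearGroup.coe_mul, mul_inv_cancel,
      Matrix.SpecialLinearGroup.coe_one, Matrix.one_mulVec]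

/-- stabilization of invariant vectors -/
lemma stab (ρ : G → G) (hρm : ∀ g h, ρ (g * h) = ρ g * ρ h) (hρc : Continuous ρ) (e : Fin 3 → ℝ) (he : e ≠ 0)
    (hve : ∀ t, ((ρ (v1 t) : G) : M3) *ᵥ e = e) (hΓ : ∀ γ : Gam, ∃ γ' : Gam, ρ (io γ) = io γ')
    {E : Set G} (hE : IsClosed E) (hne : E.Nonempty) (hinv : Inv V1 E) :
    ∃ E1 ⊆ E, IsClosed E1 ∧ E1.Nonempty ∧ Inv V1 E1 ∧ ∃ η, 0 < η ∧ η ≤ 1 ∧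
      ∀ z ∈ E1, ∀ m : Fin 3 → ℤ, m ≠ 0 → ∀ c : ℝ, ((ρ z : G) : M3) *ᵥ rv m = c • e → η ≤ |c| := by
  by_cases hno : ∃ z ∈ E, ∃ m : Fin 3 → ℤ, m ≠ 0 ∧ ∃ c : ℝ, ((ρ z : G) : M3) *ᵥ rv m = c • e
  swap
  · push Not at hno
    exact ⟨E, subset_rfl, hE, hne, hinv, 1, one_pos, le_rfl, fun z hz m hm c h => absurd h (hno z hz m hm c)⟩
  obtain ⟨z0, hz0, m0, hm0, c0, hc0⟩ := hno
  obtain ⟨d, m1, hd, hm1, rfl⟩ := exists_prim hm0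
  have hdr : (d : ℝ) ≠ 0 := by exact_mod_cast hd
  set c := c0 / d with hc
  have hz1 : ((ρ z0 : G) : M3) *ᵥ rv m1 = c • e := by
    rw [rv_smul, Matrix.mulVec_smul] at hc0
    rw [hc, div_eq_inv_mul, mul_smul, ← hc0, smul_smul, inv_mul_cancel₀ hdr, one_smul]
  have cne : c ≠ 0 := by
    intro h0
    rw [h0, zero_smul, inv_mulVec, Matrix.mulVec_zero] at hz1
    exact rv_ne hm1.ne_zero hz1
  refine ⟨E ∩ {z | ((((ρ z)⁻¹ : G)) : M3) *ᵥ (c • e) ∈ rv '' {m | Prim m}}, Set.inter_subset_left,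
    hE.inter ((isClosed_rv_image _).preimage ?_), ⟨z0, hz0, m1, hm1, (inv_mulVec _ _ _).mp hz1⟩,
    ⟨?_, ?_⟩, min 1 |c|, lt_min one_pos (abs_pos.mpr cne), min_le_left _ _, ?_⟩
  · have : Continuous fun z => (((ρ z)⁻¹ : G) : M3) := continuous_coe.comp hρc.inv
    fun_prop
  · rintro z ⟨hz, m, hm, h⟩ _ ⟨t, rfl⟩
    refine ⟨hinv.1 z hz _ (v1_mem t), m, hm, ?_⟩
    rw [← inv_mulVec] at h ⊢
    rw [hρm, Matrix.SpecialLinearGroup.coe_mul, ← Matrix.mulVec_mulVec, h, Matrix.mulVec_smul, hve]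
  · rintro z ⟨hz, m, hm, h⟩ γ
    obtain ⟨γ', hγ'⟩ := hΓ γ
    refine ⟨hinv.2 z hz γ, ((γ'⁻¹ : Gam) : Matrix (Fin 3) (Fin 3) ℤ) *ᵥ m, hm.mul _, ?_⟩
    rw [← inv_mulVec] at h ⊢
    rw [hρm, hγ', ← rv_mulVec, Matrix.mulVec_mulVec, ← Matrix.SpecialLinearGroup.coe_mul, map_inv,
      mul_inv_cancel_right, h]
  · rintro z ⟨hz, m, hm, h⟩ m' hm' c' h'
    rw [← inv_mulVec] at h
    have e1 : rv m' = (c' / c) • rv m := by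
      rw [inv_mulVec] at h h'
      rw [h, h', Matrix.mulVec_smul, Matrix.mulVec_smul, smul_smul, div_mul_cancel₀ _ cne]
    have e2 : m ⨯₃ m' = 0 := by
      apply rv_inj
      rw [rv_cross, e1, map_smul, cross_self, smul_zero]
      ext i; simp [rv]
    obtain ⟨k, hk⟩ := hm
    have e3 := Prim.par hk e2
    have hk0 : k ⬝ᵥ m' ≠ 0 := by intro h0; rw [h0, zero_smul] at e3; exact hm' e3
    rw [e3, rv_smul, Matrix.mulVec_smul, h, smul_smul] at h'
    have e4 : ((k ⬝ᵥ m' : ℤ) : ℝ) * c = c' := smul_left_injective ℝ he h'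
    refine (min_le_right _ _).trans ?_
    rw [← e4, abs_mul]
    have : (1 : ℝ) ≤ |((k ⬝ᵥ m' : ℤ) : ℝ)| := by exact_mod_cast Int.one_le_abs hk0
    nlinarith [abs_nonneg c]

def CompactMod (Y : Set G) : Prop := ∃ R, ∀ y ∈ Y, y ∈ BM R

lemma BM_mono {R R' : ℝ} (h : R ≤ R') : BM R ⊆ BM R' := fun g ⟨γ, hγ⟩ => ⟨γ, Bd_mono h hγ⟩

lemma BM_right {R : ℝ} {g : G} (γ : Gam) (h : g * io γ ∈ BM R) : g ∈ BM R := by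
  obtain ⟨γ', h⟩ := h
  exact ⟨γ * γ', by rwa [map_mul, ← mul_assoc]⟩

lemma co_io (γ : Gam) : co (io γ) = io ((γ⁻¹).transpose) := by
  apply Gext
  ext i j
  rw [co_coe, io_coe, ← map_inv, Matrix.transpose_apply, io_coe]
  rfl

theorem U4 {E : Set G} (hE : IsClosed E) (hne : E.Nonempty) (hinv : Inv V1 E) :
    ∃ Y ⊆ E, IsMin V1 Y ∧ CompactMod Y := by
  obtain ⟨E1, hE1, c1, n1, i1, η1, p1, q1, r1⟩ := stab (fun g => g) (fun _ _ => rfl) continuous_id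
    ![1,0,0] (by intro h; simpa using congrFun h 0)
    (by intro t; rw [v1_mulVec]; ext i; fin_cases i <;> simp) (fun γ => ⟨γ, rfl⟩) hE hne hinv
  obtain ⟨E2, hE2, c2, n2, i2, η2, p2, q2, r2⟩ := stab co co_mul continuous_co
    ![0,0,1] (by intro h; simpa using congrFun h 2)
    (by intro t; rw [co_v1_mulVec]; ext i; fin_cases i <;> simp) (fun γ => ⟨_, co_io γ⟩) c1 n1 i1
  set η := min η1 η2 with hη
  have η0 : 0 < η := lt_min p1 p2
  have ηl : η ≤ 1 := (min_le_left _ _).trans q1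
  have ok : ∀ z ∈ E2, InvOK η z := by
    intro z hz
    constructor
    · intro m hm h1 h2
      set x := (z : M3) *ᵥ rv m with hx
      refine (min_le_left _ _).trans ((r1 z (hE2 hz) m hm (x 0) ?_).trans (norm_le_pi_norm x 0))
      rw [← hx]
      ext i; fin_cases i <;> simp [h1, h2]
    · intro m hm h1 h2
      set x := ((co z : G) : M3) *ᵥ rv m with hx
      refine (min_le_right _ _).trans ((r2 z hz m hm (x 2) ?_).trans (norm_le_pi_norm x 2))
      rw [← hx]
      ext i; fin_cases i <;> simp [h1, h2]
  obtain ⟨Y, hYE, hY⟩ := exists_min_set (R := RR η) c2 n2 i2 (by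
    intro Z hZ _ ⟨z, hz⟩ hZi
    obtain ⟨t, _, ht⟩ := (N2 η0 ηl (ok z (hZ hz)) 0).1
    exact hZi.meet (hZi.1 z hz _ (v1_mem t)) ht)
  refine ⟨Y, hYE.trans (hE2.trans hE1), hY, ?_⟩
  set R0 := RR η
  have R0pos : 0 ≤ R0 := by unfold R0 RR; positivity
  -- return times
  have ret : ∀ y ∈ Y ∩ Bd (R0 + 1), ∃ t ≥ (1:ℝ), ∃ U ∈ 𝓝 y, ∀ z ∈ U, v1 t * z ∈ BM (R0 + 1) := by
    rintro y ⟨hy, hyb⟩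
    obtain ⟨t, ht, γ, hγ⟩ := (N2 η0 ηl (ok y (hYE hy)) 1).1
    have ho : IsOpen {g : G | ∀ i j, |(g : M3) i j| < R0 + 1} := by
      simp only [Set.setOf_forall]
      refine isOpen_iInter_of_finite fun i => isOpen_iInter_of_finite fun j => ?_
      exact isOpen_lt (continuous_entry i j).abs continuous_const
    have hc : Continuous fun z : G => v1 t * z * io γ := by fun_prop
    refine ⟨t, ht, _, (ho.preimage hc).mem_nhds (fun i j => lt_of_le_of_lt (hγ i j) (by linarith)), ?_⟩
    intro z hz
    exact ⟨γ, fun i j => (hz i j).le⟩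
  choose! τ hτ U hU hUτ using ret
  obtain ⟨s, hs, hcov⟩ := ((isCompact_Bd (R0+1)).inter_left hY.1).elim_nhds_subcover U hU
  obtain ⟨T, hT⟩ : ∃ T, ∀ y ∈ s, τ y ≤ T := by
    obtain ⟨T, hT⟩ := (s.image τ).bddAbove
    exact ⟨T, fun y hy => hT (Finset.mem_coe.mpr (Finset.mem_image_of_mem τ hy))⟩
  have ret2 : ∀ y ∈ Y, y ∈ BM (R0 + 1) → ∃ t, 1 ≤ t ∧ t ≤ T ∧ v1 t * y ∈ BM (R0 + 1) := by
    rintro y hy ⟨γ, hγ⟩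
    obtain ⟨x, hx, hxU⟩ := Set.mem_iUnion₂.mp (hcov ⟨hY.2.2.1.2 y hy γ, hγ⟩)
    refine ⟨τ x, hτ x (hs x hx), hT x hx, BM_right γ ?_⟩
    rw [mul_assoc]
    exact hUτ x (hs x hx) _ hxU
  obtain ⟨R1, hR1⟩ : ∃ R1, ∀ t, 0 ≤ t → t ≤ T → ∀ y ∈ BM (R0 + 1), v1 t * y ∈ BM R1 := by
    refine ⟨3 * ((1 + T + T^2/2) * (R0 + 1)), ?_⟩
    rintro t h0 h1 y ⟨γ, hγ⟩
    refine ⟨γ, fun i j => ?_⟩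
    rw [mul_assoc, Matrix.SpecialLinearGroup.coe_mul]
    have hT0 : 0 ≤ T := h0.trans h1
    refine entry_mul_le (by positivity) ?_ hγ i j
    intro i j
    have : t^2 ≤ T^2 := by gcongr
    have : 0 ≤ T^2 := sq_nonneg T
    fin_cases i <;> fin_cases j <;> simp [v1_coe] <;> (try rw [abs_of_nonneg h0]) <;> (try rw [abs_of_nonneg (by positivity : 0 ≤ t^2/2)]) <;> linarith
  have ind : ∀ n : ℕ, ∀ y ∈ Y, y ∈ BM (R0 + 1) → ∀ s : ℝ, 0 ≤ s → s ≤ n → v1 s * y ∈ BM R1 := by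
    intro n
    induction n with
    | zero =>
      intro y hy hb s h0 h1
      obtain ⟨t, a1, a2, a3⟩ := ret2 y hy hb
      exact hR1 s h0 (by push_cast at h1; linarith) y hb
    | succ n ih =>
      intro y hy hb s h0 h1
      obtain ⟨t, a1, a2, a3⟩ := ret2 y hy hb
      by_cases hst : s ≤ t
      · exact hR1 s h0 (by linarith) y hb
      · have := ih (v1 t * y) (hY.2.2.1.1 y hy _ (v1_mem t)) a3 (s - t) (by linarith) (by push_cast at h1; linarith)
        rwa [← mul_assoc, ← v1_add, sub_add_cancel] at this
  refine ⟨R1, fun y hy => ?_⟩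
  obtain ⟨t, ht, hb⟩ := (N2 η0 ηl (ok y (hYE hy)) 0).2
  have := ind ⌈t⌉₊ _ (hY.2.2.1.1 y hy _ (v1_mem (-t))) (BM_mono (by linarith) hb) t ht (Nat.le_ceil t)
  rwa [← mul_assoc, ← v1_add, add_neg_cancel, v1_zero, one_mul] at this

end Opp


namespace Opp
open Matrix Filter Topology
set_option linter.all false

def sym (a b d c e g : ℝ) : M3 := !![a,b,d;b,c,e;d,e,g]

lemma sym_eq {F : M3} (h : Fᵀ = F) : F = sym (F 0 0) (F 0 1) (F 0 2) (F 1 1) (F 1 2) (F 2 2) := by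
  have h1 : F 1 0 = F 0 1 := congrFun (congrFun h.symm 1) 0
  have h2 : F 2 0 = F 0 2 := congrFun (congrFun h.symm 2) 0
  have h3 : F 2 1 = F 1 2 := congrFun (congrFun h.symm 2) 1
  ext i j; fin_cases i <;> fin_cases j <;> simp [sym, h1, h2, h3]

lemma act_sym_v1 (a b d c e g t : ℝ) : act (sym a b d c e g) (v1 t) =
    sym a (a*t+b) (a*t^2/2+b*t+d) (a*t^2+2*b*t+c) (a*t^3/2+3*b*t^2/2+(c+d)*t+e)
      (a*t^4/4+b*t^3+(c+d)*t^2+2*e*t+g) := by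
  unfold act sym
  rw [v1_coe]
  ext i j; fin_cases i <;> fin_cases j <;>
    simp [Matrix.mul_apply, Fin.sum_univ_three] <;> ring

lemma act_sym_dg (a b d c e g s : ℝ) (hs : s ≠ 0) : act (sym a b d c e g) (dg s hs) =
    sym (s^2*a) (s*b) d c (e/s) (g/s^2) := by
  unfold act sym
  rw [dg_coe]
  ext i j; fin_cases i <;> fin_cases j <;>
    simp [Matrix.mul_apply, Fin.sum_univ_three] <;> field_simp

lemma tendsto_sym {ι : Type*} {l : Filter ι} {a b d c e g : ι → ℝ} {a' b' d' c' e' g' : ℝ}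
    (ha : Tendsto a l (𝓝 a')) (hb : Tendsto b l (𝓝 b')) (hd : Tendsto d l (𝓝 d'))
    (hc : Tendsto c l (𝓝 c')) (he : Tendsto e l (𝓝 e')) (hg : Tendsto g l (𝓝 g')) :
    Tendsto (fun i => sym (a i) (b i) (d i) (c i) (e i) (g i)) l (𝓝 (sym a' b' d' c' e' g')) := by
  refine tendsto_pi_nhds.2 fun i => tendsto_pi_nhds.2 fun j => ?_
  fin_cases i <;> fin_cases j <;> simpa [sym]

lemma tendsto_ent {ι : Type*} {l : Filter ι} {F : ι → M3} {F' : M3} (h : Tendsto F l (𝓝 F')) (i j : Fin 3) :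
    Tendsto (fun k => F k i j) l (𝓝 (F' i j)) :=
  ((continuous_id.matrix_elem i j).tendsto F').comp h

lemma J_sym (s : ℝ) : J + s • E33 = sym 0 0 1 (-1) 0 s := by
  ext i j; fin_cases i <;> fin_cases j <;> simp [sym, J, E33]

lemma sym_det (a b d c e g : ℝ) : (sym a b d c e g).det = a*c*g + 2*b*e*d - a*e^2 - b^2*g - d^2*c := by
  simp [sym, Matrix.det_fin_three]; ring

lemma ulim {ι X : Type*} [TopologicalSpace X] (U : Ultrafilter ι) {f : ι → X} {K : Set X} (hK : IsCompact K)
    (h : ∀ᶠ i in U, f i ∈ K) : ∃ x ∈ K, Tendsto f U (𝓝 x) := by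
  obtain ⟨x, hx, h⟩ := hK.ultrafilter_le_nhds (U.map f) (le_principal_iff.mpr h)
  exact ⟨x, hx, h⟩

lemma ulim_abs {ι : Type*} (U : Ultrafilter ι) {f : ι → ℝ} (h : ∀ᶠ i in U, |f i| ≤ 1) :
    ∃ x, Tendsto f U (𝓝 x) := by
  obtain ⟨x, _, h⟩ := ulim U (isCompact_Icc (a := (-1:ℝ)) (b := 1)) (h.mono fun i hi => abs_le.mp hi)
  exact ⟨x, h⟩

/-- the lift of a set of forms -/
def XX (O : Set M3) : Set G := {y | act J y ∈ O}

def OK (O : Set M3) : Prop := IsClosed O ∧ ∀ F ∈ O, ∀ γ : Gam, act F (io γ) ∈ O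

lemma continuous_actJ (F : M3) : Continuous (fun g : G => act F g) :=
  continuous_act.comp (by fun_prop : Continuous fun g : G => (F, g))

lemma OK.closed {O : Set M3} (h : OK O) : IsClosed (XX O) := h.1.preimage (continuous_actJ J)

lemma OK.inv {O : Set M3} (h : OK O) : Inv HH (XX O) := by
  constructor
  · intro y hy g hg
    show act J (g * y) ∈ O
    rw [act_mul, hg]; exact hy
  · intro y hy γ
    show act J (y * io γ) ∈ O
    rw [act_mul]; exact h.2 _ hy γ

def Win (O : Set M3) : Prop := ∃ w : G, ∃ ε : ℝ, (ε = 1 ∨ ε = -1) ∧ ∀ s : ℝ, 0 ≤ s → v2 (ε * s) * w ∈ XX O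

lemma all_of_one {O : Set M3} (hO : OK O) {Y : Set G} (hY : IsMin V1 Y) {s : ℝ}
    (h : ∃ y ∈ Y, v2 s * y ∈ XX O) : ∀ y ∈ Y, v2 s * y ∈ XX O := by
  have hcl : IsClosed ((fun y : G => v2 s * y) ⁻¹' XX O) := hO.closed.preimage (by fun_prop)
  have hi1 : ∀ y : G, v2 s * y ∈ XX O → ∀ t, v2 s * (v1 t * y) ∈ XX O := by
    intro y h2 t
    have := hO.inv.1 _ h2 _ (v1_mem_HH t)
    rwa [← mul_assoc, v1_v2, mul_assoc] at this
  have hi2 : ∀ y : G, v2 s * y ∈ XX O → ∀ γ, v2 s * (y * io γ) ∈ XX O := by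
    intro y h2 γ
    have := hO.inv.2 _ h2 γ
    rwa [mul_assoc] at this
  have := hY.2.2.2 (Y ∩ ((fun y : G => v2 s * y) ⁻¹' XX O)) Set.inter_subset_left
    (hY.1.inter hcl) (by obtain ⟨y, h1, h2⟩ := h; exact ⟨y, Set.mem_inter h1 (Set.mem_preimage.mpr h2)⟩)
    ⟨?_, ?_⟩
  · intro y hy
    rw [← this] at hy
    exact Set.mem_preimage.mp hy.2
  · rintro y ⟨h1, h2⟩ _ ⟨t, rfl⟩
    exact Set.mem_inter (hY.2.2.1.1 y h1 _ (v1_mem t)) (Set.mem_preimage.mpr (hi1 y (Set.mem_preimage.mp h2) t))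
  · rintro y ⟨h1, h2⟩ γ
    exact Set.mem_inter (hY.2.2.1.2 y h1 _) (Set.mem_preimage.mpr (hi2 y (Set.mem_preimage.mp h2) γ))

lemma poly_range (α β κ η : ℝ) (h : ¬(α = 0 ∧ β = 0 ∧ κ = 0 ∧ η = 0)) :
    ∃ ε : ℝ, (ε = 1 ∨ ε = -1) ∧ ∀ s : ℝ, 0 ≤ s → ∃ τ : ℝ, α*τ^4+β*τ^3+κ*τ^2+η*τ = ε * s := by
  open Polynomial in
  have key : ∀ P : ℝ[X], P.eval 0 = 0 → 0 < P.degree → 0 ≤ P.leadingCoeff → ∀ s : ℝ, 0 ≤ s →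
      ∃ τ, P.eval τ = s := by
    intro P h0 hd hl s hs
    have ht := P.tendsto_atTop_of_leadingCoeff_nonneg hd hl
    obtain ⟨M, hM1, hM2⟩ := ((ht.eventually_ge_atTop s).and (eventually_ge_atTop 0)).exists
    obtain ⟨τ, _, h⟩ := intermediate_value_Icc hM2 P.continuous.continuousOn ⟨h0.le.trans hs, hM1⟩
    exact ⟨τ, h⟩
  open Polynomial in
  set P : ℝ[X] := C α * X^4 + C β * X^3 + C κ * X^2 + C η * X with hP
  have ev : ∀ τ, P.eval τ = α*τ^4+β*τ^3+κ*τ^2+η*τ := by intro τ; simp [hP]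
  have hd : 0 < P.degree := by
    by_contra hd
    have h1 := Polynomial.eq_C_of_degree_le_zero (not_lt.mp hd)
    apply h
    have c : ∀ k, k ≠ 0 → P.coeff k = 0 := by
      intro k hk; rw [h1, Polynomial.coeff_C, if_neg hk]
    have c4 := c 4 (by norm_num)
    have c3 := c 3 (by norm_num)
    have c2 := c 2 (by norm_num)
    have c1 := c 1 (by norm_num)
    simp [hP, Polynomial.coeff_X, Polynomial.coeff_C, Polynomial.coeff_X_pow] at c1 c2 c3 c4
    exact ⟨c4, c3, c2, c1⟩
  rcases le_total 0 P.leadingCoeff with hl | hl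
  · refine ⟨1, Or.inl rfl, fun s hs => ?_⟩
    obtain ⟨τ, hτ⟩ := key P (by rw [ev]; ring) hd hl s hs
    exact ⟨τ, by rw [← ev, hτ, one_mul]⟩
  · refine ⟨-1, Or.inr rfl, fun s hs => ?_⟩
    obtain ⟨τ, hτ⟩ := key (-P) (by rw [Polynomial.eval_neg, ev]; ring) (by rwa [Polynomial.degree_neg]) (by rw [Polynomial.leadingCoeff_neg]; linarith) s hs
    exact ⟨τ, by rw [← ev]; rw [Polynomial.eval_neg] at hτ; linarith⟩

lemma exists_T (a b k e : ℝ) (h : 0 < |a| + |b| + |k| + |e|) :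
    ∃ T : ℝ, 0 < T ∧ |a| * T^4 + |b| * T^3 + |k| * T^2 + |e| * T = 1 := by
  set S := |a| + |b| + |k| + |e| with hS
  set M := 1 + 1 / S with hM
  have hS' : 0 < 1 / S := by positivity
  have hM1 : 1 ≤ M := by linarith
  have hSM : 1 ≤ S * M := by rw [hM, mul_add, mul_one_div_cancel h.ne']; linarith
  obtain ⟨T, hT, h1⟩ := intermediate_value_Icc (f := fun T : ℝ => |a| * T^4 + |b| * T^3 + |k| * T^2 + |e| * T)
    (by linarith : (0:ℝ) ≤ M) (by fun_prop) (show (1:ℝ) ∈ Set.Icc _ _ from ⟨by simp, by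
      have p2 : M ≤ M^2 := by nlinarith
      have p3 : M ≤ M^3 := by nlinarith
      have p4 : M ≤ M^4 := by nlinarith
      have := mul_le_mul_of_nonneg_left p4 (abs_nonneg a)
      have := mul_le_mul_of_nonneg_left p3 (abs_nonneg b)
      have := mul_le_mul_of_nonneg_left p2 (abs_nonneg k)
      show 1 ≤ |a| * M^4 + |b| * M^3 + |k| * M^2 + |e| * M
      have : S * M = |a| * M + |b| * M + |k| * M + |e| * M := by rw [hS]; ring
      linarith⟩)
  refine ⟨T, ?_, h1⟩
  rcases hT.1.lt_or_eq with h | h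
  · exact h
  · rw [← h] at h1; norm_num at h1

lemma abs_le_of_sum {a b c d r : ℝ} (h : |a| + |b| + |c| + |d| = r) : |a| ≤ r ∧ |b| ≤ r ∧ |c| ≤ r ∧ |d| ≤ r := by
  have := abs_nonneg a; have := abs_nonneg b; have := abs_nonneg c; have := abs_nonneg d
  refine ⟨?_, ?_, ?_, ?_⟩ <;> linarith

theorem BU0 {ι : Type*} (U : Ultrafilter ι) {O : Set M3} (hO : OK O) {Y : Set G} (hY : IsMin V1 Y)
    (hc : CompactMod Y) {y : G} (hy : y ∈ Y) (x : ι → G) (hx : ∀ᶠ i in U, x i ∈ XX O)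
    (hlim : Tendsto (fun i => act J (x i)) U (𝓝 (act J y)))
    (hnot : ∀ᶠ i in U, ¬ ∃ c σ : ℝ, act J (x i) = c • act J y + σ • act E33 y) : Win O := by
  set Φ : ι → M3 := fun i => act (act J (x i)) y⁻¹ with hΦ
  have hΦJ : Tendsto Φ U (𝓝 J) := by
    have : Tendsto Φ U (𝓝 (act (act J y) y⁻¹)) :=
      (continuous_act.comp (by fun_prop : Continuous fun F : M3 => (F, y⁻¹))).continuousAt.tendsto.comp hlim
    rwa [← act_mul, mul_inv_cancel, act_one] at this
  have hΦx : ∀ i, act (Φ i) y = act J (x i) := by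
    intro i; rw [hΦ]; simp only; rw [← act_mul, inv_mul_cancel, act_one]
  have hs : ∀ i, Φ i = sym (Φ i 0 0) (Φ i 0 1) (Φ i 0 2) (Φ i 1 1) (Φ i 1 2) (Φ i 2 2) :=
    fun i => sym_eq (act_symm (act_symm J_symm _) _)
  have ha : Tendsto (fun i => Φ i 0 0) U (𝓝 0) := by simpa [J] using tendsto_ent hΦJ 0 0
  have hb : Tendsto (fun i => Φ i 0 1) U (𝓝 0) := by simpa [J] using tendsto_ent hΦJ 0 1
  have hd : Tendsto (fun i => Φ i 0 2) U (𝓝 1) := by simpa [J] using tendsto_ent hΦJ 0 2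
  have hcc : Tendsto (fun i => Φ i 1 1) U (𝓝 (-1)) := by simpa [J] using tendsto_ent hΦJ 1 1
  have he : Tendsto (fun i => Φ i 1 2) U (𝓝 0) := by simpa [J] using tendsto_ent hΦJ 1 2
  have hg : Tendsto (fun i => Φ i 2 2) U (𝓝 0) := by simpa [J] using tendsto_ent hΦJ 2 2
  have hk : Tendsto (fun i => Φ i 1 1 + Φ i 0 2) U (𝓝 0) := by simpa using hcc.add hd
  generalize hA : (fun i => Φ i 0 0) = a at *
  generalize hB : (fun i => Φ i 0 1) = b at *
  generalize hD : (fun i => Φ i 0 2) = d at *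
  generalize hC : (fun i => Φ i 1 1) = c at *
  generalize hE : (fun i => Φ i 1 2) = e at *
  generalize hG : (fun i => Φ i 2 2) = g at *
  have hs' : ∀ i, Φ i = sym (a i) (b i) (d i) (c i) (e i) (g i) := by
    intro i; rw [hs i, ← hA, ← hB, ← hD, ← hC, ← hE, ← hG]
  have hk' : Tendsto (fun i => c i + d i) U (𝓝 0) := by
    rw [← hC, ← hD]; exact hk
  have hpos : ∀ᶠ i in U, 0 < |a i| + |b i| + |c i + d i| + |e i| := by
    filter_upwards [hnot] with i hi
    by_contra hcon
    apply hi
    have h0 := abs_nonneg (a i); have h1 := abs_nonneg (b i)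
    have h2 := abs_nonneg (c i + d i); have h3 := abs_nonneg (e i)
    have ea : a i = 0 := abs_eq_zero.mp (by linarith)
    have eb : b i = 0 := abs_eq_zero.mp (by linarith)
    have ek : c i + d i = 0 := abs_eq_zero.mp (by linarith)
    have ee : e i = 0 := abs_eq_zero.mp (by linarith)
    have ec : c i = - d i := by linarith
    refine ⟨d i, g i, ?_⟩
    rw [← hΦx, hs', ea, eb, ee, ec, ← act_smul, ← act_smul, ← act_add]
    congr 1
    ext i j; fin_cases i <;> fin_cases j <;> simp [sym, J, E33]
  have hTe : ∀ i, ∃ T : ℝ, 0 < |a i| + |b i| + |c i + d i| + |e i| → 0 < T ∧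
      |a i| * T^4 + |b i| * T^3 + |c i + d i| * T^2 + |e i| * T = 1 := by
    intro i
    by_cases h : 0 < |a i| + |b i| + |c i + d i| + |e i|
    · obtain ⟨T, hT⟩ := exists_T _ _ _ _ h
      exact ⟨T, fun _ => hT⟩
    · exact ⟨0, fun h' => absurd h' h⟩
  choose T hT using hTe
  have hT' : ∀ᶠ i in U, 0 < T i ∧ |a i| * T i^4 + |b i| * T i^3 + |c i + d i| * T i^2 + |e i| * T i = 1 :=
    hpos.mono hT
  have hTtop : Tendsto T U atTop := by
    rw [tendsto_atTop]
    intro B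
    have hsum : Tendsto (fun i => (|a i| + |b i| + |c i + d i| + |e i|) * (1+|B|)^4) U (𝓝 0) := by
      simpa using (((ha.abs.add hb.abs).add hk'.abs).add he.abs).mul_const ((1+|B|)^4)
    filter_upwards [hT', hsum.eventually (gt_mem_nhds (zero_lt_one))] with i ⟨h1, h2⟩ h3
    by_contra h4
    push Not at h4
    set M := 1 + |B|
    have hM : T i ≤ M := by have := le_abs_self B; simp only [M]; linarith
    have hM1 : 1 ≤ M := by have := abs_nonneg B; simp only [M]; linarith
    have q4 : T i^4 ≤ M^4 := by gcongr
    have q3 : T i^3 ≤ M^4 := (show T i^3 ≤ M^3 by gcongr).trans (pow_le_pow_right₀ hM1 (by norm_num))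
    have q2 : T i^2 ≤ M^4 := (show T i^2 ≤ M^2 by gcongr).trans (pow_le_pow_right₀ hM1 (by norm_num))
    have q1 : T i ≤ M^4 := hM.trans (le_self_pow₀ hM1 (by norm_num))
    have := mul_le_mul_of_nonneg_left q4 (abs_nonneg (a i))
    have := mul_le_mul_of_nonneg_left q3 (abs_nonneg (b i))
    have := mul_le_mul_of_nonneg_left q2 (abs_nonneg (c i + d i))
    have := mul_le_mul_of_nonneg_left q1 (abs_nonneg (e i))
    linarith
  have hr : Tendsto (fun i => (T i)⁻¹) U (𝓝 0) := tendsto_inv_atTop_zero.comp hTtop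
  have hsum1 : ∀ᶠ i in U, |a i * T i^4| + |b i * T i^3| + |(c i + d i) * T i^2| + |e i * T i| = 1 := by
    filter_upwards [hT'] with i ⟨h1, h2⟩
    rw [abs_mul, abs_mul, abs_mul, abs_mul, abs_of_pos h1, abs_of_pos (pow_pos h1 4), abs_of_pos (pow_pos h1 3),
      abs_of_pos (pow_pos h1 2), h2]
  obtain ⟨α, hα⟩ := ulim_abs U (hsum1.mono fun i hi => (abs_le_of_sum hi).1)
  obtain ⟨β, hβ⟩ := ulim_abs U (hsum1.mono fun i hi => (abs_le_of_sum hi).2.1)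
  obtain ⟨κ, hκ⟩ := ulim_abs U (hsum1.mono fun i hi => (abs_le_of_sum hi).2.2.1)
  obtain ⟨η, hη⟩ := ulim_abs U (hsum1.mono fun i hi => (abs_le_of_sum hi).2.2.2)
  have hnz : |α| + |β| + |κ| + |η| = 1 :=
    tendsto_nhds_unique ((((hα.abs.add hβ.abs).add hκ.abs).add hη.abs).congr' hsum1) tendsto_const_nhds
  -- the limit
  have hlimτ : ∀ τ : ℝ, Tendsto (fun i => act (Φ i) (v1 (T i * τ))) U
      (𝓝 (J + (α*τ^4/4+β*τ^3+κ*τ^2+2*η*τ) • E33)) := by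
    intro τ
    rw [J_sym]
    have e1 : ∀ᶠ i in U, sym (a i) ((a i * T i^4)*(T i)⁻¹^3*τ+b i) ((a i * T i^4)*(T i)⁻¹^2*τ^2/2+(b i*T i^3)*(T i)⁻¹^2*τ+d i)
        ((a i * T i^4)*(T i)⁻¹^2*τ^2+2*(b i*T i^3)*(T i)⁻¹^2*τ+c i)
        ((a i * T i^4)*(T i)⁻¹*τ^3/2+3*(b i*T i^3)*(T i)⁻¹*τ^2/2+((c i + d i)*T i^2)*(T i)⁻¹*τ+e i)
        ((a i * T i^4)*τ^4/4+(b i*T i^3)*τ^3+((c i+d i)*T i^2)*τ^2+2*(e i*T i)*τ+g i) = act (Φ i) (v1 (T i * τ)) := by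
      filter_upwards [hT'] with i ⟨h1, h2⟩
      rw [hs', act_sym_v1]
      congr 1 <;> field_simp
    refine Tendsto.congr' e1 (tendsto_sym ha ?_ ?_ ?_ ?_ ?_)
    · simpa using ((hα.mul (hr.pow 3)).mul_const τ).add hb
    · simpa using ((((hα.mul (hr.pow 2)).mul_const (τ^2)).div_const 2).add ((hβ.mul (hr.pow 2)).mul_const τ)).add hd
    · simpa using (((hα.mul (hr.pow 2)).mul_const (τ^2)).add (((hβ.const_mul 2).mul (hr.pow 2)).mul_const τ)).add hcc
    · simpa using (((((hα.mul hr).mul_const (τ^3)).div_const 2).add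
        ((((hβ.const_mul 3).mul hr).mul_const (τ^2)).div_const 2)).add ((hκ.mul hr).mul_const τ)).add he
    · simpa using (((((hα.mul_const (τ^4)).div_const 4).add (hβ.mul_const (τ^3))).add (hκ.mul_const (τ^2))).add
        ((hη.const_mul 2).mul_const τ)).add hg
  obtain ⟨R, hR⟩ := hc
  have hall : ∀ τ : ℝ, v2 ((α*τ^4/4+β*τ^3+κ*τ^2+2*η*τ)/2) * y ∈ XX O := by
    intro τ
    refine all_of_one hO hY ?_ y hy
    have hmem : ∀ i, v1 (-(T i * τ)) * y ∈ Y := fun i => hY.2.2.1.1 y hy _ (v1_mem _)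
    choose γ hγ using fun i => hR _ (hmem i)
    obtain ⟨z, hz, hzl⟩ := ulim U (isCompact_Bd R) (Eventually.of_forall hγ)
    have hzY : z ∈ Y := hY.1.mem_of_tendsto hzl (Eventually.of_forall fun i => hY.2.2.1.2 _ (hmem i) (γ i))
    refine ⟨z, hzY, ?_⟩
    show act J _ ∈ O
    rw [act_mul, act_J_v2, mul_div_cancel₀ _ (two_ne_zero)]
    have hl2 := (continuous_act.tendsto _).comp ((hlimτ τ).prodMk_nhds hzl)
    refine hO.1.mem_of_tendsto hl2 (hx.mono fun i hi => ?_)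
    have : act (act (Φ i) (v1 (T i * τ))) (v1 (-(T i * τ)) * y * io (γ i)) = act (act J (x i)) (io (γ i)) := by
      rw [← hΦx, ← act_mul (Φ i), ← act_mul (Φ i), v1_neg, mul_assoc, mul_inv_cancel_left]
    show act (act (Φ i) (v1 (T i * τ))) (v1 (-(T i * τ)) * y * io (γ i)) ∈ O
    rw [this]
    exact hO.2 _ hi _
  obtain ⟨ε, hε, h⟩ := poly_range (α/8) (β/2) (κ/2) η (by
    rintro ⟨h1, h2, h3, h4⟩
    have h1 : α = 0 := by linarith
    have h2 : β = 0 := by linarith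
    have h3 : κ = 0 := by linarith
    rw [h1, h2, h3, h4] at hnz
    norm_num at hnz)
  refine ⟨y, ε, hε, fun s hs => ?_⟩
  obtain ⟨τ, hτ⟩ := h s hs
  have := hall τ
  rw [← hτ]
  convert this using 3
  ring

lemma act_JE_coef {c σ : ℝ} {x y : G} (h : act J x = c • act J y + σ • act E33 y) : c = 1 := by
  have h1 : act J x = act (sym 0 0 c (-c) 0 σ) y := by
    rw [h, ← act_smul, ← act_smul, ← act_add]
    congr 1
    ext i j; fin_cases i <;> fin_cases j <;> simp [sym, J, E33]
  have h2 := congrArg Matrix.det h1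
  rw [act_det, act_det, J_det, sym_det] at h2
  have h3 : (c - 1) * (c^2 + c + 1) = 0 := by linarith
  rcases mul_eq_zero.mp h3 with h | h
  · linarith
  · nlinarith [sq_nonneg (c+1), sq_nonneg c]

/-- local structure when there is no win -/
theorem BB {O : Set M3} (hO : OK O) (hW : ¬ Win O) {Y : Set G} (hY : IsMin V1 Y) (hc : CompactMod Y)
    {y : G} (hy : y ∈ Y) :
    ∀ᶠ F in 𝓝 (act J y), ∀ x ∈ XX O, act J x = F → ∃ σ : ℝ, F = act J y + σ • act E33 y := by
  by_contra hcon
  have hf : ∃ᶠ F in 𝓝 (act J y), ∃ x ∈ XX O, act J x = F ∧ ¬ ∃ σ : ℝ, F = act J y + σ • act E33 y := by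
    intro h; apply hcon
    filter_upwards [h] with F hF x hx hxF
    by_contra h'
    exact hF ⟨x, hx, hxF, h'⟩
  have hne := frequently_iff_neBot.mp hf
  let U := @Ultrafilter.of _ _ hne
  have hU : (U : Filter M3) ≤ _ := @Ultrafilter.of_le _ _ hne
  have hU1 : (U : Filter M3) ≤ 𝓝 (act J y) := hU.trans inf_le_left
  have hU2 : ∀ᶠ F in U, ∃ x ∈ XX O, act J x = F ∧ ¬ ∃ σ : ℝ, F = act J y + σ • act E33 y :=
    hU (mem_inf_of_right (mem_principal_self _))
  have hch : ∀ F : M3, ∃ x : G, (∃ x ∈ XX O, act J x = F ∧ ¬ ∃ σ : ℝ, F = act J y + σ • act E33 y) →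
      x ∈ XX O ∧ act J x = F ∧ ¬ ∃ σ : ℝ, F = act J y + σ • act E33 y := by
    intro F
    by_cases h : (∃ x ∈ XX O, act J x = F ∧ ¬ ∃ σ : ℝ, F = act J y + σ • act E33 y)
    · obtain ⟨x, hx⟩ := h; exact ⟨x, fun _ => hx⟩
    · exact ⟨1, fun h' => absurd h' h⟩
  choose x hx using hch
  refine hW (BU0 U hO hY hc hy x (hU2.mono fun F h => (hx F h).1) ?_ (hU2.mono fun F h => ?_))
  · refine Tendsto.congr' (hU2.mono fun F h => ((hx F h).2.1).symm) ?_
    exact hU1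
  · rintro ⟨c, σ, h1⟩
    have := act_JE_coef h1
    rw [this, one_smul, (hx F h).2.1] at h1
    exact (hx F h).2.2 ⟨σ, h1⟩

theorem UB0 {ι : Type*} (U : Ultrafilter ι) {O : Set M3} (hO : OK O) {Xm : Set G} (hXc : IsClosed Xm)
    (hXi : Inv HH Xm) {z : G} (hz : z ∈ Xm) (x : ι → G) (hx : ∀ᶠ i in U, x i ∈ XX O)
    (hlim : Tendsto (fun i => act J (x i)) U (𝓝 (act J z)))
    (hnot : ∀ᶠ i in U, act J (x i) ≠ act J z) : ∃ s : ℝ, s ≠ 0 ∧ ∃ z' ∈ Xm, v2 s * z' ∈ XX O := by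
  set Φ : ι → M3 := fun i => act (act J (x i)) z⁻¹ with hΦ
  have hΦJ : Tendsto Φ U (𝓝 J) := by
    have : Tendsto Φ U (𝓝 (act (act J z) z⁻¹)) :=
      (continuous_act.comp (by fun_prop : Continuous fun F : M3 => (F, z⁻¹))).continuousAt.tendsto.comp hlim
    rwa [← act_mul, mul_inv_cancel, act_one] at this
  have hΦx : ∀ i, act (Φ i) z = act J (x i) := by
    intro i; rw [hΦ]; simp only; rw [← act_mul, inv_mul_cancel, act_one]
  have hs : ∀ i, Φ i = sym (Φ i 0 0) (Φ i 0 1) (Φ i 0 2) (Φ i 1 1) (Φ i 1 2) (Φ i 2 2) :=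
    fun i => sym_eq (act_symm (act_symm J_symm _) _)
  have hdet : ∀ i, (Φ i).det = 1 := fun i => by rw [hΦ]; simp only; rw [act_det, act_det, J_det]
  have ha : Tendsto (fun i => Φ i 0 0) U (𝓝 0) := by simpa [J] using tendsto_ent hΦJ 0 0
  have hb : Tendsto (fun i => Φ i 0 1) U (𝓝 0) := by simpa [J] using tendsto_ent hΦJ 0 1
  have hd : Tendsto (fun i => Φ i 0 2) U (𝓝 1) := by simpa [J] using tendsto_ent hΦJ 0 2
  have hcc : Tendsto (fun i => Φ i 1 1) U (𝓝 (-1)) := by simpa [J] using tendsto_ent hΦJ 1 1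
  have he : Tendsto (fun i => Φ i 1 2) U (𝓝 0) := by simpa [J] using tendsto_ent hΦJ 1 2
  have hg : Tendsto (fun i => Φ i 2 2) U (𝓝 0) := by simpa [J] using tendsto_ent hΦJ 2 2
  have hk : Tendsto (fun i => Φ i 1 1 + Φ i 0 2) U (𝓝 0) := by simpa using hcc.add hd
  generalize hA : (fun i => Φ i 0 0) = a at *
  generalize hB : (fun i => Φ i 0 1) = b at *
  generalize hD : (fun i => Φ i 0 2) = d at *
  generalize hC : (fun i => Φ i 1 1) = c at *
  generalize hE : (fun i => Φ i 1 2) = e at *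
  generalize hG : (fun i => Φ i 2 2) = g at *
  have hs' : ∀ i, Φ i = sym (a i) (b i) (d i) (c i) (e i) (g i) := by
    intro i; rw [hs i, ← hA, ← hB, ← hD, ← hC, ← hE, ← hG]
  have hk' : Tendsto (fun i => c i + d i) U (𝓝 0) := by
    rw [← hC, ← hD]; exact hk
  set ε : ι → ℝ := fun i => |a i| + |b i| + |c i + d i| + |e i| + |g i| with hε
  have hεi : ∀ i, ε i = |a i| + |b i| + |c i + d i| + |e i| + |g i| := fun i => rfl
  have hε0 : Tendsto ε U (𝓝 0) := by
    simpa using (((ha.abs.add hb.abs).add hk'.abs).add he.abs).add hg.abs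
  have hpos : ∀ᶠ i in U, 0 < ε i := by
    filter_upwards [hnot] with i hi
    by_contra hcon
    apply hi
    have h0 := abs_nonneg (a i); have h1 := abs_nonneg (b i)
    have h2 := abs_nonneg (c i + d i); have h3 := abs_nonneg (e i)
    have h4 := abs_nonneg (g i)
    rw [hεi] at hcon
    have ea : a i = 0 := abs_eq_zero.mp (by linarith)
    have eb : b i = 0 := abs_eq_zero.mp (by linarith)
    have ek : c i + d i = 0 := abs_eq_zero.mp (by linarith)
    have ee : e i = 0 := abs_eq_zero.mp (by linarith)
    have eg : g i = 0 := abs_eq_zero.mp (by linarith)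
    have ec : c i = - d i := by linarith
    have h1 : act J (x i) = d i • act J z + (0:ℝ) • act E33 z := by
      rw [← hΦx, hs', ea, eb, ee, ec, eg, ← act_smul, ← act_smul, ← act_add]
      congr 1
      ext i j; fin_cases i <;> fin_cases j <;> simp [sym, J, E33]
    have h2 := act_JE_coef h1
    rw [h1, h2, one_smul, zero_smul, add_zero]
  have bd : ∀ i, |a i| ≤ ε i ∧ |b i| ≤ ε i ∧ |c i + d i| ≤ ε i ∧ |e i| ≤ ε i ∧ |g i| ≤ ε i := by
    intro i
    have h0 := abs_nonneg (a i); have h1 := abs_nonneg (b i)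
    have h2 := abs_nonneg (c i + d i); have h3 := abs_nonneg (e i)
    have h4 := abs_nonneg (g i)
    rw [hεi]
    refine ⟨?_, ?_, ?_, ?_, ?_⟩ <;> linarith
  have quo : ∀ f : ι → ℝ, (∀ i, |f i| ≤ ε i) → ∃ x, Tendsto (fun i => f i / ε i) U (𝓝 x) := by
    intro f hf
    apply ulim_abs
    filter_upwards [hpos] with i hi
    rw [abs_div, abs_of_pos hi, div_le_one hi]
    exact hf i
  obtain ⟨α, hα⟩ := quo a fun i => (bd i).1
  obtain ⟨β, hβ⟩ := quo b fun i => (bd i).2.1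
  obtain ⟨κ, hκ⟩ := quo (fun i => c i + d i) fun i => (bd i).2.2.1
  obtain ⟨η, hη⟩ := quo e fun i => (bd i).2.2.2.1
  obtain ⟨θ, hθ⟩ := quo g fun i => (bd i).2.2.2.2
  have hnz : |α| + |β| + |κ| + |η| + |θ| = 1 := by
    refine tendsto_nhds_unique (((((hα.abs.add hβ.abs).add hκ.abs).add hη.abs).add hθ.abs).congr' ?_) tendsto_const_nhds
    filter_upwards [hpos] with i hi
    rw [abs_div, abs_div, abs_div, abs_div, abs_div, abs_of_pos hi, ← add_div, ← add_div, ← add_div, ← add_div]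
    exact div_self hi.ne'
  set p : ℝ → ℝ := fun t => α*t^4/4+β*t^3+κ*t^2+2*η*t+θ with hp
  have hpc : Continuous p := by fun_prop
  obtain ⟨t0, ht0⟩ : ∃ t0, p t0 ≠ 0 := by
    by_contra hcon
    push Not at hcon
    have q0 := hcon 0; have q1 := hcon 1; have q2 := hcon (-1); have q3 := hcon 2; have q4 := hcon (-2)
    simp only [hp] at q0 q1 q2 q3 q4
    have z1 : α = 0 := by linarith
    have z2 : β = 0 := by linarith
    have z3 : κ = 0 := by linarith
    have z4 : η = 0 := by linarith
    have z5 : θ = 0 := by linarith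
    rw [z1, z2, z3, z4, z5] at hnz
    norm_num at hnz
  obtain ⟨δ, hδ, hball⟩ := Metric.isOpen_iff.mp (isOpen_ne.preimage hpc) t0 ht0
  -- returns
  obtain ⟨a0, ha0, hret⟩ := U2 z (show -t0 - δ/2 < -t0 + δ/2 by linarith)
  set s : ι → ℝ := fun i => (Real.sqrt (ε i))⁻¹ with hs
  have hsq0 : Tendsto (fun i => Real.sqrt (ε i)) U (𝓝 0) := by
    simpa [Function.comp_def] using (Real.continuous_sqrt.tendsto 0).comp hε0
  have hspos : ∀ᶠ i in U, 0 < s i := by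
    filter_upwards [hpos] with i hi
    exact inv_pos.mpr (Real.sqrt_pos.mpr hi)
  have htendU : Tendsto s U atTop := by
    apply tendsto_inv_nhdsGT_zero.comp
    refine tendsto_nhdsWithin_iff.mpr ⟨hsq0, ?_⟩
    filter_upwards [hpos] with i hi
    exact Real.sqrt_pos.mpr hi
  have hch : ∀ i, ∃ t : ℝ, ∃ γ : Gam, ∃ q : G, (a0 ≤ s i → t ∈ Set.Icc (-t0 - δ/2) (-t0 + δ/2) ∧
      ∃ h : s i ≠ 0, q = dg (s i) h * v1 t * z ∧ q * io γ ∈ Bd (RR 1)) := by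
    intro i
    by_cases h : a0 ≤ s i
    · have h0 : s i ≠ 0 := (ha0.trans_le h).ne'
      obtain ⟨t, ht, γ, hγ⟩ := hret (s i) h0 h
      exact ⟨t, γ, _, fun _ => ⟨ht, h0, rfl, hγ⟩⟩
    · exact ⟨0, 1, 1, fun h' => absurd h' h⟩
  choose t γ q hq using hch
  have hq' := (htendU.eventually_ge_atTop a0).mono hq
  obtain ⟨t', ht', htl⟩ := ulim U isCompact_Icc (hq'.mono fun i hi => hi.1)
  obtain ⟨z', hz', hzl⟩ := ulim U (isCompact_Bd (RR 1)) (hq'.mono fun i hi => hi.2.choose_spec.2)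
  have hzX : z' ∈ Xm := by
    refine hXc.mem_of_tendsto hzl ?_
    filter_upwards [hq'] with i ⟨_, h1, h2, _⟩
    rw [h2, mul_assoc (dg _ _)]
    exact hXi.2 _ (hXi.1 _ (hXi.1 _ hz _ (v1_mem_HH _)) _ (dg_mem_HH _ _)) _
  refine ⟨p (-t') / 2, ?_, z', hzX, ?_⟩
  · have : p (-t') ≠ 0 := by
      apply hball
      rw [Metric.mem_ball, Real.dist_eq, abs_lt]
      constructor <;> linarith [ht'.1, ht'.2]
    exact div_ne_zero this two_ne_zero
  show act J _ ∈ O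
  rw [act_mul, act_J_v2, mul_div_cancel₀ _ (two_ne_zero)]
  set Ψ : ι → M3 := fun i => sym (ε i * a i) (Real.sqrt (ε i) * (a i * (-t i) + b i)) (a i*(-t i)^2/2+b i*(-t i)+d i)
    (a i*(-t i)^2+2*b i*(-t i)+c i)
    (Real.sqrt (ε i) * ((a i/ε i)*(-t i)^3/2+3*(b i/ε i)*(-t i)^2/2+((c i+d i)/ε i)*(-t i)+e i/ε i))
    ((a i/ε i)*(-t i)^4/4+(b i/ε i)*(-t i)^3+((c i+d i)/ε i)*(-t i)^2+2*(e i/ε i)*(-t i)+g i/ε i) with hΨ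
  have hlΨ : Tendsto Ψ U (𝓝 (J + p (-t') • E33)) := by
    rw [J_sym]
    have hn := htl.neg
    apply tendsto_sym
    · simpa using hε0.mul ha
    · simpa using hsq0.mul ((ha.mul hn).add hb)
    · simpa using (((ha.mul (hn.pow 2)).div_const 2).add (hb.mul hn)).add hd
    · simpa using ((ha.mul (hn.pow 2)).add ((hb.const_mul 2).mul hn)).add hcc
    · simpa using hsq0.mul (((((hα.mul (hn.pow 3)).div_const 2).add (((hβ.const_mul 3).mul (hn.pow 2)).div_const 2)).add
        (hκ.mul hn)).add hη)
    · exact (((((hα.mul (hn.pow 4)).div_const 4).add (hβ.mul (hn.pow 3))).add (hκ.mul (hn.pow 2))).add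
        ((hη.const_mul 2).mul hn)).add hθ
  have hl2 := (continuous_act.tendsto _).comp (hlΨ.prodMk_nhds hzl)
  refine hO.1.mem_of_tendsto hl2 ?_
  filter_upwards [hq', hpos, hx] with i ⟨_, h1, h2, _⟩ h3 h4
  have h5 : s i = (Real.sqrt (ε i))⁻¹ := rfl
  have h6 := Real.sq_sqrt h3.le
  have h7 : 0 < Real.sqrt (ε i) := Real.sqrt_pos.mpr h3
  have hΨi : Ψ i = act (act (Φ i) (v1 (- t i))) (dg (s i)⁻¹ (inv_ne_zero h1)) := by
    rw [hs', act_sym_v1, act_sym_dg, h5, hΨ]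
    simp only [inv_inv]
    rw [h6]
    congr 1
    · set r := Real.sqrt (ε i)
      rw [← h6]; field_simp
    · field_simp
  show act (Ψ i) (q i * io (γ i)) ∈ O
  have : act (Ψ i) (q i * io (γ i)) = act (act J (x i)) (io (γ i)) := by
    rw [hΨi, h2, ← dg_inv _ h1, v1_neg, ← hΦx, ← act_mul (Φ i), ← act_mul (Φ i), ← act_mul (Φ i)]
    congr 1
    simp only [mul_assoc, inv_mul_cancel_left]
  rw [this]
  exact hO.2 _ h4 _

end Opp


namespace Opp
open Matrix Filter Topology
set_option linter.all false

lemma freq_ultra {α β : Type*} [Nonempty β] {l : Filter α} {P : α → β → Prop} (h : ∃ᶠ a in l, ∃ b, P a b) :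
    ∃ U : Ultrafilter α, (U : Filter α) ≤ l ∧ ∃ x : α → β, ∀ᶠ a in U, P a (x a) := by
  have hne := frequently_iff_neBot.mp h
  let U := @Ultrafilter.of _ _ hne
  have hU : (U : Filter α) ≤ _ := @Ultrafilter.of_le _ _ hne
  have hU2 : ∀ᶠ a in U, ∃ b, P a b := hU (mem_inf_of_right (mem_principal_self _))
  have hch : ∀ a : α, ∃ x : β, (∃ b, P a b) → P a x := by
    intro a
    by_cases h : ∃ b, P a b
    · obtain ⟨b, hb⟩ := h; exact ⟨b, fun _ => hb⟩
    · exact ⟨Classical.arbitrary β, fun h' => absurd h' h⟩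
  choose x hx using hch
  exact ⟨U, hU.trans inf_le_left, x, hU2.mono hx⟩

/-! affine lemma -/
lemma aff1 {ι : Type*} (U : Ultrafilter ι) {S : Set ℝ} (hS : IsClosed S) (h0 : (0:ℝ) ∈ S) {lam δ : ι → ℝ}
    (hl : Tendsto lam U (𝓝 1)) (hd : Tendsto δ U (𝓝 0)) (h1 : ∀ᶠ i in U, 1 ≤ lam i) (h2 : ∀ᶠ i in U, 0 < δ i)
    (hinv : ∀ᶠ i in U, ∀ s ∈ S, lam i * s + δ i ∈ S) : ∀ r : ℝ, 0 ≤ r → r ∈ S := by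
  intro r hr
  rw [← hS.closure_eq, Metric.mem_closure_iff]
  intro ε hε
  have ht : Tendsto (fun i => (lam i - 1) * r + δ i) U (𝓝 0) := by
    simpa using ((hl.sub_const 1).mul_const r).add hd
  obtain ⟨i, i1, i2, i3, i4⟩ := (h1.and (h2.and (hinv.and (ht.eventually (gt_mem_nhds hε))))).exists
  set x : ℕ → ℝ := fun k => (fun s => lam i * s + δ i)^[k] 0 with hx
  have hx0 : x 0 = 0 := rfl
  have hxs : ∀ k, x (k+1) = lam i * x k + δ i := fun k => Function.iterate_succ_apply' _ _ _
  have hxS : ∀ k, x k ∈ S := by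
    intro k
    induction k with
    | zero => exact h0
    | succ k ih => rw [hxs]; exact i3 _ ih
  have hxk : ∀ k : ℕ, k * δ i ≤ x k := by
    intro k
    induction k with
    | zero => simp [hx0]
    | succ k ih =>
      rw [hxs]; push_cast
      have : 0 ≤ x k := le_trans (by positivity) ih
      nlinarith
  have hex : ∃ k, r < x k := by
    obtain ⟨k, hk⟩ := exists_nat_gt (r / δ i)
    exact ⟨k, lt_of_lt_of_le ((div_lt_iff₀ i2).mp hk) (hxk k)⟩
  classical
  obtain ⟨K, hK⟩ : ∃ K, Nat.find hex = K + 1 := by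
    refine Nat.exists_eq_succ_of_ne_zero ?_
    intro h
    have := Nat.find_spec hex
    rw [h, hx0] at this
    linarith
  have s1 := Nat.find_spec hex
  have s2 := Nat.find_min hex (m := K) (by omega)
  rw [hK, hxs] at s1
  push Not at s2
  refine ⟨x K, hxS K, ?_⟩
  rw [Real.dist_eq, abs_lt]
  constructor <;> nlinarith

lemma aff2 {ι : Type*} (U : Ultrafilter ι) {S : Set ℝ} (hS : IsClosed S) {s0 : ℝ} (h0 : s0 ∈ S) {lam σ : ι → ℝ}
    (hl : Tendsto lam U (𝓝 1)) (hd : Tendsto σ U (𝓝 0)) (h1 : ∀ᶠ i in U, 1 ≤ lam i)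
    (h2 : ∀ᶠ i in U, lam i * s0 + σ i ≠ s0)
    (hinv : ∀ᶠ i in U, ∀ s ∈ S, lam i * s + σ i ∈ S) :
    ∃ ε : ℝ, (ε = 1 ∨ ε = -1) ∧ ∀ r : ℝ, 0 ≤ r → s0 + ε * r ∈ S := by
  have ht : Tendsto (fun i => lam i * s0 + σ i - s0) U (𝓝 0) := by
    simpa using ((hl.mul_const s0).add hd).sub_const s0
  have key : ∀ ε : ℝ, (ε = 1 ∨ ε = -1) → (∀ᶠ i in U, 0 < ε * (lam i * s0 + σ i - s0)) →
      ∀ r : ℝ, 0 ≤ r → s0 + ε * r ∈ S := by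
    intro ε hε hp
    refine aff1 U (S := {r | s0 + ε * r ∈ S}) (hS.preimage (f := fun r => s0 + ε * r) (by fun_prop)) (by simpa using h0) hl
      (by simpa using ht.const_mul ε) h1 hp ?_
    filter_upwards [hinv] with i hi s hs
    have := hi _ hs
    have e2 : ε * ε = 1 := by rcases hε with h | h <;> rw [h] <;> norm_num
    show s0 + ε * (lam i * s + ε * (lam i * s0 + σ i - s0)) ∈ S
    have e3 : s0 + ε * (lam i * s + ε * (lam i * s0 + σ i - s0)) = lam i * (s0 + ε * s) + σ i := by
      linear_combination (lam i * s0 + σ i - s0) * e2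
    rw [e3]; exact this
  have : ∀ᶠ i in U, (0 < lam i * s0 + σ i - s0) ∨ (lam i * s0 + σ i - s0 < 0) := by
    filter_upwards [h2] with i hi
    rcases lt_or_gt_of_ne hi with h | h
    · right; linarith
    · left; linarith
  rcases Ultrafilter.eventually_or.mp this with h | h
  · exact ⟨1, Or.inl rfl, key 1 (Or.inl rfl) (h.mono fun i hi => by linarith)⟩
  · exact ⟨-1, Or.inr rfl, key (-1) (Or.inr rfl) (h.mono fun i hi => by linarith)⟩

lemma aff3 {ι : Type*} (U : Ultrafilter ι) {S : Set ℝ} (hS : IsClosed S) {s1 s2 : ℝ} (hs1 : s1 ∈ S) (hs2 : s2 ∈ S)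
    (hs : s1 ≠ s2) {lam σ : ι → ℝ}
    (hl : Tendsto lam U (𝓝 1)) (hd : Tendsto σ U (𝓝 0))
    (h2 : ∀ᶠ i in U, ¬ (lam i = 1 ∧ σ i = 0))
    (hinv : ∀ᶠ i in U, ∀ s, s ∈ S ↔ lam i * s + σ i ∈ S) :
    ∃ s0, ∃ ε : ℝ, (ε = 1 ∨ ε = -1) ∧ ∀ r : ℝ, 0 ≤ r → s0 + ε * r ∈ S := by
  obtain ⟨s0, hs0, hne⟩ : ∃ s0 ∈ S, ∀ᶠ i in U, lam i * s0 + σ i ≠ s0 := by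
    by_cases h : ∀ᶠ i in U, lam i * s1 + σ i ≠ s1
    · exact ⟨s1, hs1, h⟩
    · refine ⟨s2, hs2, ?_⟩
      have h' := Ultrafilter.eventually_not.mpr h
      filter_upwards [h', h2] with i hi hi2 hi3
      apply hi2
      push Not at hi
      have : (lam i - 1) * (s1 - s2) = 0 := by linear_combination hi - hi3
      rcases mul_eq_zero.mp this with h | h
      · have : lam i = 1 := by linarith
        exact ⟨this, by rw [this] at hi; linarith⟩
      · exact absurd (sub_eq_zero.mp h) hs
  have hpos : ∀ᶠ i in U, 0 < lam i := hl.eventually (lt_mem_nhds one_pos)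
  rcases Ultrafilter.eventually_or.mp (Eventually.of_forall (f := (U : Filter ι)) fun i => le_total 1 (lam i)) with h | h
  · obtain ⟨ε, h3, h4⟩ := aff2 U hS hs0 hl hd h hne (hinv.mono fun i hi s hs => (hi s).mp hs)
    exact ⟨s0, ε, h3, h4⟩
  · have q1 : ∀ᶠ i in U, 1 ≤ (lam i)⁻¹ := by
      filter_upwards [h, hpos] with i hi hp
      exact (one_le_inv₀ hp).mpr hi
    have q2 : ∀ᶠ i in U, (lam i)⁻¹ * s0 + - (σ i) * (lam i)⁻¹ ≠ s0 := by
      filter_upwards [hne, hpos] with i hi hp h'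
      apply hi
      field_simp at h'
      linarith
    have q3 : ∀ᶠ i in U, ∀ s ∈ S, (lam i)⁻¹ * s + - (σ i) * (lam i)⁻¹ ∈ S := by
      filter_upwards [hinv, hpos] with i hi hp s hs
      rw [hi]
      have : lam i * ((lam i)⁻¹ * s + -σ i * (lam i)⁻¹) + σ i = s := by field_simp; ring
      rwa [this]
    obtain ⟨ε, h3, h4⟩ := aff2 U hS hs0 (lam := fun i => (lam i)⁻¹) (σ := fun i => - (σ i) * (lam i)⁻¹)
      (by simpa using hl.inv₀ one_ne_zero) (by simpa using hd.neg.mul (hl.inv₀ one_ne_zero)) q1 q2 q3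
    exact ⟨s0, ε, h3, h4⟩

lemma lin_bdd {ι : Type*} {U : Ultrafilter ι} {T : ι → ℝ} (hT : Tendsto T U atTop) {a b L : ℝ}
    (h : Tendsto (fun i => a * T i + b) U (𝓝 L)) : a = 0 := by
  have hr : Tendsto (fun i => (T i)⁻¹) U (𝓝 0) := tendsto_inv_atTop_zero.comp hT
  have h1 : Tendsto (fun i => a + b * (T i)⁻¹) U (𝓝 (a + b * 0)) := (hr.const_mul b).const_add a
  have h2 : Tendsto (fun i => (a * T i + b) * (T i)⁻¹) U (𝓝 (L * 0)) := h.mul hr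
  have h3 : Tendsto (fun i => a + b * (T i)⁻¹) U (𝓝 (L * 0)) := by
    refine h2.congr' ?_
    filter_upwards [hT.eventually_gt_atTop 0] with i hi
    field_simp
  simpa using tendsto_nhds_unique h1 h3

lemma continuous_actl (g : G) : Continuous (fun F : M3 => act F g) :=
  continuous_act.comp (by fun_prop : Continuous fun F : M3 => (F, g))

lemma act_inv_right (F : M3) (g : G) : act (act F g) g⁻¹ = F := by
  rw [← act_mul, mul_inv_cancel, act_one]
lemma act_inv_left (F : M3) (g : G) : act (act F g⁻¹) g = F := by
  rw [← act_mul, inv_mul_cancel, act_one]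

lemma same_form {x y : G} (h : act J x = act J y) : x * y⁻¹ ∈ HH := by
  show act J _ = J
  rw [act_mul, h, act_inv_right]

lemma form_mem {X : Set G} (hX : Inv HH X) {x y : G} (h : act J x = act J y) (hy : y ∈ X) : x ∈ X := by
  have := hX.1 y hy _ (same_form h)
  rwa [inv_mul_cancel_right] at this

/-- symmetric `M` whose translates along `v1 (-t_i)` converge -/
lemma unip_bdd {ι : Type*} {U : Ultrafilter ι} {T : ι → ℝ} (hT : Tendsto T U atTop) {M L : M3} (hM : Mᵀ = M)
    (h : Tendsto (fun i => act M (v1 (- T i))) U (𝓝 L)) : M 0 0 = 0 ∧ ∃ c σ : ℝ, M = c • J + σ • E33 := by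
  have hs := sym_eq hM
  generalize M 0 0 = a at *
  generalize M 0 1 = b at *
  generalize M 0 2 = d at *
  generalize M 1 1 = c at *
  generalize M 1 2 = e at *
  generalize M 2 2 = g at *
  subst hs
  simp only [act_sym_v1] at h
  have h01 := tendsto_ent h 0 1
  have h02 := tendsto_ent h 0 2
  have h12 := tendsto_ent h 1 2
  have h22 := tendsto_ent h 2 2
  simp only [sym, Matrix.of_apply, Matrix.cons_val', Matrix.cons_val_zero, Matrix.cons_val_one, Matrix.cons_val] at h01 h02 h12 h22
  have ha : -a = 0 := lin_bdd hT (b := b) (h01.congr fun i => by ring)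
  have ha : a = 0 := by linarith
  subst ha
  have hb : -b = 0 := lin_bdd hT (b := d) (h02.congr fun i => by ring)
  have hb : b = 0 := by linarith
  subst hb
  have hk : -(c+d) = 0 := lin_bdd hT (b := e) (h12.congr fun i => by ring)
  have hc : c = -d := by linarith
  subst hc
  have he : -(2*e) = 0 := lin_bdd hT (b := g) (h22.congr fun i => by ring)
  have he : e = 0 := by linarith
  subst he
  refine ⟨rfl, d, g, ?_⟩
  ext i j; fin_cases i <;> fin_cases j <;> simp [sym, J, E33]

/-- rigidity at form-isolated points of minimal sets -/
theorem rigid {Xm : Set G} (hX : IsMin HH Xm) {y : G} (hy : y ∈ Xm)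
    (hiso : ∀ᶠ F in 𝓝 (act J y), ∀ x ∈ Xm, act J x = F → F = act J y) {N : M3} (hN : Nᵀ = N)
    (hinv : ∀ γ : Gam, act (act J y) (io γ) = act J y → act N (io γ) = N) : ∃ c : ℝ, N = c • act J y := by
  have key : ∀ h ∈ HH, (act N (h * y)⁻¹) 0 0 = 0 ∧ ∃ c σ : ℝ, act N (h * y)⁻¹ = c • J + σ • E33 := by
    intro h hh
    obtain ⟨η, h1, h2, h3⟩ := InvOK_single (h * y)
    choose t ht γ hγ using fun n : ℕ => (N2 h1 h2 h3 n).1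
    set U : Ultrafilter ℕ := hyperfilter ℕ
    have hU : (U : Filter ℕ) ≤ atTop := Nat.hyperfilter_le_atTop
    have htop : Tendsto t U atTop :=
      (tendsto_atTop_mono ht tendsto_natCast_atTop_atTop).mono_left hU
    obtain ⟨z, _, hz⟩ := ulim U (isCompact_Bd (RR η)) (Eventually.of_forall hγ)
    have hmem : ∀ i, v1 (t i) * (h * y) * io (γ i) ∈ Xm := fun i =>
      hX.2.2.1.2 _ (hX.2.2.1.1 _ (hX.2.2.1.1 _ hy _ hh) _ (v1_mem_HH _)) _
    have hzX : z ∈ Xm := hX.1.mem_of_tendsto hz (Eventually.of_forall hmem)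
    have hform : ∀ i, act J (v1 (t i) * (h * y) * io (γ i)) = act (act J y) (io (γ i)) := by
      intro i
      rw [act_mul, act_mul, act_J_v1, act_mul, hh]
    -- the form of z is in the orbit
    obtain ⟨γ', hγ'⟩ : ∃ γ' : Gam, act (act J z) (io γ') = act J y := by
      obtain ⟨V, hV, hVo, hyV⟩ := mem_nhds_iff.mp hiso
      have hcl : y ∈ closure {x | ∃ h ∈ HH, ∃ γ : Gam, x = h * z * io γ} := by
        rw [← hX.dense HH_one HH_mul hzX]; exact hy
      obtain ⟨x, hxV, k, hk, γ', rfl⟩ := mem_closure_iff.mp hcl _ (hVo.preimage (continuous_actJ J)) hyV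
      refine ⟨γ', ?_⟩
      have e : act J (k * z * io γ') = act (act J z) (io γ') := by
        rw [act_mul, act_mul, hk]
      rw [← e]
      exact hV hxV _ (hX.2.2.1.2 _ (hX.2.2.1.1 _ hzX _ hk) _) rfl
    have hz' : Tendsto (fun i => v1 (t i) * (h * y) * io (γ i) * io γ') U (𝓝 (z * io γ')) :=
      hz.mul_const _
    have hev : ∀ᶠ i in U, act N (io (γ i * γ')) = N := by
      have h5 : Tendsto (fun i => act J (v1 (t i) * (h * y) * io (γ i) * io γ')) U (𝓝 (act J y)) := by
        rw [← hγ', ← act_mul]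
        exact ((continuous_actJ J).tendsto _).comp hz'
      filter_upwards [h5.eventually hiso] with i hi
      apply hinv
      have := hi _ (hX.2.2.1.2 _ (hmem i) γ') rfl
      rwa [act_mul, hform, ← act_mul, ← map_mul] at this
    have hconv : Tendsto (fun i => act N (v1 (t i) * (h * y) * io (γ i) * io γ')⁻¹) U (𝓝 (act N (z * io γ')⁻¹)) :=
      ((continuous_actJ N).tendsto _).comp hz'.inv
    refine unip_bdd htop (act_symm hN _) (hconv.congr' ?_)
    filter_upwards [hev] with i hi
    conv_lhs => rw [← hi]
    rw [← act_mul, ← act_mul, v1_neg, map_mul]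
    congr 1
    group
  obtain ⟨_, c, σ, h1⟩ := key 1 HH_one
  obtain ⟨h2, _⟩ := key JG act_J_JG
  rw [one_mul] at h1
  have h3 : act N (JG * y)⁻¹ = act (c • J + σ • E33) JG⁻¹ := by
    rw [_root_.mul_inv_rev, act_mul, h1]
  have hJi : (JG⁻¹ : G) = JG := by
    rw [inv_eq_iff_mul_eq_one]
    apply Gext
    rw [Matrix.SpecialLinearGroup.coe_mul, JG_coe]
    simp only [Matrix.mul_fin_three]
    ext i j; fin_cases i <;> fin_cases j <;> simp
  have h4 : (act (c • J + σ • E33) JG) 0 0 = σ := by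
    unfold act
    rw [JG_coe]
    simp [Matrix.mul_apply, Fin.sum_univ_three, J, E33]
  rw [h3, hJi, h4] at h2
  refine ⟨c, ?_⟩
  rw [← act_inv_left N y, h1, h2, zero_smul, add_zero, act_smul]

/-- applying an additive map to the entries -/
def mp (f : ℝ →+ ℝ) (F : M3) : M3 := F.map f

lemma map_zmul (f : ℝ →+ ℝ) (n : ℤ) (x : ℝ) : f (n * x) = n * f x := by
  rw [← zsmul_eq_mul, map_zsmul, zsmul_eq_mul]

lemma mp_act (f : ℝ →+ ℝ) (F : M3) (γ : Gam) : mp f (act F (io γ)) = act (mp f F) (io γ) := by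
  ext i j
  simp only [mp, act, Matrix.map_apply, Matrix.mul_apply, Fin.sum_univ_three, Matrix.transpose_apply, io_coe]
  have e : ∀ a b : ℤ, ∀ x : ℝ, f ((a:ℝ) * x * b) = a * f x * b := by
    intro a b x
    rw [mul_comm, map_zmul, map_zmul, mul_comm]
  simp only [add_mul, map_add, e]

lemma mp_symm (f : ℝ →+ ℝ) {F : M3} (h : Fᵀ = F) : (mp f F)ᵀ = mp f F := by
  rw [mp, ← Matrix.transpose_map, h]

/-- the orbit closure of a form -/
def OC (Q : M3) : Set M3 := closure {F | ∃ γ : Gam, F = act Q (io γ)}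

lemma OC_ok (Q : M3) : OK (OC Q) := by
  refine ⟨isClosed_closure, ?_⟩
  intro F hF γ
  refine map_mem_closure (f := fun F => act F (io γ)) (continuous_actl (io γ)) hF ?_
  rintro _ ⟨γ', rfl⟩
  exact ⟨γ' * γ, by rw [map_mul, act_mul]⟩

theorem nonisolated {g0 : G} {f : ℝ →+ ℝ} (hf : ∀ c : ℝ, mp f (act J g0) ≠ c • act J g0) {Xm : Set G}
    (hX : IsMin HH Xm) (hXO : Xm ⊆ XX (OC (act J g0))) {y : G} (hy : y ∈ Xm) :
    ∃ᶠ F in 𝓝 (act J y), ∃ x, x ∈ XX (OC (act J g0)) ∧ act J x = F ∧ F ≠ act J y := by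
  by_contra hcon
  rw [not_frequently] at hcon
  have hiso : ∀ᶠ F in 𝓝 (act J y), ∀ x ∈ XX (OC (act J g0)), act J x = F → F = act J y := by
    filter_upwards [hcon] with F hF x hx hxF
    by_contra h
    exact hF ⟨x, hx, hxF, h⟩
  have hyO : act J y ∈ OC (act J g0) := hXO hy
  obtain ⟨V, hV, hVo, hyV⟩ := mem_nhds_iff.mp hiso
  obtain ⟨_, hFV, γ, rfl⟩ := mem_closure_iff.mp hyO V hVo hyV
  have hγ : act (act J g0) (io γ) = act J y := by
    refine hV hFV (g0 * io γ) ?_ (act_mul _ _ _)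
    show act J _ ∈ OC (act J g0)
    rw [act_mul]
    exact subset_closure ⟨γ, rfl⟩
  obtain ⟨c, hc⟩ := rigid hX hy (hiso.mono fun F h x hx => h x (hXO hx)) (N := mp f (act J y))
    (mp_symm f (act_symm J_symm y)) (by
      intro γ hγ
      rw [← mp_act, hγ])
  apply hf c
  rw [← hγ, mp_act, ← act_smul] at hc
  exact act_inj hc

end Opp


namespace Opp
open Matrix Filter Topology
set_option linter.all false

lemma act_J_v2_mul (s : ℝ) (y : G) : act J (v2 s * y) = act J y + (2 * s) • act E33 y := by
  rw [act_mul, act_J_v2, act_add, act_smul]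

lemma act_E_v2_mul (s : ℝ) (y : G) : act E33 (v2 s * y) = act E33 y := by
  rw [act_mul, act_E_v2]

lemma mem_XX {O : Set M3} {x : G} : x ∈ XX O ↔ act J x ∈ O := Iff.rfl

lemma mem_XX_v2 {O : Set M3} (s : ℝ) (y : G) : v2 s * y ∈ XX O ↔ act J y + (2 * s) • act E33 y ∈ O := by
  rw [mem_XX, act_J_v2_mul]

lemma v2_cancel (s : ℝ) (y : G) : v2 (-s) * (v2 s * y) = y := by
  rw [v2_neg, inv_mul_cancel_left]
lemma v2_cancel' (s : ℝ) (y : G) : v2 s * (v2 (-s) * y) = y := by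
  rw [v2_neg, mul_inv_cancel_left]

/-- translate of a set -/
def tr (s : ℝ) (Y : Set G) : Set G := (fun x => v2 (-s) * x) ⁻¹' Y

lemma mem_tr {s : ℝ} {Y : Set G} {x : G} : x ∈ tr s Y ↔ v2 (-s) * x ∈ Y := Iff.rfl

lemma tr_closed {s : ℝ} {Y : Set G} (h : IsClosed Y) : IsClosed (tr s Y) :=
  h.preimage (by fun_prop)

lemma tr_inv {s : ℝ} {Y : Set G} (h : Inv V1 Y) : Inv V1 (tr s Y) := by
  constructor
  · rintro y hy _ ⟨t, rfl⟩
    rw [mem_tr] at hy ⊢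
    rw [← mul_assoc, ← v1_v2, mul_assoc]
    exact h.1 _ hy _ (v1_mem t)
  · intro y hy γ
    rw [mem_tr] at hy ⊢
    rw [← mul_assoc]
    exact h.2 _ hy γ

lemma IsMin.tr {s : ℝ} {Y : Set G} (h : IsMin V1 Y) : IsMin V1 (tr s Y) := by
  refine ⟨tr_closed h.1, ?_, tr_inv h.2.2.1, ?_⟩
  · obtain ⟨y, hy⟩ := h.2.1
    exact ⟨v2 s * y, mem_tr.mpr (by rwa [v2_cancel])⟩
  · intro Z hZ hc hne hi
    have h1 : Opp.tr (-s) Z = Y := by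
      apply h.2.2.2 _ _ (tr_closed hc) _ (tr_inv hi)
      · intro y hy
        rw [mem_tr, neg_neg] at hy
        have := mem_tr.mp (hZ hy)
        rwa [v2_cancel] at this
      · obtain ⟨z, hz⟩ := hne
        exact ⟨v2 (-s) * z, mem_tr.mpr (by rwa [neg_neg, v2_cancel'])⟩
    apply Set.Subset.antisymm hZ
    intro x hx
    rw [mem_tr, ← h1, mem_tr, neg_neg, v2_cancel'] at hx
    exact hx

lemma CompactMod.tr {s : ℝ} {Y : Set G} (h : CompactMod Y) : CompactMod (tr s Y) := by
  obtain ⟨R, hR⟩ := h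
  obtain ⟨B, hB, hB'⟩ := exists_entry_bd (v2 s : M3)
  refine ⟨3 * (B * R), ?_⟩
  intro y hy
  obtain ⟨γ, hγ⟩ := hR _ (mem_tr.mp hy)
  refine ⟨γ, fun i j => ?_⟩
  have e : y * io γ = v2 s * (v2 (-s) * y * io γ) := by
    rw [mul_assoc (v2 (-s)), v2_cancel']
  rw [e, Matrix.SpecialLinearGroup.coe_mul]
  exact entry_mul_le hB.le hB' hγ i j

lemma norm_form {k : G} {lam : ℝ} (h1 : act J k = J) (h2 : act E33 k = lam • E33) :
    ∃ h : (k : M3) 2 2 ≠ 0, lam = (k : M3) 2 2 ^ 2 ∧ k = dg ((k : M3) 2 2)⁻¹ (inv_ne_zero h) * v1 ((k : M3) 1 2) := by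
  have hd := k.2
  rw [Matrix.det_fin_three] at hd
  have e00 := congrFun (congrFun h2 0) 0
  have e11 := congrFun (congrFun h2 1) 1
  have e22 := congrFun (congrFun h2 2) 2
  have j00 := congrFun (congrFun h1 0) 0
  have j11 := congrFun (congrFun h1 1) 1
  have j02 := congrFun (congrFun h1 0) 2
  have j12 := congrFun (congrFun h1 1) 2
  have j22 := congrFun (congrFun h1 2) 2
  simp [act, E33, J, Matrix.mul_apply, Fin.sum_univ_three] at e00 e11 e22 j00 j11 j02 j12 j22
  change ((k : M3) 0 0 * (k : M3) 1 1 * (k : M3) 2 2 - (k : M3) 0 0 * (k : M3) 1 2 * (k : M3) 2 1 -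
    (k : M3) 0 1 * (k : M3) 1 0 * (k : M3) 2 2 + (k : M3) 0 1 * (k : M3) 1 2 * (k : M3) 2 0 +
    (k : M3) 0 2 * (k : M3) 1 0 * (k : M3) 2 1 - (k : M3) 0 2 * (k : M3) 1 1 * (k : M3) 2 0 = 1) at hd
  have hk : (k : M3) = !![(k : M3) 0 0, (k : M3) 0 1, (k : M3) 0 2; (k : M3) 1 0, (k : M3) 1 1, (k : M3) 1 2;
      (k : M3) 2 0, (k : M3) 2 1, (k : M3) 2 2] := by
    ext i j; fin_cases i <;> fin_cases j <;> rfl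
  generalize (k : M3) 0 0 = p00 at *
  generalize (k : M3) 0 1 = p01 at *
  generalize (k : M3) 0 2 = p02 at *
  generalize (k : M3) 1 0 = p10 at *
  generalize (k : M3) 1 1 = p11 at *
  generalize (k : M3) 1 2 = p12 at *
  generalize (k : M3) 2 0 = p20 at *
  generalize (k : M3) 2 1 = p21 at *
  generalize (k : M3) 2 2 = p22 at *
  subst e00
  subst e11
  have j00' : p10 = 0 := by
    have : p10 * p10 = 0 := by linarith
    exact mul_self_eq_zero.mp this
  subst j00'
  simp at hd j02 j12 j22 j11
  have hm : p22 ≠ 0 := by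
    intro h; rw [h] at hd; simp at hd
  have e1 : p11 = 1 := by
    have : (p00 * p22) * p11 = 1 := by linear_combination hd
    have j : p00 * p22 = 1 := by linear_combination j02
    rw [j] at this; linarith
  subst e1
  have e2 : p00 = p22⁻¹ := by field_simp; linear_combination hd
  have e3 : p01 = p22⁻¹ * p12 := by field_simp; linear_combination j12
  have e4 : p02 = p22⁻¹ * (p12^2/2) := by field_simp; linear_combination j22
  refine ⟨hm, by linear_combination -e22, ?_⟩
  apply Gext
  rw [Matrix.SpecialLinearGroup.coe_mul, dg_coe, v1_coe, hk, e2, e3, e4]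
  simp only [Matrix.mul_fin_three]
  ext i j; fin_cases i <;> fin_cases j <;> simp

lemma disc {δ : ℕ → Gam} (h : Tendsto (fun n => io (δ n)) atTop (𝓝 1)) : ∃ n, io (δ n) = 1 := by
  have h1 : ∀ i j : Fin 3, ∀ᶠ n in atTop, |((io (δ n) : G) : M3) i j - (1 : M3) i j| < 1 := by
    intro i j
    have h2 := ((continuous_entry i j).tendsto 1).comp h
    have h3 : Tendsto (fun n => |((io (δ n) : G) : M3) i j - (1 : M3) i j|) atTop (𝓝 0) := by
      have := (h2.sub_const ((1 : M3) i j)).abs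
      simpa using this
    exact h3.eventually (gt_mem_nhds one_pos)
  obtain ⟨n, hn⟩ := (eventually_all.mpr fun i => eventually_all.mpr fun j => h1 i j).exists
  refine ⟨n, ?_⟩
  apply Gext
  rw [Matrix.SpecialLinearGroup.coe_one]
  ext i j
  have := hn i j
  rw [io_coe] at this ⊢
  have e : (1 : M3) i j = (((1 : Matrix (Fin 3) (Fin 3) ℤ) i j : ℤ) : ℝ) := by
    simp [Matrix.one_apply]
  rw [e] at this ⊢
  norm_cast at this ⊢
  rw [Int.abs_lt_one_iff] at this
  linarith

lemma v1_eq_one {t : ℝ} (h : v1 t = 1) : t = 0 := by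
  have := congrArg (fun g : G => (g : M3) 0 1) h
  simpa [v1_coe] using this

/-- no contraction of periodic orbits -/
lemma period {y : G} {T : ℝ} (hT : T ≠ 0) {u : Gam} (hu : v1 T * y = y * io u) {γ : Gam} {lam σ : ℝ}
    (h1 : act E33 (y * io γ * y⁻¹) = lam • E33) (h2 : act J (y * io γ * y⁻¹) = J + σ • E33) : lam = 1 := by
  set g := y * io γ * y⁻¹ with hg
  set P : Set ℝ := {t | ∃ δ : Gam, v1 t * y = y * io δ} with hP
  have hPT : T ∈ P := ⟨u, hu⟩
  set k := g * v2 (-(σ/2)) with hk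
  have k1 : act J k = J := by
    rw [hk, act_mul, h2, act_add, act_smul, act_E_v2, act_J_v2]
    ext i j; simp; ring
  have k2 : act E33 k = lam • E33 := by
    rw [hk, act_mul, h1, act_smul, act_E_v2]
  obtain ⟨hm, hlam, hkd⟩ := norm_form k1 k2
  generalize (k : M3) 2 2 = μ at *
  generalize (k : M3) 1 2 = τ at *
  have hgk : g = k * v2 (σ/2) := by rw [hk, v2_neg, inv_mul_cancel_right]
  -- conjugation
  have conj : ∀ t, g * v1 t = v1 (μ⁻¹ * t) * g := by
    intro t
    calc g * v1 t = k * (v1 t * v2 (σ/2)) := by rw [hgk, v1_v2, mul_assoc]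
      _ = dg μ⁻¹ (inv_ne_zero hm) * (v1 τ * v1 t) * v2 (σ/2) := by
        conv_lhs => rw [hkd]
        simp only [mul_assoc]
      _ = v1 (μ⁻¹ * t) * (dg μ⁻¹ (inv_ne_zero hm) * v1 τ) * v2 (σ/2) := by
        rw [← v1_add, add_comm, v1_add, ← mul_assoc, dg_v1]
        simp only [mul_assoc]
      _ = v1 (μ⁻¹ * t) * g := by rw [← hkd, hgk, mul_assoc]
  have hgy : g * y = y * io γ := by rw [hg, inv_mul_cancel_right]
  have hgy' : g⁻¹ * y = y * (io γ)⁻¹ := by rw [hg]; group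
  have st1 : ∀ t ∈ P, μ⁻¹ * t ∈ P := by
    rintro t ⟨δ, hδ⟩
    refine ⟨γ * δ * γ⁻¹, ?_⟩
    have : v1 (μ⁻¹ * t) = g * v1 t * g⁻¹ := by rw [conj, mul_inv_cancel_right]
    rw [this, mul_assoc, hgy', mul_assoc g, ← mul_assoc (v1 t), hδ, ← mul_assoc, ← mul_assoc, hgy]
    simp only [map_mul, map_inv, mul_assoc]
  have st2 : ∀ t ∈ P, μ * t ∈ P := by
    rintro t ⟨δ, hδ⟩
    refine ⟨γ⁻¹ * δ * γ, ?_⟩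
    have : v1 (μ * t) = g⁻¹ * v1 t * g := by
      have := conj (μ * t)
      rw [inv_mul_cancel_left₀ hm] at this
      rw [mul_assoc, ← this, inv_mul_cancel_left]
    rw [this, mul_assoc, hgy, mul_assoc g⁻¹, ← mul_assoc (v1 t), hδ, ← mul_assoc, ← mul_assoc, hgy']
    simp only [map_mul, map_inv, mul_assoc]
  have contr : ∀ ν : ℝ, |ν| < 1 → ν ≠ 0 → (∀ t ∈ P, ν * t ∈ P) → False := by
    intro ν hν hν0 hst
    have hmem : ∀ n : ℕ, ν ^ n * T ∈ P := by
      intro n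
      induction n with
      | zero => simpa using hPT
      | succ n ih => rw [pow_succ', mul_assoc]; exact hst _ ih
    choose δ hδ using hmem
    have hδ' : ∀ n, io (δ n) = y⁻¹ * (v1 (ν ^ n * T) * y) := by
      intro n; rw [hδ, inv_mul_cancel_left]
    have hlim : Tendsto (fun n => io (δ n)) atTop (𝓝 1) := by
      have q1 : Tendsto (fun n : ℕ => ν ^ n * T) atTop (𝓝 0) := by
        simpa using (tendsto_pow_atTop_nhds_zero_of_abs_lt_one hν).mul_const T
      have q2 : Tendsto (fun n : ℕ => y⁻¹ * (v1 (ν ^ n * T) * y)) atTop (𝓝 (y⁻¹ * (v1 0 * y))) :=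
        (((continuous_v1.tendsto 0).comp q1).mul_const y).const_mul y⁻¹
      rw [v1_zero, one_mul, inv_mul_cancel] at q2
      simpa only [hδ'] using q2
    obtain ⟨n, hn⟩ := disc hlim
    have e := hδ n
    rw [hn, mul_one] at e
    have e2 : v1 (ν ^ n * T) = 1 := mul_eq_right.mp e
    have e3 := v1_eq_one e2
    rcases mul_eq_zero.mp e3 with h | h
    · exact pow_ne_zero n hν0 h
    · exact hT h
  rcases lt_trichotomy |μ| 1 with h | h | h
  · exact (contr μ h hm st2).elim
  · rw [hlam, ← sq_abs, h, one_pow]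
  · refine (contr μ⁻¹ ?_ (inv_ne_zero hm) st1).elim
    rw [abs_inv]
    exact inv_lt_one_of_one_lt₀ h

end Opp

namespace Opp
open Matrix Filter Topology
set_option linter.all false

lemma E33_22 : E33 2 2 = 1 := by simp [E33]

lemma coef_lim {ι : Type*} {U : Filter ι} {c : ι → ℝ} {c0 : ℝ} {z : G}
    (h : Tendsto (fun i => c i • act E33 z) U (𝓝 (c0 • act E33 z))) : Tendsto c U (𝓝 c0) := by
  have h1 := ((continuous_actl z⁻¹).tendsto _).comp h
  have h2 := tendsto_ent h1 2 2
  simpa [Function.comp_def, act_smul, act_inv_right, E33_22] using h2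

lemma coef_inj {c d : ℝ} {z : G} (h : c • act E33 z = d • act E33 z) : c = d := by
  rw [← act_smul, ← act_smul] at h
  have := congrFun (congrFun (act_inj h) 2) 2
  simpa [E33_22] using this

lemma BB2 {O : Set M3} (hO : OK O) (hW : ¬ Win O) {Y : Set G} (hY : IsMin V1 Y) (hc : CompactMod Y)
    {ς : ℝ} (hς : ς ≠ 0) {z : G} (hz : z ∈ Y) :
    ∀ᶠ x in 𝓝 z, x ∈ XX O → v2 ς * x ∈ XX O → ∃ p : ℝ × ℝ, act J x = act J z + p.1 • act E33 z ∧
      act E33 x = p.2 • act E33 z := by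
  have h1 := ((continuous_actJ J).tendsto z).eventually (BB hO hW hY hc hz)
  have hz2 : v2 ς * z ∈ tr ς Y := mem_tr.mpr (by rwa [v2_cancel])
  have hct : Continuous (fun x : G => act J (v2 ς * x)) := (continuous_actJ J).comp (by fun_prop)
  have h2 := (hct.tendsto z).eventually (BB hO hW (hY.tr (s := ς)) (hc.tr (s := ς)) hz2)
  filter_upwards [h1, h2] with x a1 a2 b1 b2
  obtain ⟨σ, hσ⟩ := a1 x b1 rfl
  obtain ⟨σ', hσ'⟩ := a2 _ b2 rfl
  rw [act_J_v2_mul, act_J_v2_mul, act_E_v2_mul, hσ] at hσ'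
  refine ⟨(σ, (2*ς)⁻¹ * (2*ς+σ'-σ)), hσ, ?_⟩
  have h3 : (2*ς) • act E33 x = (2*ς+σ'-σ) • act E33 z := by
    ext i j
    have := congrFun (congrFun hσ' i) j
    simp only [Matrix.add_apply, Matrix.smul_apply, smul_eq_mul] at this ⊢
    linarith
  rw [mul_smul, ← h3, smul_smul, inv_mul_cancel₀ (by simpa using hς), one_smul]

lemma affW {ι : Type*} (U : Ultrafilter ι) {O : Set M3} (hO : OK O) {Y : Set G} (hY : IsMin V1 Y)
    {ς : ℝ} (hς : ς ≠ 0) (h0 : ∀ y ∈ Y, y ∈ XX O) (h1 : ∀ y ∈ Y, v2 ς * y ∈ XX O) {z : G} (hz : z ∈ Y)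
    {x : ι → G} (hx : ∀ᶠ i in U, x i ∈ Y) {σ lam : ι → ℝ}
    (e1 : ∀ᶠ i in U, act J (x i) = act J z + σ i • act E33 z)
    (e2 : ∀ᶠ i in U, act E33 (x i) = lam i • act E33 z)
    (hl : Tendsto lam U (𝓝 1)) (hd : Tendsto σ U (𝓝 0))
    (hn : ∀ᶠ i in U, ¬ (lam i = 1 ∧ σ i = 0)) : Win O := by
  set S : Set ℝ := (fun s => v2 s * z) ⁻¹' XX O with hS
  have hSc : IsClosed S := hO.closed.preimage (continuous_v2.mul continuous_const)
  have m0 : (0:ℝ) ∈ S := Set.mem_preimage.mpr (by rw [v2_zero, one_mul]; exact h0 z hz)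
  have m1 : ς ∈ S := Set.mem_preimage.mpr (h1 z hz)
  have hd' : Tendsto (fun i => σ i / 2) U (𝓝 0) := by simpa using hd.div_const 2
  have := aff3 U hSc m0 m1 hς.symm hl hd' (hn.mono fun i hi h => hi ⟨h.1, by linarith [h.2]⟩) (by
    filter_upwards [hx, e1, e2] with i a b c s
    have k1 : v2 (lam i * s + σ i / 2) * z ∈ XX O ↔ v2 s * x i ∈ XX O := by
      rw [mem_XX_v2, mem_XX_v2, b, c]
      have : act J z + σ i • act E33 z + (2 * s) • lam i • act E33 z =
        act J z + (2 * (lam i * s + σ i / 2)) • act E33 z := by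
        rw [smul_smul, add_assoc, ← add_smul]; congr 2; ring
      rw [this]
    rw [hS, Set.mem_preimage, Set.mem_preimage, k1]
    exact ⟨fun h => all_of_one hO hY ⟨z, hz, h⟩ _ a, fun h => all_of_one hO hY ⟨x i, a, h⟩ _ hz⟩)
  obtain ⟨s0, ε, hε, h⟩ := this
  refine ⟨v2 s0 * z, ε, hε, fun s hs => ?_⟩
  have := Set.mem_preimage.mp (h s hs)
  rwa [add_comm, v2_add, mul_assoc] at this

lemma dg_one (a : ℝ) (ha : a ≠ 0) (h : a = 1) : dg a ha = 1 := by
  apply Gext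
  rw [dg_coe, h]
  ext i j; fin_cases i <;> fin_cases j <;> simp

theorem periodic {O : Set M3} (hO : OK O) (hW : ¬ Win O) {Y : Set G} (hY : IsMin V1 Y) (hc : CompactMod Y)
    {ς : ℝ} (hς : ς ≠ 0) (h0 : ∀ y ∈ Y, y ∈ XX O) (h1 : ∀ y ∈ Y, v2 ς * y ∈ XX O) {y : G} (hy : y ∈ Y) :
    ∃ T : ℝ, T ≠ 0 ∧ ∃ u : Gam, v1 T * y = y * io u := by
  obtain ⟨R, hR⟩ := id hc
  have hRn : ∀ n : ℕ, ∃ γ : Gam, v1 (n:ℝ) * y * io γ ∈ Bd R := fun n => hR _ (hY.2.2.1.1 y hy _ (v1_mem _))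
  choose γ hγ using hRn
  set x : ℕ → G := fun n => v1 (n:ℝ) * y * io (γ n) with hx
  have hxY : ∀ n, x n ∈ Y := fun n => hY.2.2.1.2 _ (hY.2.2.1.1 y hy _ (v1_mem _)) _
  obtain ⟨z, -, hlim⟩ := ulim (hyperfilter ℕ) (isCompact_Bd R) (Eventually.of_forall hγ)
  have hlim : Tendsto x (hyperfilter ℕ) (𝓝 z) := hlim
  have hz : z ∈ Y := hY.1.mem_of_tendsto hlim (Eventually.of_forall hxY)
  have hev : ∀ᶠ i in (hyperfilter ℕ : Filter ℕ), ∃ p : ℝ × ℝ, act J (x i) = act J z + p.1 • act E33 z ∧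
      act E33 (x i) = p.2 • act E33 z := by
    filter_upwards [hlim.eventually (BB2 hO hW hY hc hς hz)] with i hi
    exact hi (h0 _ (hxY i)) (h1 _ (hxY i))
  obtain ⟨p, hp⟩ := hev.choice
  have hl : Tendsto (fun i => (p i).2) (hyperfilter ℕ) (𝓝 1) := by
    apply coef_lim (z := z)
    rw [one_smul]
    exact (((continuous_actJ E33).tendsto z).comp hlim).congr' (hp.mono fun i hi => hi.2)
  have hd : Tendsto (fun i => (p i).1) (hyperfilter ℕ) (𝓝 0) := by
    apply coef_lim (z := z)
    rw [zero_smul]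
    have a1 := (((continuous_actJ J).tendsto z).comp hlim).sub_const (act J z)
    rw [sub_self] at a1
    refine a1.congr' (hp.mono fun i hi => ?_)
    simp only [Function.comp_apply]
    rw [hi.1, add_sub_cancel_left]
  have hnn : ∀ᶠ i in (hyperfilter ℕ : Filter ℕ), (p i).2 = 1 ∧ (p i).1 = 0 := by
    by_contra hcon
    rw [← Ultrafilter.eventually_not] at hcon
    exact hW (affW (hyperfilter ℕ) hO hY hς h0 h1 hz (Eventually.of_forall hxY) (hp.mono fun i hi => hi.1)
      (hp.mono fun i hi => hi.2) hl hd hcon)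
  have hk : Tendsto (fun i => x i * z⁻¹) (hyperfilter ℕ) (𝓝 1) := by
    have := hlim.mul_const z⁻¹
    rwa [mul_inv_cancel] at this
  have hk2 := ((continuous_entry 2 2).tendsto 1).comp hk
  have hk1 := ((continuous_entry 1 2).tendsto 1).comp hk
  have hb2 : ∀ᶠ i in (hyperfilter ℕ : Filter ℕ), 0 < ((x i * z⁻¹ : G) : M3) 2 2 := by
    apply hk2.eventually (lt_mem_nhds _)
    simp
  have hb1 : ∀ᶠ i in (hyperfilter ℕ : Filter ℕ), |((x i * z⁻¹ : G) : M3) 1 2| < 1/4 := by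
    have := hk1.abs
    apply this.eventually (gt_mem_nhds _)
    simp
  have hA : ∀ᶠ i in (hyperfilter ℕ : Filter ℕ), ∃ τ : ℝ, |τ| < 1/4 ∧ x i = v1 τ * z := by
    filter_upwards [hp, hnn, hb2, hb1] with i a b c d
    have n1 : act J (x i * z⁻¹) = J := by rw [act_mul, a.1, b.2, zero_smul, add_zero, act_inv_right]
    have n2 : act E33 (x i * z⁻¹) = (1:ℝ) • E33 := by rw [act_mul, a.2, b.1, act_smul, act_inv_right]
    obtain ⟨hne, hl, hk⟩ := norm_form n1 n2
    have hm : ((x i * z⁻¹ : G) : M3) 2 2 = 1 := by nlinarith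
    refine ⟨_, d, ?_⟩
    rw [dg_one _ _ (by rw [hm, inv_one]), one_mul] at hk
    rw [← hk, inv_mul_cancel_right]
  obtain ⟨n, τ, hτ, en⟩ := hA.exists
  obtain ⟨m, ⟨τ', hτ', em⟩, hnm⟩ := (hA.and (Nat.hyperfilter_le_atTop (eventually_gt_atTop n))).exists
  have f1 : z = v1 (-τ + n) * y * io (γ n) := by
    rw [v1_add, v1_neg, mul_assoc, mul_assoc, ← mul_assoc (v1 (n:ℝ))]
    exact eq_inv_mul_of_mul_eq en.symm
  have f2 : z = v1 (-τ' + m) * y * io (γ m) := by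
    rw [v1_add, v1_neg, mul_assoc, mul_assoc, ← mul_assoc (v1 (m:ℝ))]
    exact eq_inv_mul_of_mul_eq em.symm
  refine ⟨-(-τ' + m) + (-τ + n), ?_, γ m * (γ n)⁻¹, ?_⟩
  · have : (n:ℝ) + 1 ≤ m := by exact_mod_cast hnm
    have := abs_lt.mp hτ; have := abs_lt.mp hτ'
    intro h; linarith
  · rw [v1_add, v1_neg, map_mul, map_inv, mul_assoc, inv_mul_eq_iff_eq_mul, ← mul_assoc, ← mul_assoc, eq_mul_inv_iff_mul_eq,
      ← f2, ← f1]

end Opp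

namespace Opp
open Matrix Filter Topology
set_option linter.all false

lemma period2 {y : G} {T : ℝ} (hT : T ≠ 0) {u : Gam} (hu : v1 T * y = y * io u) {γ : Gam} {lam σ : ℝ}
    (h1 : act (act E33 y) (io γ) = lam • act E33 y) (h2 : act (act J y) (io γ) = act J y + σ • act E33 y) :
    act (act E33 y) (io γ) = act E33 y := by
  have : lam = 1 := by
    apply period hT hu (γ := γ) (σ := σ)
    · rw [act_mul, act_mul, h1, act_smul, act_inv_right]
    · rw [act_mul, act_mul, h2, act_add, act_smul, act_inv_right, act_inv_right]
  rw [h1, this, one_smul]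

lemma case_a {O : Set M3} (hO : OK O) (hW : ¬ Win O) {Y : Set G} (hY : IsMin V1 Y) (hc : CompactMod Y)
    {ς : ℝ} (hς : ς ≠ 0) (h0 : ∀ y ∈ Y, y ∈ XX O) (h1 : ∀ y ∈ Y, v2 ς * y ∈ XX O) {y : G} (hy : y ∈ Y)
    {T : ℝ} (hT : T ≠ 0) {u : Gam} (hu : v1 T * y = y * io u) {Xm : Set G} (hX : IsMin HH Xm) (hyX : y ∈ Xm) :
    ∀ᶠ F in 𝓝 (act J y), ∀ x ∈ Xm, act J x = F → F = act J y := by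
  by_contra hcon
  rw [not_eventually] at hcon
  have hfr : ∃ᶠ F in 𝓝 (act J y), ∃ γ : Gam, act (act J y) (io γ) = F ∧ F ≠ act J y := by
    rw [frequently_iff] at hcon ⊢
    intro W hWn
    obtain ⟨W', hW', hWo, hWm⟩ := mem_nhds_iff.mp hWn
    obtain ⟨F, hF, hF2⟩ := hcon (hWo.mem_nhds hWm)
    push Not at hF2
    obtain ⟨x, hx, rfl, hne⟩ := hF2
    rw [hX.dense HH_one HH_mul hyX, mem_closure_iff] at hx
    obtain ⟨x', hx', h, hh, γ, rfl⟩ := hx ((fun g => act J g) ⁻¹' (W' ∩ {act J y}ᶜ))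
      ((hWo.inter isOpen_compl_singleton).preimage (continuous_actJ J)) (Set.mem_preimage.mpr ⟨hF, hne⟩)
    have hx'' := Set.mem_preimage.mp hx'
    have e : act J (h * y * io γ) = act (act J y) (io γ) := by
      rw [act_mul, act_mul, show act J h = J from hh]
    rw [e] at hx''
    exact ⟨_, hW' hx''.1, γ, rfl, hx''.2⟩
  obtain ⟨U, hU, γ, hγ⟩ := freq_ultra hfr
  have hB := BB hO hW hY hc hy
  have hB2 := eventually_eventually_nhds.mpr hB
  have hyγ : ∀ δ : Gam, y * io δ ∈ Y := fun δ => hY.2.2.1.2 y hy δ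
  have hs : ∀ᶠ F in (U : Filter M3), ∃ σ : ℝ, F = act J y + σ • act E33 y := by
    filter_upwards [hγ, hU hB] with F a b
    exact b (y * io (γ F)) (h0 _ (hyγ _)) (by rw [act_mul, a.1])
  obtain ⟨σ, hσ⟩ := hs.choice
  have hσ0 : ∀ᶠ F in (U : Filter M3), σ F ≠ 0 := by
    filter_upwards [hγ, hσ] with F a b h
    rw [h, zero_smul, add_zero] at b
    exact a.2 b
  have hlim : Tendsto σ U (𝓝 0) := by
    apply coef_lim (z := y)
    rw [zero_smul]
    have a1 : Tendsto (fun F : M3 => F - act J y) U (𝓝 (act J y - act J y)) :=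
      (tendsto_id.mono_left hU).sub_const (act J y)
    rw [sub_self] at a1
    refine a1.congr' (hσ.mono fun F hF => ?_)
    rw [sub_eq_iff_eq_add']; exact hF
  have hE : ∀ᶠ F in (U : Filter M3), act (act E33 y) (io (γ F)) = act E33 y := by
    filter_upwards [hγ, hσ, hU hB2] with F a b c
    have l1 : Tendsto (fun F' : M3 => act F' (io (γ F))) U (𝓝 F) := by
      have := ((continuous_actl (io (γ F))).tendsto (act J y)).mono_left hU
      rwa [a.1] at this
    obtain ⟨F', ⟨d1, d2⟩, d3, d4⟩ := ((hγ.and hσ).and ((hσ0).and (l1.eventually c))).exists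
    obtain ⟨σ', hσ'⟩ := d4 (y * io (γ F') * io (γ F)) (hO.inv.2 _ (h0 _ (hyγ _)) _)
      (by rw [act_mul, act_mul, d1.1])
    rw [d2, act_add, act_smul, a.1] at hσ'
    apply period2 hT hu (lam := (σ F')⁻¹ * (σ' - σ F)) (σ := σ F) _ (by rw [a.1]; exact b)
    rw [mul_smul, sub_smul, eq_inv_smul_iff₀ d3, eq_sub_iff_add_eq', ← add_right_inj (act J y), ← add_assoc, ← b, hσ']
  refine hW (affW U hO hY hς h0 h1 hy (x := fun F => y * io (γ F)) (σ := σ) (lam := fun _ => 1)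
    (Eventually.of_forall fun F => hyγ _) ?_ ?_ tendsto_const_nhds hlim (hσ0.mono fun F h1 h2 => h1 h2.2))
  · filter_upwards [hγ, hσ] with F a b
    rw [act_mul, a.1]; exact b
  · filter_upwards [hE] with F a
    rw [act_mul, a, one_smul]

theorem core {g0 : G} {f : ℝ →+ ℝ} (hf : ∀ c : ℝ, mp f (act J g0) ≠ c • act J g0) :
    Win (OC (act J g0)) := by
  by_contra hW
  have hO := OC_ok (act J g0)
  have hne : (XX (OC (act J g0))).Nonempty :=
    ⟨g0, mem_XX.mpr (subset_closure ⟨1, by rw [map_one, act_one]⟩)⟩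
  obtain ⟨Xm, hXO, hX⟩ := HH_min hO.closed hne hO.inv
  have hni := fun y (hy : y ∈ Xm) => nonisolated hf hX hXO hy
  set O := OC (act J g0) with hOdef
  obtain ⟨z0, hz0⟩ := hX.2.1
  obtain ⟨U, hU, x, hx⟩ := freq_ultra (hni z0 hz0)
  have hxl : Tendsto (fun F => act J (x F)) U (𝓝 (act J z0)) := by
    have : Tendsto (fun F : M3 => F) U (𝓝 (act J z0)) := tendsto_id.mono_left hU
    exact this.congr' (hx.mono fun F h => h.2.1.symm)
  obtain ⟨ς, hς, z1, hz1, hz1'⟩ := UB0 U hO hX.1 hX.2.2.1 hz0 x (hx.mono fun F h => h.1) hxl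
    (hx.mono fun F h => by rw [h.2.1]; exact h.2.2)
  have hEc : IsClosed (Xm ∩ tr (-ς) (XX O)) := hX.1.inter (tr_closed hO.closed)
  have hOV : Inv V1 (XX O) := ⟨fun y hy h hh => hO.inv.1 y hy h (by obtain ⟨t, rfl⟩ := hh; exact v1_mem_HH t), hO.inv.2⟩
  have hXV : Inv V1 Xm := ⟨fun y hy h hh => hX.2.2.1.1 y hy h (by obtain ⟨t, rfl⟩ := hh; exact v1_mem_HH t), hX.2.2.1.2⟩
  have hOt := tr_inv (s := -ς) hOV
  have hEi : Inv V1 (Xm ∩ tr (-ς) (XX O)) :=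
    ⟨fun y hy h hh => ⟨hXV.1 y hy.1 h hh, hOt.1 y hy.2 h hh⟩, fun y hy γ => ⟨hXV.2 y hy.1 γ, hOt.2 y hy.2 γ⟩⟩
  obtain ⟨Y, hYE, hY, hc⟩ := U4 hEc ⟨z1, hz1, mem_tr.mpr (by rwa [neg_neg])⟩ hEi
  have h0 : ∀ y ∈ Y, y ∈ XX O := fun y hy => hXO (hYE hy).1
  have h1 : ∀ y ∈ Y, v2 ς * y ∈ XX O := fun y hy => by
    have := mem_tr.mp (hYE hy).2
    rwa [neg_neg] at this
  obtain ⟨y, hy⟩ := hY.2.1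
  have hyX : y ∈ Xm := (hYE hy).1
  obtain ⟨T, hT, u, hu⟩ := periodic hO hW hY hc hς h0 h1 hy
  have hiso := case_a hO hW hY hc hς h0 h1 hy hT hu hX hyX
  have hB := BB hO hW hY hc hy
  obtain ⟨c, hcc⟩ := rigid hX hyX hiso (N := act E33 y)
    (act_symm (by ext i j; fin_cases i <;> fin_cases j <;> simp [E33]) y) (by
    intro δ hδ
    obtain ⟨U, hU, x, hx⟩ := freq_ultra (hni y hyX)
    have hl : Tendsto (fun F : M3 => act F (io δ)) U (𝓝 (act J y)) := by
      have := ((continuous_actl (io δ)).tendsto (act J y)).mono_left hU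
      rwa [hδ] at this
    obtain ⟨F, a, b, d⟩ := (hx.and ((hB.filter_mono hU).and (hl.eventually hB))).exists
    obtain ⟨σ, hσ⟩ := b _ a.1 a.2.1
    have hσ0 : σ ≠ 0 := by
      rintro rfl
      rw [zero_smul, add_zero] at hσ
      exact a.2.2 hσ
    obtain ⟨σ', hσ'⟩ := d (x F * io δ) (hO.inv.2 _ a.1 _) (by rw [act_mul, a.2.1])
    rw [hσ, act_add, hδ, act_smul, add_right_inj] at hσ'
    apply period2 hT hu (lam := σ⁻¹ * σ') (σ := 0) _ (by rw [hδ, zero_smul, add_zero])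
    rw [mul_smul, eq_inv_smul_iff₀ hσ0, hσ'])
  rw [← act_smul] at hcc
  have := act_inj hcc
  have e1 := congrFun (congrFun this 2) 2
  simp [E33, J] at e1

end Opp

namespace Opp
open Matrix Filter Topology
set_option linter.all false

lemma int_point {ι : Type*} [Fintype ι] {P : (ι → ℝ) → Prop} (ho : IsOpen {x | P x})
    (hs : ∀ x (c : ℝ), c ≠ 0 → P x → P (c • x)) (hx : ∃ x, P x) : ∃ m : ι → ℤ, P (fun i => (m i : ℝ)) := by
  have hd : DenseRange (fun q : ι → ℚ => fun i => ((q i : ℚ) : ℝ)) :=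
    DenseRange.piMap fun _ => Rat.denseRange_cast
  obtain ⟨q, hq⟩ := hd.exists_mem_open ho hx
  have hq : P (fun i => ((q i : ℚ) : ℝ)) := hq
  set D : ℕ := ∏ i, (q i).den with hD
  have hD0 : D ≠ 0 := Finset.prod_ne_zero_iff.mpr fun i _ => (q i).den_nz
  have hm : ∀ i, ∃ m : ℤ, (m : ℝ) = (D : ℝ) * ((q i : ℚ) : ℝ) := by
    intro i
    obtain ⟨e, he⟩ : (q i).den ∣ D := Finset.dvd_prod_of_mem _ (Finset.mem_univ i)
    refine ⟨e * (q i).num, ?_⟩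
    have h1 : ((q i).den : ℚ) * q i = (q i).num := Rat.den_mul_eq_num (q i)
    have h2 : ((q i).den : ℝ) * ((q i : ℚ) : ℝ) = (q i).num := by exact_mod_cast h1
    rw [he]; push_cast; rw [← h2]; ring
  choose m hm using hm
  refine ⟨m, ?_⟩
  have := hs _ (D : ℝ) (by exact_mod_cast hD0) hq
  convert this using 1
  ext i; rw [hm]; rfl

/-- value of a form -/
def qv {ι : Type*} [Fintype ι] (F : Matrix ι ι ℝ) (v : ι → ℝ) : ℝ := v ⬝ᵥ (F *ᵥ v)

lemma qv_act (F : M3) (g : G) (v : Fin 3 → ℝ) : qv (act F g) v = qv F ((g : M3) *ᵥ v) := by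
  unfold qv act
  rw [Matrix.mul_assoc, ← Matrix.mulVec_mulVec, Matrix.dotProduct_mulVec, Matrix.vecMul_transpose, Matrix.mulVec_mulVec]

lemma qv_J (v : Fin 3 → ℝ) : qv J v = 2 * v 0 * v 2 - v 1 ^ 2 := by
  simp [qv, J, dotProduct, Matrix.mulVec, Fin.sum_univ_three]; ring
lemma qv_E (v : Fin 3 → ℝ) : qv E33 v = v 2 ^ 2 := by
  simp [qv, E33, dotProduct, Matrix.mulVec, Fin.sum_univ_three]; ring

lemma continuous_qv {ι : Type*} [Fintype ι] (v : ι → ℝ) : Continuous (fun F : Matrix ι ι ℝ => qv F v) := by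
  unfold qv; fun_prop

lemma prim_line {b k x : ℤ} {p : Fin 3 → ℤ} {i j : Fin 3} (hij : i ≠ j) (hi : p i = k * b * b) (hj : p j = k * b * x + 1) :
    Prim p := by
  refine ⟨Pi.single i (k * x^2) + Pi.single j (1 - k * b * x), ?_⟩
  rw [add_dotProduct, single_dotProduct, single_dotProduct, hi, hj]
  ring

lemma big_k {A B C a c : ℝ} (hA : 0 < A) (ha : a ≠ 0) : ∃ k : ℕ, -A * k^2 + B * k + C ≤ 0 ∧ a * k + c ≠ 0 := by
  obtain ⟨k, hk⟩ := exists_nat_gt ((|B| + |C|) / A + |c| / |a| + 1)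
  have ha' := abs_pos.mpr ha
  have h1 : 0 ≤ (|B| + |C|) / A := by positivity
  have h2 : 0 ≤ |c| / |a| := by positivity
  have h3 : (|B| + |C|) / A < k := by linarith
  have h4 : |c| / |a| < k := by linarith
  have h5 : (1:ℝ) < k := by linarith
  rw [div_lt_iff₀ hA] at h3
  rw [div_lt_iff₀ ha'] at h4
  refine ⟨k, ?_, ?_⟩
  · have := le_abs_self B; have := le_abs_self C; have := abs_nonneg C; have := abs_nonneg B
    nlinarith [mul_le_mul_of_nonneg_right (le_abs_self B) (by linarith : (0:ℝ) ≤ k)]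
  · intro h
    have : |c| = k * |a| := by
      rw [show c = -(a*k) by linarith, abs_neg, abs_mul, abs_of_pos (by linarith : (0:ℝ) < k), mul_comm]
    linarith

lemma good_p (w : G) {ε : ℝ} (hε : ε = 1 ∨ ε = -1) (r : ℝ) : ∃ p : Fin 3 → ℤ, Prim p ∧
    0 ≤ ε * (r - qv J ((w : M3) *ᵥ rv p)) ∧ ((w : M3) *ᵥ rv p) 2 ≠ 0 := by
  have hε2 : ε * ε = 1 := by rcases hε with rfl | rfl <;> norm_num
  have hc : Continuous (fun x : Fin 3 → ℝ => (w : M3) *ᵥ x) := by fun_prop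
  obtain ⟨m, hm1, hm2⟩ := int_point (P := fun x : Fin 3 → ℝ => ε * qv J ((w : M3) *ᵥ x) < 0 ∧ ((w : M3) *ᵥ x) 2 ≠ 0)
    (by
      apply IsOpen.and
      · simp only [qv_J]
        exact isOpen_lt (by fun_prop) continuous_const
      · exact isOpen_ne_fun (by fun_prop) continuous_const)
    (by
      rintro x c hc ⟨h1, h2⟩
      rw [Matrix.mulVec_smul]
      constructor
      · rw [qv_J] at h1 ⊢
        simp only [Pi.smul_apply, smul_eq_mul]
        have : 0 < c^2 := by positivity
        nlinarith
      · simpa [hc] using h2)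
    ⟨((w⁻¹ : G) : M3) *ᵥ ![-ε, 0, 1], by
      rw [(inv_mulVec w _ _).mpr rfl, qv_J]
      simp; nlinarith⟩
  have hm0 : ∃ i, m i ≠ 0 := by
    by_contra hcon
    push Not at hcon
    apply hm2
    simp [Matrix.mulVec, dotProduct, hcon]
  obtain ⟨i, hi⟩ := hm0
  obtain ⟨j, hij⟩ : ∃ j : Fin 3, i ≠ j := ⟨i + 1, by fin_cases i <;> decide⟩
  set b := m i with hb
  set v := (w : M3) *ᵥ rv m with hv
  set e := (w : M3) *ᵥ rv (Pi.single j 1) with he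
  have hbR : (b : ℝ) ≠ 0 := by exact_mod_cast hi
  have hv1 : ε * qv J v < 0 := hm1
  have hv2 : v 2 ≠ 0 := hm2
  rw [qv_J] at hv1
  obtain ⟨k, hk1, hk2⟩ := big_k (A := -(ε * (2 * v 0 * v 2 - v 1 ^ 2)) * b^2)
    (B := ε * (2 * b * (v 0 * e 2 + v 2 * e 0 - v 1 * e 1))) (C := ε * (2 * e 0 * e 2 - e 1 ^2 - r)) (a := b * v 2) (c := e 2)
    (mul_pos (by linarith) (by positivity)) (mul_ne_zero hbR hv2)
  have hw : (w : M3) *ᵥ rv (((k:ℤ) * b) • m + Pi.single j 1) = ((k:ℝ) * b) • v + e := by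
    rw [hv, he, ← Matrix.mulVec_smul, ← Matrix.mulVec_add]
    congr 1
    ext l; simp [rv, Pi.single_apply]
  refine ⟨((k:ℤ) * b) • m + Pi.single j 1, ?_, ?_, ?_⟩
  · apply prim_line (b := b) (k := k) (x := m j) hij
    · simp [hij, hb]
    · simp
  · rw [hw, qv_J]
    simp only [Pi.add_apply, Pi.smul_apply, smul_eq_mul]
    nlinarith
  · rw [hw]
    simp only [Pi.add_apply, Pi.smul_apply, smul_eq_mul]
    intro h; apply hk2; linarith

theorem values {Q0 : M3} (hW : Win (OC Q0)) : ∀ r : ℝ, r ∈ closure {x : ℝ | ∃ p, Prim p ∧ x = qv Q0 (rv p)} := by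
  intro r
  obtain ⟨w, ε, hε, h⟩ := hW
  have hε2 : ε * ε = 1 := by rcases hε with rfl | rfl <;> norm_num
  obtain ⟨p, hp, h1, h2⟩ := good_p w hε r
  set v := (w : M3) *ᵥ rv p with hv
  have hs : 0 ≤ ε * (r - qv J v) / (2 * v 2 ^ 2) := by positivity
  have hmem := (mem_XX_v2 _ _).mp (h _ hs)
  have e1 : qv (act J w + (2 * (ε * (ε * (r - qv J v) / (2 * v 2 ^ 2)))) • act E33 w) (rv p) = r := by
    have : ∀ (A B : M3) (c : ℝ) (x : Fin 3 → ℝ), qv (A + c • B) x = qv A x + c * qv B x := by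
      intro A B c x
      simp [qv, Matrix.add_mulVec, Matrix.smul_mulVec]
    rw [this, qv_act, qv_act, ← hv, qv_E]
    field_simp
    linear_combination (r - qv J v) * hε2
  rw [← e1]
  refine map_mem_closure (f := fun F => qv F (rv p)) (continuous_qv _) hmem ?_
  rintro _ ⟨γ, rfl⟩
  exact ⟨_, hp.mul γ, by show qv (act Q0 (io γ)) (rv p) = _; rw [qv_act, rv_mulVec]⟩

end Opp

namespace Opp
open Matrix Filter Topology
set_option linter.all false

lemma cbrt (d : ℝ) : ∃ c : ℝ, c ^ 3 = d := by
  have h : ∀ x : ℝ, 0 ≤ x → ∃ c : ℝ, c^3 = x := fun x hx =>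
    ⟨x ^ ((3:ℕ) : ℝ)⁻¹, Real.rpow_inv_natCast_pow hx (by norm_num)⟩
  rcases le_total 0 d with h1 | h1
  · exact h d h1
  · obtain ⟨c, hc⟩ := h (-d) (by linarith)
    exact ⟨-c, by rw [Odd.neg_pow (by decide), hc, neg_neg]⟩

lemma bsym {ι : Type*} [Fintype ι] {F : Matrix ι ι ℝ} (hs : Fᵀ = F) (x y : ι → ℝ) : x ⬝ᵥ (F *ᵥ y) = y ⬝ᵥ (F *ᵥ x) := by
  rw [Matrix.dotProduct_mulVec, ← Matrix.mulVec_transpose, hs, dotProduct_comm]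

lemma isotropic {ι : Type*} [Fintype ι] {F : Matrix ι ι ℝ} (hs : Fᵀ = F) {v w : ι → ℝ} (hv : 0 < qv F v) (hw : qv F w < 0) :
    ∃ e, e ≠ 0 ∧ e ⬝ᵥ (F *ᵥ e) = 0 := by
  have hq : ∀ t : ℝ, (v + t • w) ⬝ᵥ (F *ᵥ (v + t • w)) = qv F w * (t * t) + (2 * (v ⬝ᵥ (F *ᵥ w))) * t + qv F v := by
    intro t
    simp only [Matrix.mulVec_add, Matrix.mulVec_smul, dotProduct_add, add_dotProduct, smul_dotProduct, dotProduct_smul, smul_eq_mul, qv, bsym hs w v]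
    ring
  obtain ⟨t, ht⟩ := exists_quadratic_eq_zero (a := qv F w) (b := 2 * (v ⬝ᵥ (F *ᵥ w))) (c := qv F v) hw.ne
    ⟨√(discrim (qv F w) (2 * (v ⬝ᵥ (F *ᵥ w))) (qv F v)), by
      rw [Real.mul_self_sqrt]; unfold discrim; nlinarith [sq_nonneg (2 * (v ⬝ᵥ (F *ᵥ w)))]⟩
  refine ⟨v + t • w, ?_, by rw [hq, ht]⟩
  intro h
  have : v = (-t) • w := by rw [neg_smul]; exact eq_neg_of_add_eq_zero_left h
  have h2 : qv F v = t^2 * qv F w := by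
    rw [this]; simp only [qv, Matrix.mulVec_smul, dotProduct_smul, smul_dotProduct, smul_eq_mul]; ring
  nlinarith [sq_nonneg t]

lemma hyp_pair {ι : Type*} [Fintype ι] [DecidableEq ι] {F : Matrix ι ι ℝ} (hs : Fᵀ = F) (hd : F.det ≠ 0) {e : ι → ℝ} (he : e ≠ 0)
    (h0 : e ⬝ᵥ (F *ᵥ e) = 0) : ∃ f, f ⬝ᵥ (F *ᵥ f) = 0 ∧ e ⬝ᵥ (F *ᵥ f) = 1 := by
  have hFe : F *ᵥ e ≠ 0 := fun h => he (Matrix.eq_zero_of_mulVec_eq_zero hd h)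
  have hpos : (F *ᵥ e) ⬝ᵥ (F *ᵥ e) ≠ 0 := fun h => hFe (dotProduct_self_eq_zero.mp h)
  set f0 := ((F *ᵥ e) ⬝ᵥ (F *ᵥ e))⁻¹ • (F *ᵥ e) with hf0
  have h1 : f0 ⬝ᵥ (F *ᵥ e) = 1 := by rw [hf0, smul_dotProduct, smul_eq_mul, inv_mul_cancel₀ hpos]
  refine ⟨f0 - ((f0 ⬝ᵥ (F *ᵥ f0)) / 2) • e, ?_, ?_⟩
  · simp only [Matrix.mulVec_sub, Matrix.mulVec_smul, dotProduct_sub, sub_dotProduct, smul_dotProduct, dotProduct_smul, smul_eq_mul, h0, h1, bsym hs e f0]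
    ring
  · simp only [Matrix.mulVec_sub, Matrix.mulVec_smul, dotProduct_sub, dotProduct_smul, smul_eq_mul, h0, h1, bsym hs e f0]
    ring

lemma norm3 {F : M3} (hs : Fᵀ = F) (hd : F.det ≠ 0) {v w : Fin 3 → ℝ} (hv : 0 < qv F v) (hw : qv F w < 0) :
    ∃ c : ℝ, c ≠ 0 ∧ ∃ g : G, F = c • act J g := by
  obtain ⟨e, he, h0⟩ := isotropic hs hv hw
  obtain ⟨f, hf, hef⟩ := hyp_pair hs hd he h0
  set g0 := crossProduct (F *ᵥ e) (F *ᵥ f) with hg0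
  have q1 : (F *ᵥ e) ⬝ᵥ g0 = 0 := dot_self_cross _ _
  have q2 : (F *ᵥ f) ⬝ᵥ g0 = 0 := dot_cross_self _ _
  have hdet : Matrix.det ![e, g0, f] = 1 := by
    rw [← triple_product_eq_det, triple_product_permutation, hg0, cross_dot_cross]
    rw [dotProduct_comm _ f, dotProduct_comm _ e, dotProduct_comm _ f, dotProduct_comm _ e, bsym hs f e, hef, hf, h0]
    ring
  set B : G := ⟨(Matrix.of ![e, g0, f])ᵀ, by rw [Matrix.det_transpose]; exact hdet⟩ with hB
  have hent : ∀ i j, act F B i j = (![e,g0,f] : Fin 3 → Fin 3 → ℝ) i ⬝ᵥ (F *ᵥ (![e,g0,f] : Fin 3 → Fin 3 → ℝ) j) := by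
    intro i j
    unfold act
    rw [Matrix.mul_assoc]
    rfl
  have q3 : e ⬝ᵥ (F *ᵥ g0) = 0 := by rw [bsym hs, dotProduct_comm]; exact q1
  have q4 : f ⬝ᵥ (F *ᵥ g0) = 0 := by rw [bsym hs, dotProduct_comm]; exact q2
  set κ := g0 ⬝ᵥ (F *ᵥ g0) with hκ
  have hK : act F B = !![0,0,1;0,κ,0;1,0,0] := by
    ext i j
    rw [hent]
    fin_cases i <;> fin_cases j <;> simp [h0, hf, hef, q3, q4, bsym hs g0 e, bsym hs g0 f, bsym hs f e, hκ]
  have hκd : κ = - F.det := by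
    rw [← act_det F B, hK]; simp [Matrix.det_fin_three]
  obtain ⟨c, hc⟩ := cbrt F.det
  have hc0 : c ≠ 0 := by rintro rfl; apply hd; rw [← hc]; norm_num
  obtain ⟨D, hD⟩ : ∃ D : G, (D : M3) = !![c⁻¹,0,0;0,c,0;0,0,1] := ⟨⟨_, by simp [Matrix.det_fin_three, hc0]⟩, rfl⟩
  refine ⟨c, hc0, D * B⁻¹, ?_⟩
  rw [act_mul, ← act_smul, ← act_smul]
  have : act (c • J) D = act F B := by
    rw [hK, hκd, ← hc]
    unfold act J
    rw [hD]
    ext i j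
    fin_cases i <;> fin_cases j <;> simp [Matrix.mul_apply, Fin.sum_univ_three, hc0]
    ring
  rw [this, act_inv_right]

/-- density for ternary forms -/
theorem ternary {F : M3} (hs : Fᵀ = F) (hd : F.det ≠ 0) {v w : Fin 3 → ℝ} (hv : 0 < qv F v) (hw : qv F w < 0)
    {f : ℝ →+ ℝ} (hf : ∀ c : ℝ, mp f F ≠ c • F) (r : ℝ) : r ∈ closure {x : ℝ | ∃ p, Prim p ∧ x = qv F (rv p)} := by
  obtain ⟨c, hc, g, rfl⟩ := norm3 hs hd hv hw
  have h1 := values (core (g0 := g) (f := f.comp (AddMonoidHom.mulLeft c)) (by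
    intro c' h
    apply hf (c' / c)
    rw [smul_smul, div_mul_cancel₀ _ hc, ← h]
    rfl)) (c⁻¹ * r)
  have h2 := map_mem_closure (f := fun x => c * x) (by fun_prop) h1 (t := {x : ℝ | ∃ p, Prim p ∧ x = qv (c • act J g) (rv p)}) (by
    rintro x ⟨p, hp, rfl⟩
    exact ⟨p, hp, by simp [qv, Matrix.smul_mulVec]⟩)
  rwa [mul_inv_cancel_left₀ hc] at h2

end Opp

namespace Opp
open Matrix Filter Topology
set_option linter.all false

lemma bl_lin {ι : Type*} [Fintype ι] (F : Matrix ι ι ℝ) (x y z : ι → ℝ) (s : ℝ) :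
    x ⬝ᵥ (F *ᵥ (y + s • z)) = x ⬝ᵥ (F *ᵥ y) + s * (x ⬝ᵥ (F *ᵥ z)) := by
  simp [Matrix.mulVec_add, Matrix.mulVec_smul]

lemma bl_sq {ι : Type*} [Fintype ι] {F : Matrix ι ι ℝ} (hs : Fᵀ = F) (y z : ι → ℝ) (s : ℝ) :
    (y + s • z) ⬝ᵥ (F *ᵥ (y + s • z)) = y ⬝ᵥ (F *ᵥ y) + 2 * s * (y ⬝ᵥ (F *ᵥ z)) + s^2 * (z ⬝ᵥ (F *ᵥ z)) := by
  simp only [Matrix.mulVec_add, Matrix.mulVec_smul, dotProduct_add, add_dotProduct, smul_dotProduct, dotProduct_smul, smul_eq_mul, bsym hs z y]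
  ring

lemma eq_zero_of_sq {ι : Type*} [Fintype ι] [DecidableEq ι] {F : Matrix ι ι ℝ} (hs : Fᵀ = F) (h : ∀ x, x ⬝ᵥ (F *ᵥ x) = 0) : F = 0 := by
  ext i j
  have h1 := bl_sq hs (Pi.single i 1) (Pi.single j 1) 1
  rw [h, h, h] at h1
  simp at h1
  simpa using h1

theorem goalA {n : ℕ} (hn : 3 ≤ n) {q N : Matrix (Fin n) (Fin n) ℝ} (hs : qᵀ = q) (hd : q.det ≠ 0)
    {v w : Fin n → ℝ} (hv : 0 < qv q v) (hw : qv q w < 0) (hN : Nᵀ = N) (hne : ∀ c : ℝ, N ≠ c • q) :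
    ∃ A : Matrix (Fin n) (Fin 3) ℝ, (Aᵀ * q * A).det ≠ 0 ∧ 0 < qv (Aᵀ * q * A) ![1,1,0] ∧ qv (Aᵀ * q * A) ![1,-1,0] < 0 ∧
      ∀ c : ℝ, Aᵀ * N * A ≠ c • (Aᵀ * q * A) := by
  obtain ⟨e, he, h0⟩ := isotropic hs hv hw
  obtain ⟨f, hf, hef⟩ := hyp_pair hs hd he h0
  have hfe : f ⬝ᵥ (q *ᵥ e) = 1 := by rw [bsym hs, hef]
  by_contra hcon
  push Not at hcon
  have key : ∀ w, e ⬝ᵥ (q *ᵥ w) = 0 → f ⬝ᵥ (q *ᵥ w) = 0 → w ⬝ᵥ (q *ᵥ w) ≠ 0 → 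
      e ⬝ᵥ (N *ᵥ e) = 0 ∧ f ⬝ᵥ (N *ᵥ f) = 0 ∧ e ⬝ᵥ (N *ᵥ w) = 0 ∧ f ⬝ᵥ (N *ᵥ w) = 0 ∧ 
      w ⬝ᵥ (N *ᵥ w) = (e ⬝ᵥ (N *ᵥ f)) * (w ⬝ᵥ (q *ᵥ w)) := by
    intro w h1 h2 h3
    set A : Matrix (Fin n) (Fin 3) ℝ := (Matrix.of ![e, f, w])ᵀ with hA
    have hent : ∀ (F : Matrix (Fin n) (Fin n) ℝ) i j, (Aᵀ * F * A) i j =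
        (![e,f,w] : Fin 3 → Fin n → ℝ) i ⬝ᵥ (F *ᵥ (![e,f,w] : Fin 3 → Fin n → ℝ) j) := by
      intro F i j
      rw [Matrix.mul_assoc]
      rfl
    have hK : Aᵀ * q * A = !![0,1,0;1,0,0;0,0,w ⬝ᵥ (q *ᵥ w)] := by
      ext i j
      rw [hent]
      fin_cases i <;> fin_cases j <;> simp [h0, hf, hef, hfe, h1, h2, bsym hs w e, bsym hs w f]
    obtain ⟨c, hc⟩ := hcon A (by rw [hK]; simpa [Matrix.det_fin_three] using h3)
      (by rw [hK]; simp [qv, Matrix.mulVec, dotProduct, Fin.sum_univ_three])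
      (by rw [hK]; simp [qv, Matrix.mulVec, dotProduct, Fin.sum_univ_three])
    rw [hK] at hc
    have c1 := congrFun (congrFun hc 0) 0
    have c2 := congrFun (congrFun hc 1) 1
    have c3 := congrFun (congrFun hc 0) 2
    have c4 := congrFun (congrFun hc 1) 2
    have c5 := congrFun (congrFun hc 2) 2
    have c6 := congrFun (congrFun hc 0) 1
    rw [hent] at c1 c2 c3 c4 c5 c6
    simp at c1 c2 c3 c4 c5 c6
    exact ⟨c1, c2, c3, c4, by rw [c5, c6]⟩
  -- a nonisotropic vector in the complement
  have hw0 : ∃ w0, e ⬝ᵥ (q *ᵥ w0) = 0 ∧ f ⬝ᵥ (q *ᵥ w0) = 0 ∧ w0 ⬝ᵥ (q *ᵥ w0) ≠ 0 := by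
    by_contra hcon2
    push Not at hcon2
    let L : (Fin n → ℝ) →ₗ[ℝ] (Fin 2 → ℝ) := Matrix.mulVecLin (Matrix.of ![e, f] * q)
    have hker := LinearMap.ker_ne_bot_of_finrank_lt (f := L) (by simp; omega)
    obtain ⟨w1, hw1, hw1n⟩ := Submodule.exists_mem_ne_zero_of_ne_bot hker
    have hL : Matrix.of ![e, f] *ᵥ (q *ᵥ w1) = 0 := by
      rw [Matrix.mulVec_mulVec]; exact hw1
    have k1 : e ⬝ᵥ (q *ᵥ w1) = 0 := congrFun hL 0
    have k2 : f ⬝ᵥ (q *ᵥ w1) = 0 := congrFun hL 1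
    apply hw1n
    apply Matrix.eq_zero_of_mulVec_eq_zero hd
    apply dotProduct_self_eq_zero.mp
    have all : ∀ x, x ⬝ᵥ (q *ᵥ w1) = 0 := by
      intro x
      set w2 := (x + (-(f ⬝ᵥ (q *ᵥ x))) • e) + (-(e ⬝ᵥ (q *ᵥ x))) • f with hw2
      have m1 : e ⬝ᵥ (q *ᵥ w2) = 0 := by rw [hw2, bl_lin, bl_lin, h0, hef]; ring
      have m2 : f ⬝ᵥ (q *ᵥ w2) = 0 := by rw [hw2, bl_lin, bl_lin, hf, hfe]; ring
      have m3 : w1 ⬝ᵥ (q *ᵥ w2) = 0 := by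
        have n1 := hcon2 (w1 + (1:ℝ) • w2) (by rw [bl_lin, k1, m1]; ring) (by rw [bl_lin, k2, m2]; ring)
        rw [bl_sq hs, hcon2 w1 k1 k2, hcon2 w2 m1 m2] at n1
        linarith
      rw [hw2, bl_lin, bl_lin, bsym hs w1 e, bsym hs w1 f, k1, k2] at m3
      rw [bsym hs]; linarith
    exact all _
  obtain ⟨w0, p1, p2, p3⟩ := hw0
  obtain ⟨r1, r2, r3, r4, r5⟩ := key w0 p1 p2 p3
  set c := e ⬝ᵥ (N *ᵥ f) with hc
  have key2 : ∀ w, e ⬝ᵥ (q *ᵥ w) = 0 → f ⬝ᵥ (q *ᵥ w) = 0 → e ⬝ᵥ (N *ᵥ w) = 0 ∧ f ⬝ᵥ (N *ᵥ w) = 0 ∧ 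
      w ⬝ᵥ (N *ᵥ w) = c * (w ⬝ᵥ (q *ᵥ w)) := by
    intro w h1 h2
    by_cases h3 : w ⬝ᵥ (q *ᵥ w) = 0
    swap
    · exact (key w h1 h2 h3).2.2
    obtain ⟨t, ht⟩ : ∃ t : ℝ, t ≠ 0 ∧ 2 * (w ⬝ᵥ (q *ᵥ w0)) + t * (w0 ⬝ᵥ (q *ᵥ w0)) ≠ 0 ∧
        2 * (w ⬝ᵥ (q *ᵥ w0)) - t * (w0 ⬝ᵥ (q *ᵥ w0)) ≠ 0 := by
      generalize w ⬝ᵥ (q *ᵥ w0) = b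
      generalize w0 ⬝ᵥ (q *ᵥ w0) = d at p3
      by_cases hb : b = 0
      · refine ⟨1, by norm_num, ?_, ?_⟩ <;> simpa [hb] using p3
      · refine ⟨b / d, div_ne_zero hb p3, ?_, ?_⟩ <;> rw [div_mul_cancel₀ _ p3]
        · intro h; apply hb; linarith
        · intro h; apply hb; linarith
    obtain ⟨t0, ht1, ht2⟩ := ht
    have a1 := key (w + t • w0) (by rw [bl_lin, h1, p1]; ring) (by rw [bl_lin, h2, p2]; ring) (by
      rw [bl_sq hs, h3]
      intro h; exact mul_ne_zero t0 ht1 (by linear_combination h))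
    have a2 := key (w + (-t) • w0) (by rw [bl_lin, h1, p1]; ring) (by rw [bl_lin, h2, p2]; ring) (by
      rw [bl_sq hs, h3]
      intro h; exact mul_ne_zero t0 ht2 (by linear_combination -h))
    obtain ⟨-, -, b3, b4, b5⟩ := a1
    obtain ⟨-, -, d3, d4, d5⟩ := a2
    rw [bl_lin] at b3 b4 d3 d4
    rw [bl_sq hs, bl_sq hN] at b5 d5
    refine ⟨by linarith, by linarith, ?_⟩
    linear_combination b5/2 + d5/2 - t^2 * r5
  apply hne c
  have hM : (N - c • q)ᵀ = N - c • q := by rw [Matrix.transpose_sub, Matrix.transpose_smul, hN, hs]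
  rw [← sub_eq_zero]
  apply eq_zero_of_sq hM
  intro x
  obtain ⟨w2, α, β, hx, m1, m2⟩ : ∃ w2 : Fin n → ℝ, ∃ α β : ℝ, x = (w2 + α • e) + β • f ∧ e ⬝ᵥ (q *ᵥ w2) = 0 ∧ f ⬝ᵥ (q *ᵥ w2) = 0 := by
    refine ⟨(x + (-(f ⬝ᵥ (q *ᵥ x))) • e) + (-(e ⬝ᵥ (q *ᵥ x))) • f, f ⬝ᵥ (q *ᵥ x), e ⬝ᵥ (q *ᵥ x), ?_, ?_, ?_⟩
    · module
    · rw [bl_lin, bl_lin, h0, hef]; ring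
    · rw [bl_lin, bl_lin, hf, hfe]; ring
  obtain ⟨k1, k2, k3⟩ := key2 w2 m1 m2
  have expand : ∀ F : Matrix (Fin n) (Fin n) ℝ, Fᵀ = F → x ⬝ᵥ (F *ᵥ x) = w2 ⬝ᵥ (F *ᵥ w2) + 2 * α * (e ⬝ᵥ (F *ᵥ w2)) + 
      α ^2 * (e ⬝ᵥ (F *ᵥ e)) + 2 * β * (f ⬝ᵥ (F *ᵥ w2) + α * (e ⬝ᵥ (F *ᵥ f))) + β^2 * (f ⬝ᵥ (F *ᵥ f)) := by
    intro F hF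
    rw [hx, bl_sq hF, bl_sq hF, bsym hF (w2 + α • e) f, bl_lin, bsym hF w2 e, bsym hF f e]
  rw [Matrix.sub_mulVec, dotProduct_sub, Matrix.smul_mulVec, dotProduct_smul, smul_eq_mul, expand q hs, expand N hN,
    k1, k2, k3, m1, m2, h0, hf, hef, r1, r2, ← hc]
  ring

end Opp

namespace Opp
open Matrix Filter Topology
set_option linter.all false

/-- real matrix of an integer matrix -/
def rm {α β : Type*} (A : Matrix α β ℤ) : Matrix α β ℝ := A.map (fun z : ℤ => (z : ℝ))

lemma rm_mul {α β κ : Type*} [Fintype β] (A : Matrix α β ℤ) (B : Matrix β κ ℤ) : rm (A * B) = rm A * rm B := by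
  ext i j; simp [rm, Matrix.mul_apply]

lemma map_conj {n m : ℕ} (f : ℝ →+ ℝ) (A : Matrix (Fin n) (Fin m) ℤ) (q : Matrix (Fin n) (Fin n) ℝ) :
    ((rm A)ᵀ * q * rm A).map f = (rm A)ᵀ * q.map f * rm A := by
  have e : ∀ a b : ℤ, ∀ x : ℝ, f ((a:ℝ) * x * b) = a * f x * b := by
    intro a b x
    rw [mul_comm, map_zmul, map_zmul, mul_comm]
  ext i j
  simp [Matrix.mul_apply, Finset.sum_mul, map_sum, rm, e]

theorem goalB {n : ℕ} {q N : Matrix (Fin n) (Fin n) ℝ} 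
    (h : ∃ A : Matrix (Fin n) (Fin 3) ℝ, (Aᵀ * q * A).det ≠ 0 ∧ 0 < qv (Aᵀ * q * A) ![1,1,0] ∧ qv (Aᵀ * q * A) ![1,-1,0] < 0 ∧
      ∀ c : ℝ, Aᵀ * N * A ≠ c • (Aᵀ * q * A)) :
    ∃ A : Matrix (Fin n) (Fin 3) ℤ, ((rm A)ᵀ * q * rm A).det ≠ 0 ∧ 0 < qv ((rm A)ᵀ * q * rm A) ![1,1,0] ∧
      qv ((rm A)ᵀ * q * rm A) ![1,-1,0] < 0 ∧ ∀ c : ℝ, (rm A)ᵀ * N * rm A ≠ c • ((rm A)ᵀ * q * rm A) := by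
  obtain ⟨A, h1, h2, h3, h4⟩ := h
  have hmin : ∃ i j k l, (Aᵀ * N * A) i j * (Aᵀ * q * A) k l - (Aᵀ * N * A) k l * (Aᵀ * q * A) i j ≠ 0 := by
    by_contra hcon
    push Not at hcon
    have hk : ∃ k l, (Aᵀ * q * A) k l ≠ 0 := by
      by_contra hz
      push Not at hz
      apply h1
      have : Aᵀ * q * A = 0 := by ext i j; exact hz i j
      rw [this, Matrix.det_zero]
    obtain ⟨k, l, hkl⟩ := hk
    apply h4 ((Aᵀ * N * A) k l / (Aᵀ * q * A) k l)
    ext i j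
    have := hcon i j k l
    rw [Matrix.smul_apply, smul_eq_mul, div_mul_eq_mul_div, eq_div_iff hkl]
    linarith
  obtain ⟨i, j, k, l, hm⟩ := hmin
  let μ : (Fin n × Fin 3 → ℝ) → Matrix (Fin n) (Fin 3) ℝ := fun x => Matrix.of fun a b => x (a, b)
  have hμ : Continuous μ := by
    refine continuous_matrix fun a b => ?_
    exact continuous_apply (a, b)
  have hc : ∀ F : Matrix (Fin n) (Fin n) ℝ, Continuous (fun x => (μ x)ᵀ * F * μ x) := by intro F; fun_prop
  have hsm : ∀ (F : Matrix (Fin n) (Fin n) ℝ) x (c : ℝ), (μ (c • x))ᵀ * F * μ (c • x) = c^2 • ((μ x)ᵀ * F * μ x) := by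
    intro F x c
    have : μ (c • x) = c • μ x := rfl
    rw [this, Matrix.transpose_smul, Matrix.smul_mul, Matrix.smul_mul, Matrix.mul_smul, smul_smul, sq]
  have hqv : ∀ (c : ℝ) (F : M3) v, qv (c • F) v = c * qv F v := by
    intro c F v; simp [qv, Matrix.smul_mulVec]
  obtain ⟨m, m1, m2, m3, m4⟩ := int_point (P := fun x => ((μ x)ᵀ * q * μ x).det ≠ 0 ∧ 0 < qv ((μ x)ᵀ * q * μ x) ![1,1,0] ∧
      qv ((μ x)ᵀ * q * μ x) ![1,-1,0] < 0 ∧ 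
      ((μ x)ᵀ * N * μ x) i j * ((μ x)ᵀ * q * μ x) k l - ((μ x)ᵀ * N * μ x) k l * ((μ x)ᵀ * q * μ x) i j ≠ 0)
    (by
      refine (isOpen_ne_fun (hc q).matrix_det continuous_const).and ((isOpen_lt continuous_const ((continuous_qv _).comp (hc q))).and
        ((isOpen_lt ((continuous_qv _).comp (hc q)) continuous_const).and (isOpen_ne_fun ?_ continuous_const)))
      exact (((hc N).matrix_elem i j).mul ((hc q).matrix_elem k l)).sub (((hc N).matrix_elem k l).mul ((hc q).matrix_elem i j)))
    (by
      rintro x c hc0 ⟨a1, a2, a3, a4⟩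
      simp only [hsm, hqv, Matrix.det_smul, Matrix.smul_apply, smul_eq_mul]
      have : 0 < c^2 := by positivity
      refine ⟨mul_ne_zero (by positivity) a1, mul_pos this a2, mul_neg_of_pos_of_neg this a3, ?_⟩
      intro h
      apply mul_ne_zero (mul_ne_zero this.ne' this.ne') a4
      rw [← h]; ring)
    ⟨fun p => A p.1 p.2, h1, h2, h3, hm⟩
  refine ⟨Matrix.of fun a b => m (a, b), m1, m2, m3, ?_⟩
  intro c hcc
  apply m4
  have hcc : (μ fun i => (m i : ℝ))ᵀ * N * (μ fun i => (m i : ℝ)) = c • ((μ fun i => (m i : ℝ))ᵀ * q * (μ fun i => (m i : ℝ))) := hcc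
  rw [hcc, Matrix.smul_apply, Matrix.smul_apply, smul_eq_mul, smul_eq_mul]
  ring

theorem goalC {n : ℕ} (A : Matrix (Fin n) (Fin 3) ℤ) (hA : Function.Injective A.mulVecLin) :
    ∃ (A' : Matrix (Fin n) (Fin 3) ℤ) (C : Matrix (Fin 3) (Fin 3) ℤ), A = A' * C ∧
      ∀ p, Prim p → Finset.univ.gcd (A' *ᵥ p) = 1 := by
  obtain ⟨k, bM, bN, φ, a, snf⟩ := Submodule.smithNormalForm (Pi.basisFun ℤ (Fin n)) (LinearMap.range A.mulVecLin)
  have hk : k = 3 := by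
    have h1 := Module.finrank_eq_card_basis bN
    rw [LinearMap.finrank_range_of_inj hA] at h1
    simpa using h1.symm
  subst hk
  refine ⟨Matrix.of fun i j => bM (φ j) i, Matrix.of fun i j => bN.repr ⟨A *ᵥ (Pi.single j 1), ⟨_, rfl⟩⟩ i * a i, ?_, ?_⟩
  · ext i j
    have h1 := bN.sum_repr ⟨A *ᵥ (Pi.single j 1), ⟨_, rfl⟩⟩
    have h2 := congrArg (fun z : LinearMap.range A.mulVecLin => (z : Fin n → ℤ) i) h1
    simp only [AddSubmonoidClass.coe_finset_sum, Submodule.coe_smul, snf, Finset.sum_apply, Pi.smul_apply, smul_eq_mul] at h2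
    have h3 : (A *ᵥ (Pi.single j 1)) i = A i j := by rw [Matrix.mulVec_single_one]; rfl
    simp only [Matrix.mul_apply, Matrix.of_apply]
    rw [← h3, ← h2]
    exact Finset.sum_congr rfl fun x _ => by ring
  · rintro p ⟨κ, hκ⟩
    set m := (Matrix.of fun i j => bM (φ j) i : Matrix (Fin n) (Fin 3) ℤ) *ᵥ p with hm
    have hm' : m = ∑ j, p j • bM (φ j) := by
      ext i; simp [hm, Matrix.mulVec, dotProduct, mul_comm]
    set d := Finset.univ.gcd m with hd
    have hdv : ∀ i, ∃ t, m i = d * t := fun i => Finset.gcd_dvd (Finset.mem_univ i)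
    choose m' hm1 using hdv
    have hm2 : m = d • m' := by ext i; rw [hm1]; simp
    have hp : ∀ j, d ∣ p j := by
      intro j
      have e1 : bM.repr m (φ j) = p j := by
        rw [hm', map_sum, Finset.sum_apply']
        simp only [map_smul, Module.Basis.repr_self, Finsupp.smul_apply, Finsupp.single_apply, EmbeddingLike.apply_eq_iff_eq]
        simp
      rw [← e1, hm2, map_smul]
      exact ⟨_, rfl⟩
    have hone : d ∣ 1 := by
      rw [← hκ]
      exact Finset.dvd_sum fun j _ => (hp j).mul_left _
    have := Int.isUnit_iff.mp (isUnit_of_dvd_one hone)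
    rcases this with h | h
    · exact h
    · have hn := Int.nonneg_of_normalize_eq_self (Finset.normalize_gcd (s := Finset.univ) (f := m))
      rw [← hd, h] at hn
      norm_num at hn

theorem goalD {n : ℕ} {q : Matrix (Fin n) (Fin n) ℝ} (h : ¬ ∃ (c : ℝ) (M : Matrix (Fin n) (Fin n) ℤ), q = c • rm M) :
    ∃ f : ℝ →+ ℝ, ∀ c : ℝ, q.map f ≠ c • q := by
  by_contra hcon
  push Not at hcon
  have hk : ∃ k l, q k l ≠ 0 := by
    by_contra hz
    push Not at hz
    exact h ⟨0, 0, by ext i j; simp [hz]⟩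
  obtain ⟨k, l, hkl⟩ := hk
  have : ∃ φ : Module.Dual ℚ ℝ, φ (q k l) ≠ 0 := by
    by_contra hz
    push Not at hz
    exact hkl ((Module.forall_dual_apply_eq_zero_iff ℚ _).mp hz)
  obtain ⟨φ, hφ⟩ := this
  obtain ⟨c, hc⟩ := hcon ((Rat.castHom ℝ).toAddMonoidHom.comp φ.toAddMonoidHom)
  have hc' : ∀ i j, ((φ (q i j) : ℚ) : ℝ) = c * q i j := fun i j => congrFun (congrFun hc i) j
  have hc0 : c ≠ 0 := by
    rintro rfl
    have := hc' k l
    rw [zero_mul] at this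
    exact hφ (by exact_mod_cast this)
  set D : ℕ := ∏ i, ∏ j, (φ (q i j)).den with hD
  have hD0 : D ≠ 0 := Finset.prod_ne_zero_iff.mpr fun i _ => Finset.prod_ne_zero_iff.mpr fun j _ => (φ (q i j)).den_nz
  have hD0' : (D : ℝ) ≠ 0 := by exact_mod_cast hD0
  have hm : ∀ i j, ∃ m : ℤ, (m : ℝ) = (D : ℝ) * (c * q i j) := by
    intro i j
    obtain ⟨e, he⟩ : (φ (q i j)).den ∣ D :=
      (Finset.dvd_prod_of_mem (fun j => (φ (q i j)).den) (Finset.mem_univ j)).trans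
        (Finset.dvd_prod_of_mem (fun i => ∏ j, (φ (q i j)).den) (Finset.mem_univ i))
    refine ⟨e * (φ (q i j)).num, ?_⟩
    have h1 : ((φ (q i j)).den : ℚ) * φ (q i j) = (φ (q i j)).num := Rat.den_mul_eq_num _
    have h2 : ((φ (q i j)).den : ℝ) * ((φ (q i j) : ℚ) : ℝ) = (φ (q i j)).num := by exact_mod_cast h1
    rw [← hc', he]; push_cast; rw [← h2]; ring
  choose M hM using hm
  refine h ⟨(D * c)⁻¹, Matrix.of M, ?_⟩
  ext i j
  simp only [rm, Matrix.smul_apply, Matrix.map_apply, Matrix.of_apply, hM, smul_eq_mul]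
  field_simp

end Opp

namespace Opp
open Matrix
set_option linter.all false
theorem main_thm (n : ℕ) (hn : 3 ≤ n) (Q : QuadraticForm ℝ (Fin n → ℝ))
    (hnondeg : ∀ v : Fin n → ℝ, (∀ w : Fin n → ℝ, QuadraticMap.polar (⇑Q) v w = 0) → v = 0)
    (hindef : (∃ v : Fin n → ℝ, 0 < Q v) ∧ (∃ w : Fin n → ℝ, Q w < 0))
    (hirrational : ¬ ∃ (c : ℝ) (M : Matrix (Fin n) (Fin n) ℤ),
      ∀ x : Fin n → ℝ, Q x = c * ∑ i, ∑ j, (M i j : ℝ) * x i * x j) :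
    Dense {r : ℝ | ∃ m : Fin n → ℤ,
      Finset.univ.gcd m = 1 ∧ Q (fun i => (m i : ℝ)) = r} := by
  set q : Matrix (Fin n) (Fin n) ℝ := QuadraticForm.toMatrix' Q with hq
  have hs : qᵀ = q := QuadraticForm.isSymm_toMatrix' Q
  have hass : ∀ x y, x ⬝ᵥ (q *ᵥ y) = QuadraticMap.associated Q x y := by
    intro x y
    rw [hq, QuadraticForm.toMatrix', ← Matrix.toLinearMap₂'_apply', Matrix.toLinearMap₂'_toMatrix']
  have hQ : ∀ x, qv q x = Q x := by
    intro x
    rw [qv, hass, QuadraticMap.associated_eq_self_apply]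
  have hpol : ∀ x y, QuadraticMap.polar Q x y = 2 * (x ⬝ᵥ (q *ᵥ y)) := by
    intro x y
    have h1 := bl_sq hs x y 1
    rw [one_smul] at h1
    have e1 := hQ (x + y); have e2 := hQ x; have e3 := hQ y
    unfold qv at e1 e2 e3
    rw [QuadraticMap.polar, ← e1, ← e2, ← e3, h1]
    ring
  have hd : q.det ≠ 0 := by
    intro h
    obtain ⟨v, hv, hv2⟩ := Matrix.exists_mulVec_eq_zero_iff.mpr h
    apply hv
    apply hnondeg
    intro w
    rw [hpol, bsym hs, hv2, dotProduct_zero, mul_zero]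
  obtain ⟨⟨v, hv⟩, w, hw⟩ := hindef
  rw [← hQ] at hv hw
  obtain ⟨f, hf⟩ := goalD (q := q) (by
    rintro ⟨c, M, hM⟩
    refine hirrational ⟨c, M, fun x => ?_⟩
    rw [← hQ, hM]
    simp only [qv, rm, dotProduct, Matrix.mulVec, Matrix.smul_apply, smul_eq_mul, Matrix.map_apply, Finset.mul_sum]
    refine Finset.sum_congr rfl fun i _ => Finset.sum_congr rfl fun j _ => by ring)
  obtain ⟨A, h1, h2, h3, h4⟩ := goalB (goalA hn hs hd hv hw (N := q.map f)
    (by rw [← Matrix.transpose_map, hs]) hf)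
  have hinj : Function.Injective A.mulVecLin := by
    rw [← LinearMap.ker_eq_bot, LinearMap.ker_eq_bot']
    intro x hx
    have hx : A *ᵥ x = 0 := hx
    have hx2 : rm A *ᵥ (rv x) = 0 := by
      ext i
      have := congrFun hx i
      simp only [Matrix.mulVec, dotProduct, rm, rv, Matrix.map_apply, Pi.zero_apply] at this ⊢
      exact_mod_cast this
    have hx3 := Matrix.eq_zero_of_mulVec_eq_zero h1 (v := rv x) (by
      rw [← Matrix.mulVec_mulVec, hx2, Matrix.mulVec_zero])
    ext i
    have := congrFun hx3 i
    simpa [rv] using this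
  obtain ⟨A', C, rfl, hprim⟩ := goalC A hinj
  set F : M3 := (rm A')ᵀ * q * rm A' with hF
  have hFC : (rm (A' * C))ᵀ * q * rm (A' * C) = (rm C)ᵀ * F * rm C := by
    rw [rm_mul, Matrix.transpose_mul, hF]; simp only [Matrix.mul_assoc]
  have hval : ∀ x, qv ((rm C)ᵀ * F * rm C) x = qv F (rm C *ᵥ x) := by
    intro x
    unfold qv
    rw [Matrix.mul_assoc, ← Matrix.mulVec_mulVec, Matrix.dotProduct_mulVec, Matrix.vecMul_transpose, Matrix.mulVec_mulVec]
  have hval2 : ∀ x, qv F x = qv q (rm A' *ᵥ x) := by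
    intro x
    unfold qv
    rw [hF, Matrix.mul_assoc, ← Matrix.mulVec_mulVec, Matrix.dotProduct_mulVec, Matrix.vecMul_transpose, Matrix.mulVec_mulVec]
  rw [← map_conj, hFC] at h4
  rw [hFC] at h1 h2 h3
  rw [hval] at h2 h3
  have hFs : Fᵀ = F := by rw [hF]; simp [Matrix.transpose_mul, hs, Matrix.mul_assoc]
  have hFd : F.det ≠ 0 := by
    intro h
    apply h1
    rw [Matrix.det_mul, Matrix.det_mul, h, mul_zero, zero_mul]
  have hff : ∀ c : ℝ, mp f F ≠ c • F := by
    intro c h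
    apply h4 c
    rw [map_conj]
    rw [mp] at h
    rw [h, Matrix.mul_smul, Matrix.smul_mul]
  intro r
  refine closure_mono ?_ (ternary hFs hFd h2 h3 hff r)
  rintro x ⟨p, hp, rfl⟩
  refine ⟨A' *ᵥ p, hprim p hp, ?_⟩
  rw [hval2, ← hQ]
  congr 1
  ext i
  simp [Matrix.mulVec, dotProduct, rm, rv]
end Opp

/-- **Dani–Margulis**: values of a nondegenerate indefinite irrational quadratic form
in `n ≥ 3` variables at *primitive* integer vectors are dense in `ℝ`. -/
theorem oppenheim_primitive (n : ℕ) (hn : 3 ≤ n) (Q : QuadraticForm ℝ (Fin n → ℝ))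
    (hnondeg : ∀ v : Fin n → ℝ, (∀ w : Fin n → ℝ, QuadraticMap.polar (⇑Q) v w = 0) → v = 0)
    (hindef : (∃ v : Fin n → ℝ, 0 < Q v) ∧ (∃ w : Fin n → ℝ, Q w < 0))
    (hirrational : ¬ ∃ (c : ℝ) (M : Matrix (Fin n) (Fin n) ℤ),
      ∀ x : Fin n → ℝ, Q x = c * ∑ i, ∑ j, (M i j : ℝ) * x i * x j) :
    Dense {r : ℝ | ∃ m : Fin n → ℤ,
      Finset.univ.gcd m = 1 ∧ Q (fun i => (m i : ℝ)) = r} := by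
  exact Opp.main_thm n hn Q hnondeg hindef hirrational
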